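/- arXiv:1601.02819 — 5 statements merged into one kernel-verified Lean document; each statement's English description precedes it below -/
import Mathlib

section
/- Let n ≥ 1, s ∈ (0,1), β > 0 and let Ω ⊆ ℝⁿ be an open set. Let K satisfy the symmetry, growth and Hölder conditions (i)–(iii). Let f ∈ L²(Ω) and let u ∈ X(Ω) with ‖u‖_{L¹_β(ℝⁿ)} < ∞ be a solution of E_K(u,·) = f in Ω. Then for every ε > 0 with 0 < 2s − ε < 1 and every open set Ω′ whose closure is compact and contained in Ω, there exists a constant C > 0, depending only on n, s, β, λ, Λ, M, Γ, Ω, Ω′ and ε (and not on u or f), such that the Gagliardo seminorm satisfies ( ∫_{Ω′}∫_{Ω′} |u(x) − u(y)|² / |x−y|^{n + 2(2s−ε)} dx dy )^{1/2} ≤ C ( ‖u‖_{L²(Ω)} + ‖u‖_{L¹_β(ℝⁿ)} + ‖f‖_{L²(Ω)} ). -/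
open MeasureTheory Set Metric

noncomputable section

abbrev V (n : ℕ) : Type := EuclideanSpace ℝ (Fin n)

variable {n : ℕ}

/-- The cross-shaped set `C_Ω = (ℝⁿ×ℝⁿ) \ ((ℝⁿ\Ω)×(ℝⁿ\Ω))`. -/
def crossSet (Ω : Set (V n)) : Set (V n × V n) := {p | p.1 ∈ Ω ∨ p.2 ∈ Ω}

/-- Membership in the energy space `X(Ω)`. -/
def MemX (Ω : Set (V n)) (K : V n → V n → ℝ) (u : V n → ℝ) : Prop :=
  Measurable u ∧ IntegrableOn (fun x => u x ^ 2) Ω ∧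
    IntegrableOn (fun p : V n × V n => (u p.1 - u p.2) ^ 2 * K p.1 p.2) (crossSet Ω)

/-- Membership in `X₀(Ω)`: member of `X(Ω)` vanishing a.e. outside `Ω`. -/
def MemX0 (Ω : Set (V n)) (K : V n → V n → ℝ) (u : V n → ℝ) : Prop :=
  MemX Ω K u ∧ ∀ᵐ x ∂(volume : Measure (V n)), x ∉ Ω → u x = 0

/-- The bilinear form `E_K(u,φ)`. -/
def energyForm (K : V n → V n → ℝ) (u φ : V n → ℝ) : ℝ :=
  ∫ x, ∫ y, (u x - u y) * (φ x - φ y) * K x y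

/-- `u` is a weak solution of `E_K(u,·) = f` in `Ω`. -/
def IsSolution (Ω : Set (V n)) (K : V n → V n → ℝ) (u f : V n → ℝ) : Prop :=
  ∀ φ : V n → ℝ, MemX0 Ω K φ → energyForm K u φ = ∫ x in Ω, f x * φ x

/-- Symmetry of the kernel. -/
def KSym (K : V n → V n → ℝ) : Prop :=
  ∀ᵐ p ∂(volume : Measure (V n × V n)), K p.1 p.2 = K p.2 p.1

/-- Growth conditions (i) and (ii) on the kernel. -/
def KBounds (s β lam Lam M : ℝ) (K : V n → V n → ℝ) : Prop :=
  (∀ᵐ p ∂(volume : Measure (V n × V n)), ‖p.1 - p.2‖ < 1 →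
      lam ≤ ‖p.1 - p.2‖ ^ ((n : ℝ) + 2 * s) * K p.1 p.2 ∧
        ‖p.1 - p.2‖ ^ ((n : ℝ) + 2 * s) * K p.1 p.2 ≤ Lam) ∧
  ∀ᵐ p ∂(volume : Measure (V n × V n)), 1 ≤ ‖p.1 - p.2‖ →
      0 ≤ ‖p.1 - p.2‖ ^ ((n : ℝ) + β) * K p.1 p.2 ∧
        ‖p.1 - p.2‖ ^ ((n : ℝ) + β) * K p.1 p.2 ≤ M

/-- Hölder condition (iii) on the kernel (local translation regularity). -/
def KHolder (s Gam : ℝ) (K : V n → V n → ℝ) : Prop :=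
  ∀ᵐ q ∂(volume : Measure (V n × V n × V n)),
    ‖q.2.1 - q.2.2‖ < 1 → ‖q.1‖ < 1 →
      ‖q.2.1 - q.2.2‖ ^ ((n : ℝ) + 2 * s) *
          |K (q.2.1 + q.1) (q.2.2 + q.1) - K q.2.1 q.2.2| ≤ Gam * ‖q.1‖ ^ s

/-- The `L²` norm over a set `A`. -/
def L2norm (A : Set (V n)) (u : V n → ℝ) : ℝ := (∫ x in A, u x ^ 2) ^ ((1 : ℝ) / 2)

/-- The weighted norm `‖u‖_{L¹_{x₀,β}(ℝⁿ)}`. -/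
def wnorm (β : ℝ) (x₀ : V n) (u : V n → ℝ) : ℝ :=
  ∫ x, |u x| / (1 + ‖x - x₀‖ ^ ((n : ℝ) + β))

/-- Finiteness of the weighted norm `‖u‖_{L¹_{x₀,β}(ℝⁿ)}`. -/
def HasFiniteWnorm (β : ℝ) (x₀ : V n) (u : V n → ℝ) : Prop :=
  Integrable (fun x => |u x| / (1 + ‖x - x₀‖ ^ ((n : ℝ) + β)))

/-- The second difference `Δ_z² u(x) = u(x+2z) − 2u(x+z) + u(x)`. -/
def diff2 (z : V n) (u : V n → ℝ) (x : V n) : ℝ := u (x + 2 • z) - 2 * u (x + z) + u x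

/-- The set `U_{2z} = {x ∈ U : x+z ∈ U, x+2z ∈ U}`. -/
def shift2 (U : Set (V n)) (z : V n) : Set (V n) := {x ∈ U | x + z ∈ U ∧ x + 2 • z ∈ U}

/-- The truncated weight `|h|^{-(n+2s)} 1_{|h|<r}`. -/
def truncWeight (s r : ℝ) (h : V n) : ℝ :=
  if ‖h‖ < r then ‖h‖ ^ (-((n : ℝ) + 2 * s)) else 0

lemma truncWeight_nonneg (s r : ℝ) (h : V n) : 0 ≤ truncWeight s r h := by
  unfold truncWeight; split_ifs <;> positivity

lemma truncWeight_neg (s r : ℝ) (h : V n) : truncWeight s r (-h) = truncWeight s r h := by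
  simp [truncWeight]

lemma measurable_truncWeight (s r : ℝ) : Measurable (truncWeight s r : V n → ℝ) := by
  unfold truncWeight
  exact Measurable.ite (measurableSet_lt measurable_norm measurable_const)
    (measurable_norm.pow_const _) measurable_const

lemma integrableOn_norm_rpow_ball (hn : 1 ≤ n) {a : ℝ} (ha : 0 < a) {R : ℝ} (hR : 0 < R) :
    IntegrableOn (fun h : V n => ‖h‖ ^ (a - n)) (ball 0 R) := by
  have : Nonempty (Fin n) := ⟨⟨0, hn⟩⟩
  have : Nontrivial (V n) := inferInstance
  rw [integrableOn_fun_norm_addHaar (μ := volume) (f := fun t : ℝ => t ^ (a - n))]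
  have h := (intervalIntegral.integrableOn_Ioo_rpow_iff (s := a - 1) hR).2 (by linarith)
  refine h.congr_fun (fun t ht => ?_) measurableSet_Ioo
  simp only [finrank_euclideanSpace, Fintype.card_fin, smul_eq_mul]
  rw [← Real.rpow_natCast, ← Real.rpow_add ht.1, Nat.cast_sub hn]
  congr 1; push_cast; ring

lemma integrable_sq_mul_truncWeight (hn : 1 ≤ n) {s r : ℝ} (hs : s < 1) (hr : 0 < r) :
    Integrable (fun h : V n => ‖h‖ ^ 2 * truncWeight s r h) := by
  have h := integrableOn_norm_rpow_ball (n := n) hn (a := 2 - 2 * s) (by linarith) hr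
  rw [← integrable_indicator_iff measurableSet_ball] at h
  refine h.congr ?_
  have h0 : ∀ᵐ x : V n, x ≠ 0 := by
    have : Nonempty (Fin n) := ⟨⟨0, hn⟩⟩
    exact Measure.ae_ne volume 0
  filter_upwards [h0] with x hx
  by_cases hxr : ‖x‖ < r
  · rw [indicator_of_mem (by simpa using hxr)]
    simp only [truncWeight, hxr, if_true]
    rw [← Real.rpow_natCast, ← Real.rpow_add (norm_pos_iff.2 hx)]
    congr 1; push_cast; ring
  · rw [indicator_of_notMem (by simpa using hxr)]
    simp [truncWeight, hxr]

/-- The second moment of the truncated weight. -/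
def truncMoment (n : ℕ) (s r : ℝ) : ℝ := ∫ h : V n, ‖h‖ ^ 2 * truncWeight s r h

lemma truncMoment_nonneg (n : ℕ) (s r : ℝ) : 0 ≤ truncMoment n s r :=
  integral_nonneg fun h => mul_nonneg (by positivity) (truncWeight_nonneg s r h)

/-- The shear `(h, x) ↦ (h + x, x)`, adapted to kernels depending on `x - y`. -/
def shearEquiv (n : ℕ) : V n × V n ≃ᵐ V n × V n where
  toFun q := (q.1 + q.2, q.2)
  invFun p := (p.1 - p.2, p.2)
  left_inv q := by simp
  right_inv p := by simp
  measurable_toFun := by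
    change Measurable fun q : V n × V n => (q.1 + q.2, q.2)
    fun_prop
  measurable_invFun := by
    change Measurable fun p : V n × V n => (p.1 - p.2, p.2)
    fun_prop

lemma measurePreserving_shearEquiv :
    MeasurePreserving (shearEquiv n) volume volume :=
  measurePreserving_add_prod (volume : Measure (V n)) (volume : Measure (V n))

lemma integrable_shear_iff {F : V n × V n → ℝ} :
    Integrable (fun q : V n × V n => F (q.1 + q.2, q.2)) ↔ Integrable F :=
  measurePreserving_shearEquiv.integrable_comp_emb (shearEquiv n).measurableEmbedding

lemma integral_shear (F : V n × V n → ℝ) :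
    ∫ q : V n × V n, F (q.1 + q.2, q.2) = ∫ p, F p :=
  measurePreserving_shearEquiv.integral_comp' F

lemma integrable_swap_iff {F : V n × V n → ℝ} :
    Integrable (fun q : V n × V n => F (q.2, q.1)) ↔ Integrable F :=
  (Measure.measurePreserving_swap (μ := (volume : Measure (V n)))
    (ν := (volume : Measure (V n)))).integrable_comp_emb MeasurableEquiv.prodComm.measurableEmbedding

lemma integral_swap (F : V n × V n → ℝ) :
    ∫ q : V n × V n, F (q.2, q.1) = ∫ p, F p :=
  (Measure.measurePreserving_swap (μ := (volume : Measure (V n)))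
    (ν := (volume : Measure (V n)))).integral_comp MeasurableEquiv.prodComm.measurableEmbedding F

/-- The diagonal translation of the product space. -/
lemma measurePreserving_diagonal_add (z : V n) :
    MeasurePreserving (fun p : V n × V n => (p.1 + z, p.2 + z)) volume volume :=
  (measurePreserving_add_right volume z).prod (measurePreserving_add_right volume z)

lemma measurableEmbedding_diagonal_add (z : V n) :
    MeasurableEmbedding (fun p : V n × V n => (p.1 + z, p.2 + z)) :=
  ((MeasurableEquiv.addRight z).prodCongr (MeasurableEquiv.addRight z)).measurableEmbedding

lemma integrable_diagonal_add_iff (z : V n) {F : V n × V n → ℝ} :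
    Integrable (fun p : V n × V n => F (p.1 + z, p.2 + z)) ↔ Integrable F :=
  (measurePreserving_diagonal_add z).integrable_comp_emb (measurableEmbedding_diagonal_add z)

lemma integral_diagonal_add (z : V n) (F : V n × V n → ℝ) :
    ∫ p : V n × V n, F (p.1 + z, p.2 + z) = ∫ p, F p :=
  (measurePreserving_diagonal_add z).integral_comp (measurableEmbedding_diagonal_add z) F

lemma integrable_moment_snd (hn : 1 ≤ n) {s r : ℝ} (hs : s < 1) (hr : 0 < r) {F : V n → ℝ}
    (hF : Integrable F) :
    Integrable (fun p : V n × V n =>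
      F p.2 * (‖p.1 - p.2‖ ^ 2 * truncWeight s r (p.1 - p.2))) := by
  rw [← integrable_shear_iff]
  refine ((integrable_sq_mul_truncWeight hn hs hr).mul_prod hF).congr ?_
  filter_upwards with q
  simp; ring

lemma integral_moment_snd (s r : ℝ) (F : V n → ℝ) :
    ∫ p : V n × V n, F p.2 * (‖p.1 - p.2‖ ^ 2 * truncWeight s r (p.1 - p.2)) =
      truncMoment n s r * ∫ x, F x := by
  rw [← integral_shear, truncMoment, ← integral_prod_mul]
  refine integral_congr_ae ?_
  filter_upwards with q
  simp; ring

lemma integrable_moment_fst (hn : 1 ≤ n) {s r : ℝ} (hs : s < 1) (hr : 0 < r) {F : V n → ℝ}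
    (hF : Integrable F) :
    Integrable (fun p : V n × V n =>
      F p.1 * (‖p.1 - p.2‖ ^ 2 * truncWeight s r (p.1 - p.2))) := by
  rw [← integrable_swap_iff]
  refine (integrable_moment_snd hn hs hr hF).congr ?_
  filter_upwards with q
  rw [norm_sub_rev, ← truncWeight_neg, neg_sub]

lemma integral_moment_fst (s r : ℝ) (F : V n → ℝ) :
    ∫ p : V n × V n, F p.1 * (‖p.1 - p.2‖ ^ 2 * truncWeight s r (p.1 - p.2)) =
      truncMoment n s r * ∫ x, F x := by
  rw [← integral_swap, ← integral_moment_snd]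
  refine integral_congr_ae ?_
  filter_upwards with q
  rw [norm_sub_rev, ← truncWeight_neg, neg_sub]

/-- Square-integrable functions with finite truncated Gagliardo energy. -/
structure FiniteEnergy (s r : ℝ) (w : V n → ℝ) : Prop where
  meas : Measurable w
  sq : Integrable (fun x => w x ^ 2)
  gag : Integrable (fun p : V n × V n => (w p.1 - w p.2) ^ 2 * truncWeight s r (p.1 - p.2))

/-- The truncated Gagliardo energy. -/
def truncEnergy (s r : ℝ) (w : V n → ℝ) : ℝ :=
  ∫ p : V n × V n, (w p.1 - w p.2) ^ 2 * truncWeight s r (p.1 - p.2)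

lemma truncEnergy_nonneg (s r : ℝ) (w : V n → ℝ) : 0 ≤ truncEnergy s r w :=
  integral_nonneg fun _ => mul_nonneg (sq_nonneg _) (truncWeight_nonneg _ _ _)

lemma FiniteEnergy.translate {s r : ℝ} {w : V n → ℝ} (hw : FiniteEnergy s r w) (z : V n) :
    FiniteEnergy s r (fun x => w (x + z)) where
  meas := hw.meas.comp (measurable_add_const z)
  sq := hw.sq.comp_add_right z
  gag := by
    have := (integrable_diagonal_add_iff z).2 hw.gag
    simpa using this

lemma truncEnergy_translate (s r : ℝ) (w : V n → ℝ) (z : V n) :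
    truncEnergy s r (fun x => w (x + z)) = truncEnergy s r w := by
  simpa [truncEnergy] using integral_diagonal_add z
    (fun p : V n × V n => (w p.1 - w p.2) ^ 2 * truncWeight s r (p.1 - p.2))

lemma FiniteEnergy.sub {s r : ℝ} {v w : V n → ℝ} (hv : FiniteEnergy s r v)
    (hw : FiniteEnergy s r w) : FiniteEnergy s r (fun x => v x - w x) where
  meas := hv.meas.sub hw.meas
  sq := by
    refine ((hv.sq.const_mul 2).add (hw.sq.const_mul 2)).mono'
      ((hv.meas.sub hw.meas).pow_const 2).aestronglyMeasurable (ae_of_all _ fun x => ?_)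
    rw [Real.norm_of_nonneg (sq_nonneg _)]
    simp only [Pi.add_apply]
    nlinarith [sq_nonneg (v x + w x)]
  gag := by
    have hv' := hv.meas
    have hw' := hw.meas
    have hm := measurable_truncWeight (n := n) s r
    refine ((hv.gag.const_mul 2).add (hw.gag.const_mul 2)).mono'
      (by fun_prop : Measurable _).aestronglyMeasurable (ae_of_all _ fun p => ?_)
    have hk := truncWeight_nonneg s r (p.1 - p.2)
    rw [Real.norm_of_nonneg (mul_nonneg (sq_nonneg _) hk)]
    simp only [Pi.add_apply]
    nlinarith [mul_nonneg (sq_nonneg (v p.1 - v p.2 + (w p.1 - w p.2))) hk]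

/-- Multiplication by a bounded Lipschitz function, under a local hypothesis on the energy
density of `w`. -/
lemma FiniteEnergy.cutoff_of_local (hn : 1 ≤ n) {s r L : ℝ} (hs : s < 1) (hr : 0 < r)
    {η w : V n → ℝ} (hηm : Measurable η) (hη1 : ∀ x, |η x| ≤ 1)
    (hηL : ∀ x y, |η x - η y| ≤ L * ‖x - y‖) (hwm : Measurable w)
    (hw : Integrable (fun x => w x ^ 2))
    {D : V n × V n → ℝ} (hD : Integrable D)
    (hDb : ∀ᵐ p : V n × V n, (η p.1 * (w p.1 - w p.2)) ^ 2 * truncWeight s r (p.1 - p.2) ≤ D p) :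
    FiniteEnergy s r (fun x => η x * w x) ∧
      truncEnergy s r (fun x => η x * w x) ≤
        2 * (∫ p, D p) + 2 * L ^ 2 * truncMoment n s r * ∫ x, w x ^ 2 := by
  have hm := measurable_truncWeight (n := n) s r
  have hI : Integrable (fun p : V n × V n => 2 * D p + 2 * L ^ 2 *
      (w p.2 ^ 2 * (‖p.1 - p.2‖ ^ 2 * truncWeight s r (p.1 - p.2)))) :=
    (hD.const_mul 2).add ((integrable_moment_snd hn hs hr hw).const_mul _)
  have hb : ∀ᵐ p : V n × V n,
      (η p.1 * w p.1 - η p.2 * w p.2) ^ 2 * truncWeight s r (p.1 - p.2) ≤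
      2 * D p + 2 * L ^ 2 * (w p.2 ^ 2 * (‖p.1 - p.2‖ ^ 2 * truncWeight s r (p.1 - p.2))) := by
    filter_upwards [hDb] with p hp
    have hk := truncWeight_nonneg s r (p.1 - p.2)
    have h1 : (η p.1 - η p.2) ^ 2 ≤ L ^ 2 * ‖p.1 - p.2‖ ^ 2 := by
      rw [← mul_pow, ← sq_abs]
      exact pow_le_pow_left₀ (abs_nonneg _) (hηL _ _) 2
    have h2 : (η p.1 * w p.1 - η p.2 * w p.2) ^ 2 ≤
        2 * (η p.1 * (w p.1 - w p.2)) ^ 2 + 2 * (w p.2 ^ 2 * (η p.1 - η p.2) ^ 2) := by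
      nlinarith [sq_nonneg (η p.1 * (w p.1 - w p.2) - w p.2 * (η p.1 - η p.2))]
    have h3 := mul_le_mul_of_nonneg_left h1 (sq_nonneg (w p.2))
    have h4 := mul_le_mul_of_nonneg_right (h2.trans (by linarith :
      _ ≤ 2 * (η p.1 * (w p.1 - w p.2)) ^ 2 + 2 * (w p.2 ^ 2 * (L ^ 2 * ‖p.1 - p.2‖ ^ 2)))) hk
    refine h4.trans ?_
    nlinarith
  have hg : Integrable (fun p : V n × V n =>
      (η p.1 * w p.1 - η p.2 * w p.2) ^ 2 * truncWeight s r (p.1 - p.2)) := by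
    refine hI.mono' (by fun_prop : Measurable _).aestronglyMeasurable ?_
    filter_upwards [hb] with p hp
    rwa [Real.norm_of_nonneg (mul_nonneg (sq_nonneg _) (truncWeight_nonneg _ _ _))]
  refine ⟨⟨hηm.mul hwm, ?_, hg⟩, ?_⟩
  · refine hw.mono' ((hηm.mul hwm).pow_const 2).aestronglyMeasurable (ae_of_all _ fun x => ?_)
    rw [Real.norm_of_nonneg (sq_nonneg _), mul_pow]
    have : η x ^ 2 ≤ 1 := by rw [← sq_abs]; exact pow_le_one₀ (abs_nonneg _) (hη1 x)
    nlinarith [sq_nonneg (w x)]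
  · refine (integral_mono_ae hg hI hb).trans (le_of_eq ?_)
    rw [integral_add (hD.const_mul 2) ((integrable_moment_snd hn hs hr hw).const_mul _),
      integral_const_mul, integral_const_mul, integral_moment_snd s r (fun x => w x ^ 2)]
    ring

lemma FiniteEnergy.cutoff (hn : 1 ≤ n) {s r L : ℝ} (hs : s < 1) (hr : 0 < r)
    {η w : V n → ℝ} (hηm : Measurable η) (hη1 : ∀ x, |η x| ≤ 1)
    (hηL : ∀ x y, |η x - η y| ≤ L * ‖x - y‖) (hw : FiniteEnergy s r w) :
    FiniteEnergy s r (fun x => η x * w x) ∧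
      truncEnergy s r (fun x => η x * w x) ≤
        2 * truncEnergy s r w + 2 * L ^ 2 * truncMoment n s r * ∫ x, w x ^ 2 := by
  refine FiniteEnergy.cutoff_of_local hn hs hr hηm hη1 hηL hw.meas hw.sq hw.gag
    (ae_of_all _ fun p => ?_)
  refine mul_le_mul_of_nonneg_right ?_ (truncWeight_nonneg _ _ _)
  rw [mul_pow]
  have : η p.1 ^ 2 ≤ 1 := by rw [← sq_abs]; exact pow_le_one₀ (abs_nonneg _) (hη1 _)
  nlinarith [sq_nonneg (w p.1 - w p.2)]

/-- The squared `L²` norm of the first difference. -/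
def shiftNormSq (w : V n → ℝ) (z : V n) : ℝ := ∫ x, (w (x + z) - w x) ^ 2

lemma shiftNormSq_nonneg (w : V n → ℝ) (z : V n) : 0 ≤ shiftNormSq w z :=
  integral_nonneg fun _ => sq_nonneg _

lemma integrable_sub_sq {v w : V n → ℝ} (hvm : Measurable v) (hv : Integrable (fun x => v x ^ 2))
    (hwm : Measurable w) (hw : Integrable (fun x => w x ^ 2)) :
    Integrable (fun x => (v x - w x) ^ 2) := by
  refine ((hv.const_mul 2).add (hw.const_mul 2)).mono'
    ((hvm.sub hwm).pow_const 2).aestronglyMeasurable (ae_of_all _ fun x => ?_)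
  rw [Real.norm_of_nonneg (sq_nonneg _)]
  simp only [Pi.add_apply]
  nlinarith [sq_nonneg (v x + w x)]

lemma integrable_shift_sq {w : V n → ℝ} (hwm : Measurable w)
    (hw : Integrable (fun x => w x ^ 2)) (z : V n) :
    Integrable (fun x => (w (x + z) - w x) ^ 2) :=
  integrable_sub_sq (v := fun x => w (x + z)) (hwm.comp (measurable_add_const z))
    (hw.comp_add_right z) hwm hw

lemma shiftNormSq_le {w : V n → ℝ} (hwm : Measurable w)
    (hw : Integrable (fun x => w x ^ 2)) (z : V n) :
    shiftNormSq w z ≤ 4 * ∫ x, w x ^ 2 := by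
  have h2 := hw.comp_add_right z
  have h := integral_mono (integrable_shift_sq hwm hw z)
    ((h2.const_mul 2).add (hw.const_mul 2)) (fun x => by
      simp only [Pi.add_apply]
      nlinarith [sq_nonneg (w (x + z) + w x)])
  refine h.trans (le_of_eq ?_)
  simp only [Pi.add_apply]
  rw [integral_add (h2.const_mul 2) (hw.const_mul 2), integral_const_mul, integral_const_mul,
    integral_add_right_eq_self (fun x => w x ^ 2) z]
  ring

lemma FiniteEnergy.integrable_weight_mul_shiftNormSq {s r : ℝ} {w : V n → ℝ}
    (hw : FiniteEnergy s r w) :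
    Integrable (fun h => truncWeight s r h * shiftNormSq w h) ∧
      ∫ h, truncWeight s r h * shiftNormSq w h = truncEnergy s r w := by
  have h1 := integrable_shear_iff.2 hw.gag
  have h2 := integral_shear (fun p : V n × V n =>
    (w p.1 - w p.2) ^ 2 * truncWeight s r (p.1 - p.2))
  have h3 : ∀ h : V n, ∫ x, (w (h + x) - w x) ^ 2 * truncWeight s r (h + x - x) =
      truncWeight s r h * shiftNormSq w h := by
    intro h
    simp only [add_sub_cancel_right, shiftNormSq]
    rw [integral_mul_const, mul_comm]
    simp only [add_comm h]
  constructor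
  · have := h1.integral_prod_left
    simpa only [h3] using this
  · rw [truncEnergy, ← h2]
    rw [Measure.volume_eq_prod, integral_prod _ h1]
    simp only [h3]

lemma shiftNormSq_le_weight {s r : ℝ} (hs : 0 < s) (w : V n → ℝ) {h z : V n} (hz : ‖z‖ < r)
    (hh : ‖h‖ ≤ ‖z‖) :
    shiftNormSq w h ≤ ‖z‖ ^ ((n : ℝ) + 2 * s) * (truncWeight s r h * shiftNormSq w h) := by
  by_cases h0 : h = 0
  · simp [h0, shiftNormSq]
  have hhp : 0 < ‖h‖ := norm_pos_iff.2 h0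
  have hp : 0 ≤ (n : ℝ) + 2 * s := by positivity
  have : 1 ≤ ‖z‖ ^ ((n : ℝ) + 2 * s) * truncWeight s r h := by
    rw [truncWeight, if_pos (hh.trans_lt hz), Real.rpow_neg hhp.le, ← div_eq_mul_inv,
      one_le_div (by positivity)]
    exact Real.rpow_le_rpow hhp.le hh hp
  rw [← mul_assoc]
  exact le_mul_of_one_le_left (shiftNormSq_nonneg w h) this

lemma shiftNormSq_add_le {w : V n → ℝ} (hwm : Measurable w)
    (hw : Integrable (fun x => w x ^ 2)) (z h : V n) :
    shiftNormSq w z ≤ 2 * shiftNormSq w h + 2 * shiftNormSq w (z - h) := by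
  have i1 := integrable_shift_sq hwm hw h
  have i2 := (integrable_shift_sq hwm hw (z - h)).comp_add_right h
  have e2 : ∫ x, (w (x + h + (z - h)) - w (x + h)) ^ 2 = shiftNormSq w (z - h) :=
    integral_add_right_eq_self (fun x => (w (x + (z - h)) - w x) ^ 2) h
  have h := integral_mono (integrable_shift_sq hwm hw z)
    ((i1.const_mul 2).add (i2.const_mul 2)) (fun x => by
      simp only [Pi.add_apply]
      have : x + h + (z - h) = x + z := by abel
      rw [this]
      nlinarith [sq_nonneg (w (x + z) - w (x + h) - (w (x + h) - w x))])
  refine h.trans (le_of_eq ?_)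
  simp only [Pi.add_apply]
  rw [integral_add (i1.const_mul 2) (i2.const_mul 2), integral_const_mul, integral_const_mul, e2]
  rfl

/-- Constant in the embedding of the energy space in the Nikol'skii space of the same order. -/
def nikolskiiConst (n : ℕ) : ℝ := 4 * 2 ^ n / volume.real (ball (0 : V n) 1)

lemma nikolskiiConst_pos (n : ℕ) : 0 < nikolskiiConst n := by
  have : 0 < volume.real (ball (0 : V n) 1) :=
    ENNReal.toReal_pos (measure_ball_pos _ _ one_pos).ne' measure_ball_lt_top.ne
  unfold nikolskiiConst; positivity

lemma FiniteEnergy.shiftNormSq_le {s r : ℝ} (hs : 0 < s) {w : V n → ℝ}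
    (hw : FiniteEnergy s r w) {z : V n} (hz : ‖z‖ < r) :
    shiftNormSq w z ≤ nikolskiiConst n * ‖z‖ ^ (2 * s) * truncEnergy s r w := by
  by_cases h0 : z = 0
  · have : shiftNormSq w z = 0 := by simp [h0, shiftNormSq]
    rw [this]
    have := (nikolskiiConst_pos n).le
    have := truncEnergy_nonneg s r w
    positivity
  have hzp : 0 < ‖z‖ := norm_pos_iff.2 h0
  obtain ⟨hi, he⟩ := hw.integrable_weight_mul_shiftNormSq
  set g : V n → ℝ := fun h => truncWeight s r h * shiftNormSq w h with hg
  have hg0 : ∀ h, 0 ≤ g h := fun h => mul_nonneg (truncWeight_nonneg _ _ _) (shiftNormSq_nonneg _ _)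
  set A := ‖z‖ ^ ((n : ℝ) + 2 * s) with hA
  have hA0 : 0 ≤ A := by positivity
  have hi' : Integrable (fun h => g (z - h)) := hi.comp_sub_left z
  have hI : Integrable (fun h => 2 * A * g h + 2 * A * g (z - h)) :=
    (hi.const_mul _).add (hi'.const_mul _)
  have key : ∫ _h in ball ((1 / 2 : ℝ) • z) (‖z‖ / 2), shiftNormSq w z ≤
      ∫ h, (2 * A * g h + 2 * A * g (z - h)) := by
    refine (setIntegral_mono_on (integrableOn_const (by exact measure_ball_lt_top.ne))
      hI.integrableOn measurableSet_ball (fun h hh => ?_)).trans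
      (setIntegral_le_integral hI (ae_of_all _ fun h => ?_))
    · have hh' : ‖h - (1 / 2 : ℝ) • z‖ < ‖z‖ / 2 := by simpa [dist_eq_norm] using hh
      have hz2 : ‖(1 / 2 : ℝ) • z‖ = ‖z‖ / 2 := by
        rw [norm_smul]; norm_num; ring
      have b1 : ‖h‖ ≤ ‖z‖ := by
        have := norm_add_le (h - (1 / 2 : ℝ) • z) ((1 / 2 : ℝ) • z)
        rw [sub_add_cancel] at this; linarith
      have b2 : ‖z - h‖ ≤ ‖z‖ := by
        have := norm_sub_le ((1 / 2 : ℝ) • z) (h - (1 / 2 : ℝ) • z)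
        have e : (1 / 2 : ℝ) • z - (h - (1 / 2 : ℝ) • z) = z - h := by
          rw [sub_sub_eq_add_sub, ← add_smul]; norm_num
        rw [e] at this; linarith
      have := shiftNormSq_add_le hw.meas hw.sq z h
      have := shiftNormSq_le_weight hs w hz b1
      have := shiftNormSq_le_weight hs w hz b2
      simp only [hg]
      linarith
    · have := hg0 h
      have := hg0 (z - h)
      simp only [Pi.zero_apply]
      positivity
  rw [integral_add (hi.const_mul _) (hi'.const_mul _), integral_const_mul, integral_const_mul,
    integral_sub_left_eq_self g volume z, he, setIntegral_const, smul_eq_mul,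
    measureReal_def, Measure.addHaar_ball_of_pos _ _ (by positivity), ENNReal.toReal_mul,
    ENNReal.toReal_ofReal (by positivity), ← measureReal_def, finrank_euclideanSpace,
    Fintype.card_fin] at key
  have hb : 0 < volume.real (ball (0 : V n) 1) :=
    ENNReal.toReal_pos (measure_ball_pos _ _ one_pos).ne' measure_ball_lt_top.ne
  have hA' : A = ‖z‖ ^ n * ‖z‖ ^ (2 * s) := by
    rw [hA, Real.rpow_add hzp, Real.rpow_natCast]
  have hzn : 0 < ‖z‖ ^ n := by positivity
  rw [hA', div_pow] at key
  unfold nikolskiiConst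
  have h2n : (0 : ℝ) < 2 ^ n := by positivity
  rw [div_mul_eq_mul_div, div_mul_eq_mul_div, le_div_iff₀ hb]
  have k2 : ‖z‖ ^ n * (shiftNormSq w z * volume.real (ball (0 : V n) 1)) ≤
      ‖z‖ ^ n * (4 * 2 ^ n * ‖z‖ ^ (2 * s) * truncEnergy s r w) := by
    rw [div_mul_eq_mul_div, div_mul_eq_mul_div, div_le_iff₀ h2n] at key
    nlinarith
  exact le_of_mul_le_mul_left k2 hzn

/-- Measurable kernels comparable with the truncated weight. -/
structure IsTruncKernel (s r lam Lam : ℝ) (k : V n × V n → ℝ) : Prop where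
  meas : Measurable k
  lower : ∀ᵐ p : V n × V n, lam * truncWeight s r (p.1 - p.2) ≤ k p
  upper : ∀ᵐ p : V n × V n, k p ≤ Lam * truncWeight s r (p.1 - p.2)

/-- The bilinear form of a kernel on the product space. -/
def kernelForm (k : V n × V n → ℝ) (u φ : V n → ℝ) : ℝ :=
  ∫ p : V n × V n, (u p.1 - u p.2) * (φ p.1 - φ p.2) * k p

lemma IsTruncKernel.integrable_form {s r lam Lam : ℝ} (hlam : 0 ≤ lam) {k : V n × V n → ℝ}
    (hk : IsTruncKernel s r lam Lam k) {v φ : V n → ℝ} (hv : FiniteEnergy s r v)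
    (hφ : FiniteEnergy s r φ) :
    Integrable (fun p : V n × V n => (v p.1 - v p.2) * (φ p.1 - φ p.2) * k p) := by
  have hv' := hv.meas
  have hφ' := hφ.meas
  have hk' := hk.meas
  refine ((hv.gag.add hφ.gag).const_mul Lam).mono'
    (by fun_prop : Measurable _).aestronglyMeasurable ?_
  filter_upwards [hk.lower, hk.upper] with p h1 h2
  have hρ := truncWeight_nonneg s r (p.1 - p.2)
  have hk0 : 0 ≤ k p := (mul_nonneg hlam hρ).trans h1
  rw [Real.norm_eq_abs, abs_mul, abs_of_nonneg hk0]
  simp only [Pi.add_apply]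
  set a := v p.1 - v p.2
  set b := φ p.1 - φ p.2
  have hab : |a * b| ≤ a ^ 2 + b ^ 2 := by
    rw [abs_le]; constructor <;> nlinarith [sq_nonneg (a + b), sq_nonneg (a - b)]
  calc |a * b| * k p ≤ (a ^ 2 + b ^ 2) * (Lam * truncWeight s r (p.1 - p.2)) :=
        mul_le_mul hab h2 hk0 (by positivity)
    _ = _ := by ring

/-- Testing with `η² w` controls the energy of `η w`. -/
lemma IsTruncKernel.energy_cutoff_le (hn : 1 ≤ n) {s r lam Lam L : ℝ} (hs : s < 1) (hr : 0 < r)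
    (hlam : 0 ≤ lam) {k : V n × V n → ℝ} (hk : IsTruncKernel s r lam Lam k)
    {η w : V n → ℝ} (hηL : ∀ x y, |η x - η y| ≤ L * ‖x - y‖)
    (hw : Integrable (fun x => w x ^ 2)) (hηw : FiniteEnergy s r (fun x => η x * w x))
    (hform : Integrable (fun p : V n × V n =>
      (w p.1 - w p.2) * (η p.1 * (η p.1 * w p.1) - η p.2 * (η p.2 * w p.2)) * k p)) :
    lam * truncEnergy s r (fun x => η x * w x) ≤
      kernelForm k w (fun x => η x * (η x * w x)) +
        Lam * L ^ 2 * truncMoment n s r * ∫ x, w x ^ 2 := by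
  have i1 := integrable_moment_fst hn hs hr hw
  have i2 := integrable_moment_snd hn hs hr hw
  have i3 : Integrable (fun p : V n × V n => Lam * L ^ 2 / 2 *
      (w p.1 ^ 2 * (‖p.1 - p.2‖ ^ 2 * truncWeight s r (p.1 - p.2)) +
        w p.2 ^ 2 * (‖p.1 - p.2‖ ^ 2 * truncWeight s r (p.1 - p.2)))) :=
    (i1.add i2).const_mul _
  have h := integral_mono_ae (hηw.gag.const_mul lam) (hform.add i3) (by
    filter_upwards [hk.lower, hk.upper] with p h1 h2
    simp only [Pi.add_apply]
    have hρ := truncWeight_nonneg s r (p.1 - p.2)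
    have hk0 : 0 ≤ k p := (mul_nonneg hlam hρ).trans h1
    have h3 : (η p.1 - η p.2) ^ 2 ≤ L ^ 2 * ‖p.1 - p.2‖ ^ 2 := by
      rw [← mul_pow, ← sq_abs]
      exact pow_le_pow_left₀ (abs_nonneg _) (hηL _ _) 2
    have h4 : (η p.1 * w p.1 - η p.2 * w p.2) ^ 2 * (lam * truncWeight s r (p.1 - p.2)) ≤
      (η p.1 * w p.1 - η p.2 * w p.2) ^ 2 * k p := mul_le_mul_of_nonneg_left h1 (sq_nonneg _)
    have h5 : w p.1 * w p.2 * (η p.1 - η p.2) ^ 2 ≤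
        (w p.1 ^ 2 + w p.2 ^ 2) / 2 * (η p.1 - η p.2) ^ 2 :=
      mul_le_mul_of_nonneg_right (by nlinarith [sq_nonneg (w p.1 - w p.2)]) (sq_nonneg _)
    have h6 : (w p.1 ^ 2 + w p.2 ^ 2) / 2 * (η p.1 - η p.2) ^ 2 * k p ≤
        (w p.1 ^ 2 + w p.2 ^ 2) / 2 * (L ^ 2 * ‖p.1 - p.2‖ ^ 2) *
          (Lam * truncWeight s r (p.1 - p.2)) :=
      mul_le_mul (mul_le_mul_of_nonneg_left h3 (by positivity)) h2 hk0 (by positivity)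
    have h7 := mul_le_mul_of_nonneg_right h5 hk0
    have e : (η p.1 * w p.1 - η p.2 * w p.2) ^ 2 * k p =
        (w p.1 - w p.2) * (η p.1 * (η p.1 * w p.1) - η p.2 * (η p.2 * w p.2)) * k p +
          w p.1 * w p.2 * (η p.1 - η p.2) ^ 2 * k p := by ring
    linarith)
  rw [integral_const_mul] at h
  refine h.trans (le_of_eq ?_)
  simp only [Pi.add_apply]
  rw [integral_add hform i3, integral_const_mul, integral_add i1 i2, integral_moment_fst s r (fun x => w x ^ 2),
    integral_moment_snd s r (fun x => w x ^ 2), kernelForm]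
  ring

/-- Comparison of the form of a translate with the translated form. -/
lemma IsTruncKernel.kernelForm_diff_le {s r lam Lam Gam θ : ℝ} (hlam : 0 ≤ lam) (hθ : 0 < θ)
    {k : V n × V n → ℝ} (hk : IsTruncKernel s r lam Lam k) {v ψ : V n → ℝ}
    (hv : FiniteEnergy s r v) (hψ : FiniteEnergy s r ψ) (z : V n)
    (hH : ∀ᵐ p : V n × V n,
      |k (p.1 + z, p.2 + z) - k p| ≤ Gam * ‖z‖ ^ s * truncWeight s r (p.1 - p.2)) :
    kernelForm k (fun x => v (x + z) - v x) ψ ≤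
      kernelForm k v (fun x => ψ (x + -z) - ψ x) +
        Gam ^ 2 * ‖z‖ ^ (2 * s) / (2 * θ) * truncEnergy s r v + θ / 2 * truncEnergy s r ψ := by
  have i1 := hk.integrable_form hlam (hv.translate z) hψ
  have i2 := hk.integrable_form hlam hv hψ
  have i3 := hk.integrable_form hlam hv (hψ.translate (-z))
  have i3' := (integrable_diagonal_add_iff z).2 i3
  have e3 := integral_diagonal_add z (fun p : V n × V n =>
    (v p.1 - v p.2) * (ψ (p.1 + -z) - ψ (p.2 + -z)) * k p)
  have e1 : kernelForm k (fun x => v (x + z) - v x) ψ =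
      (∫ p : V n × V n, (v (p.1 + z) - v (p.2 + z)) * (ψ p.1 - ψ p.2) * k p) -
      ∫ p : V n × V n, (v p.1 - v p.2) * (ψ p.1 - ψ p.2) * k p := by
    rw [kernelForm, ← integral_sub i1 i2]
    congr 1; ext p; ring
  have e2 : kernelForm k v (fun x => ψ (x + -z) - ψ x) =
      (∫ p : V n × V n, (v p.1 - v p.2) * (ψ (p.1 + -z) - ψ (p.2 + -z)) * k p) -
      ∫ p : V n × V n, (v p.1 - v p.2) * (ψ p.1 - ψ p.2) * k p := by
    rw [kernelForm, ← integral_sub i3 i2]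
    congr 1; ext p; ring
  have i4 := ((hv.translate z).gag.const_mul (Gam ^ 2 * ‖z‖ ^ (2 * s) / (2 * θ))).add
    (hψ.gag.const_mul (θ / 2))
  have h := integral_mono_ae (i1.sub i3') i4 (by
    filter_upwards [hH] with p hp
    simp only [Pi.add_apply, Pi.sub_apply, add_neg_cancel_right]
    have hρ := truncWeight_nonneg s r (p.1 - p.2)
    set a := v (p.1 + z) - v (p.2 + z)
    set b := ψ p.1 - ψ p.2
    set ρ := truncWeight s r (p.1 - p.2)
    have ht : ‖z‖ ^ (2 * s) = (‖z‖ ^ s) ^ 2 := by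
      rw [mul_comm, Real.rpow_mul (norm_nonneg z)]; norm_cast
    rw [ht]
    set q := ‖z‖ ^ s
    have hq : 0 ≤ q := by positivity
    calc a * b * k p - a * b * k (p.1 + z, p.2 + z)
        = -(a * b) * (k (p.1 + z, p.2 + z) - k p) := by ring
      _ ≤ |a * b| * |k (p.1 + z, p.2 + z) - k p| := by
        rw [← abs_neg (a * b), ← abs_mul]; exact le_abs_self _
      _ ≤ |a * b| * (Gam * q * ρ) := mul_le_mul_of_nonneg_left hp (abs_nonneg _)
      _ = (|a| * |b| * (Gam * q)) * ρ := by rw [abs_mul]; ring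
      _ ≤ (Gam ^ 2 * q ^ 2 / (2 * θ) * a ^ 2 + θ / 2 * b ^ 2) * ρ := by
        refine mul_le_mul_of_nonneg_right ?_ hρ
        rw [← sq_abs a, ← sq_abs b]
        have : Gam ^ 2 * q ^ 2 / (2 * θ) * |a| ^ 2 + θ / 2 * |b| ^ 2 - |a| * |b| * (Gam * q)
            = (Gam * q * |a| - θ * |b|) ^ 2 / (2 * θ) := by
          field_simp; ring
        have : 0 ≤ (Gam * q * |a| - θ * |b|) ^ 2 / (2 * θ) := by positivity
        linarith
      _ = _ := by ring)
  simp only [Pi.add_apply, Pi.sub_apply] at h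
  rw [integral_sub i1 i3', integral_add ((hv.translate z).gag.const_mul _) (hψ.gag.const_mul _),
    integral_const_mul, integral_const_mul, e3] at h
  have e4 := truncEnergy_translate s r v z
  unfold truncEnergy at e4 ⊢
  rw [e4] at h
  rw [e1, e2]
  linarith

lemma integral_mul_abs_le {G φ : V n → ℝ} (hGm : Measurable G)
    (hG : Integrable (fun x => G x ^ 2)) (hφm : Measurable φ)
    (hφ : Integrable (fun x => φ x ^ 2)) {c : ℝ} (hc : 0 < c) :
    ∫ x, G x * |φ x| ≤ c / 2 * (∫ x, G x ^ 2) + 1 / (2 * c) * ∫ x, φ x ^ 2 := by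
  rw [← integral_const_mul, ← integral_const_mul,
    ← integral_add (hG.const_mul _) (hφ.const_mul _)]
  have hpt : ∀ x, |G x * (|φ x|)| ≤ c / 2 * G x ^ 2 + 1 / (2 * c) * φ x ^ 2 := fun x => by
    rw [abs_mul, abs_abs, ← sq_abs (G x), ← sq_abs (φ x)]
    have : c / 2 * |G x| ^ 2 + 1 / (2 * c) * |φ x| ^ 2 - |G x| * |φ x|
        = (c * |G x| - |φ x|) ^ 2 / (2 * c) := by field_simp; ring
    have : 0 ≤ (c * |G x| - |φ x|) ^ 2 / (2 * c) := by positivity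
    linarith
  have hI := (hG.const_mul (c / 2)).add (hφ.const_mul (1 / (2 * c)))
  refine integral_mono (hI.mono' (by fun_prop : Measurable _).aestronglyMeasurable
    (ae_of_all _ hpt)) hI fun x => (le_abs_self _).trans (hpt x)

/-- Energy estimate for first differences of a local solution. -/
lemma exists_energy_diff_le (hn : 1 ≤ n) {s r lam Lam Gam L : ℝ} (hs0 : 0 < s) (hs : s < 1)
    (hr : 0 < r) (hlam : 0 < lam) (hLam : 0 ≤ Lam) :
    ∃ C > 0, ∀ (k : V n × V n → ℝ) (v G η : V n → ℝ) (z : V n),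
      IsTruncKernel s r lam Lam k → FiniteEnergy s r v → Measurable G →
      Integrable (fun x => G x ^ 2) → Measurable η → (∀ x, |η x| ≤ 1) →
      (∀ x y, |η x - η y| ≤ L * ‖x - y‖) → z ≠ 0 → ‖z‖ < r →
      (∀ᵐ p : V n × V n,
        |k (p.1 + z, p.2 + z) - k p| ≤ Gam * ‖z‖ ^ s * truncWeight s r (p.1 - p.2)) →
      (∀ φ : V n → ℝ, FiniteEnergy s r φ → (∀ x, η (x + -z) = 0 → η x = 0 → φ x = 0) →
        kernelForm k v φ ≤ ∫ x, G x * |φ x|) →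
      truncEnergy s r (fun x => η x * (v (x + z) - v x)) ≤
        C * ‖z‖ ^ (2 * s) * ((∫ x, G x ^ 2) + truncEnergy s r v) := by
  set N := nikolskiiConst n with hN
  have hNp : 0 < N := nikolskiiConst_pos n
  set c := truncMoment n s r with hc
  have hc0 : 0 ≤ c := truncMoment_nonneg n s r
  set θ := lam / (2 * (N + 1)) with hθ
  have hθp : 0 < θ := by positivity
  set C1 := 1 / (2 * θ) + Gam ^ 2 / (2 * θ) + (lam / 2 + Lam) * L ^ 2 * c * N with hC1
  have hC1p : 0 < C1 := by positivity
  refine ⟨2 / lam * C1, by positivity, ?_⟩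
  intro k v G η z hk hv hGm hG hηm hη1 hηL hz hzr hH hP
  have hw : FiniteEnergy s r (fun x => v (x + z) - v x) := (hv.translate z).sub hv
  obtain ⟨hηw, -⟩ := hw.cutoff hn hs hr hηm hη1 hηL
  obtain ⟨hψ, hψQ⟩ := hηw.cutoff hn hs hr hηm hη1 hηL
  have b1 := hk.energy_cutoff_le hn hs hr hlam.le hηL hw.sq hηw
    (hk.integrable_form hlam.le hw hψ)
  have b2 := hk.kernelForm_diff_le hlam.le hθp hv hψ z hH
  have hφ := (hψ.translate (-z)).sub hψ
  have b3 := hP _ hφ (fun x h1 h2 => by simp [h1, h2])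
  set t := ‖z‖ ^ (2 * s) with ht
  have htp : 0 < t := Real.rpow_pos_of_pos (norm_pos_iff.2 hz) _
  have b4 := integral_mul_abs_le hGm hG hφ.meas hφ.sq (c := t / θ) (by positivity)
  have b5 := hψ.shiftNormSq_le hs0 (z := -z) (by simpa using hzr)
  have b6 := hv.shiftNormSq_le hs0 hzr
  unfold shiftNormSq at b5 b6
  rw [norm_neg] at b5
  have b7 : ∫ x, (η x * (v (x + z) - v x)) ^ 2 ≤ ∫ x, (v (x + z) - v x) ^ 2 :=
    integral_mono hηw.sq hw.sq fun x => by
      simp only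
      rw [mul_pow]
      have : η x ^ 2 ≤ 1 := by rw [← sq_abs]; exact pow_le_one₀ (abs_nonneg _) (hη1 _)
      nlinarith [sq_nonneg (v (x + z) - v x)]
  rw [← ht] at b5 b6
  rw [← hN] at b5 b6
  rw [← hc] at hψQ b1
  set S := truncEnergy s r (fun x => η x * (v (x + z) - v x)) with hS
  set P := truncEnergy s r (fun x => η x * (η x * (v (x + z) - v x))) with hPdef
  set W := ∫ x, (v (x + z) - v x) ^ 2 with hW
  set W' := ∫ x, (η x * (v (x + z) - v x)) ^ 2 with hW'
  set g := ∫ x, G x ^ 2 with hg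
  set Q := truncEnergy s r v with hQ
  have hg0 : 0 ≤ g := integral_nonneg fun _ => sq_nonneg _
  have hQ0 : 0 ≤ Q := truncEnergy_nonneg _ _ _
  have hS0 : 0 ≤ S := truncEnergy_nonneg _ _ _
  have a1 : P ≤ 2 * S + 2 * L ^ 2 * c * W := by
    have := mul_le_mul_of_nonneg_left b7 (by positivity : 0 ≤ 2 * L ^ 2 * c)
    linarith
  have a2 : 1 / (2 * (t / θ)) * (N * t * P) = θ / 2 * N * P := by
    field_simp
  have a3 := mul_le_mul_of_nonneg_left b5 (by positivity : 0 ≤ 1 / (2 * (t / θ)))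
  rw [a2] at a3
  have a4 : lam * S ≤ t / θ / 2 * g + Gam ^ 2 * t / (2 * θ) * Q + θ / 2 * (N + 1) * P
      + Lam * L ^ 2 * c * W := by linarith
  have a5 : θ / 2 * (N + 1) = lam / 4 := by rw [hθ]; field_simp; norm_num
  rw [a5] at a4
  have a6 : lam / 2 * S ≤ t / θ / 2 * g + Gam ^ 2 * t / (2 * θ) * Q +
      (lam / 2 + Lam) * L ^ 2 * c * W := by
    have := mul_le_mul_of_nonneg_left a1 (by positivity : 0 ≤ lam / 4)
    linarith
  have a7 : lam / 2 * S ≤ t / θ / 2 * g + Gam ^ 2 * t / (2 * θ) * Q +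
      (lam / 2 + Lam) * L ^ 2 * c * (N * t * Q) := by
    have := mul_le_mul_of_nonneg_left b6 (by positivity : 0 ≤ (lam / 2 + Lam) * L ^ 2 * c)
    linarith
  have a8 : lam / 2 * S ≤ C1 * t * (g + Q) := by
    have n1 : 0 ≤ Gam ^ 2 / (2 * θ) * (t * g) := by positivity
    have n2 : 0 ≤ 1 / (2 * θ) * (t * Q) := by positivity
    have n3 : 0 ≤ (lam / 2 + Lam) * L ^ 2 * c * N * (t * g) := by positivity
    have m1 : t / θ / 2 * g = 1 / (2 * θ) * (t * g) := by field_simp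
    have m2 : Gam ^ 2 * t / (2 * θ) * Q = Gam ^ 2 / (2 * θ) * (t * Q) := by field_simp
    rw [m1, m2] at a7
    rw [hC1]
    linarith
  have a9 : S = 2 / lam * (lam / 2 * S) := by field_simp
  rw [a9]
  have := mul_le_mul_of_nonneg_left a8 (by positivity : 0 ≤ 2 / lam)
  linarith

/-- The squared `L²` norm of the second difference. -/
def shift2NormSq (w : V n → ℝ) (z : V n) : ℝ := ∫ x, (diff2 z w x) ^ 2

lemma diff2_eq (w : V n → ℝ) (z x : V n) :
    diff2 z w x = w (x + z + z) - 2 * w (x + z) + w x := by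
  rw [diff2, two_nsmul, add_assoc]

lemma integrable_diff2_sq {w : V n → ℝ} (hwm : Measurable w)
    (hw : Integrable (fun x => w x ^ 2)) (z : V n) :
    Integrable (fun x => (diff2 z w x) ^ 2) := by
  have h := integrable_sub_sq (v := fun x => w (x + z + z) - w (x + z))
    (w := fun x => w (x + z) - w x)
    (by fun_prop) ((integrable_shift_sq hwm hw z).comp_add_right z) (by fun_prop)
    (integrable_shift_sq hwm hw z)
  refine h.congr (ae_of_all _ fun x => ?_)
  simp only [diff2_eq]; ring

lemma shift2NormSq_cutoff_le {L : ℝ} {ζ η v : V n → ℝ} {z : V n} (hζm : Measurable ζ)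
    (hζ1 : ∀ x, |ζ x| ≤ 1) (hζL : ∀ x y, |ζ x - ζ y| ≤ L * ‖x - y‖) (hηm : Measurable η)
    (hη1 : ∀ x, |η x| ≤ 1) (hηζ : ∀ x, ζ (x + z + z) ≠ 0 → η x = 1 ∧ η (x + z) = 1)
    (hvm : Measurable v) (hv : Integrable (fun x => v x ^ 2)) :
    shift2NormSq (fun x => ζ x * v x) z ≤
      3 * (shiftNormSq (fun x => η x * (v (x + z) - v x)) z) +
        12 * L ^ 2 * ‖z‖ ^ 2 * (shiftNormSq v z + ∫ x, v x ^ 2) := by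
  have hmul : ∀ {χ w : V n → ℝ}, Measurable χ → (∀ x, |χ x| ≤ 1) → Measurable w →
      Integrable (fun x => w x ^ 2) → Integrable (fun x => (χ x * w x) ^ 2) := by
    intro χ w hχm hχ1 hwm hw
    refine hw.mono' ((hχm.mul hwm).pow_const 2).aestronglyMeasurable (ae_of_all _ fun x => ?_)
    rw [Real.norm_of_nonneg (sq_nonneg _), mul_pow]
    have : χ x ^ 2 ≤ 1 := by rw [← sq_abs]; exact pow_le_one₀ (abs_nonneg _) (hχ1 x)
    nlinarith [sq_nonneg (w x)]
  have i0 := hmul hζm hζ1 hvm hv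
  have i1 := integrable_shift_sq hvm hv z
  have i2 := hmul (w := fun x => v (x + z) - v x) hηm hη1 (by fun_prop) i1
  have i3 := integrable_shift_sq (w := fun x => η x * (v (x + z) - v x)) (by fun_prop) i2 z
  have i4 : Integrable (fun x => 12 * L ^ 2 * ‖z‖ ^ 2 * ((v (x + z) - v x) ^ 2 + v x ^ 2)) :=
    (i1.add hv).const_mul _
  have h := integral_mono (integrable_diff2_sq (hζm.mul hvm) i0 z)
    ((i3.const_mul 3).add i4) (fun x => by
    simp only [Pi.add_apply, diff2_eq, Pi.mul_apply]
    have l1 : (ζ (x + z + z) - ζ (x + z)) ^ 2 ≤ L ^ 2 * ‖z‖ ^ 2 := by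
      rw [← mul_pow, ← sq_abs]
      refine pow_le_pow_left₀ (abs_nonneg _) ((hζL _ _).trans (le_of_eq ?_)) 2
      rw [add_sub_cancel_left]
    have l2 : (ζ (x + z) - ζ x) ^ 2 ≤ L ^ 2 * ‖z‖ ^ 2 := by
      rw [← mul_pow, ← sq_abs]
      refine pow_le_pow_left₀ (abs_nonneg _) ((hζL _ _).trans (le_of_eq ?_)) 2
      rw [add_sub_cancel_left]
    have l3 : (ζ (x + z + z)) ^ 2 ≤ 1 := by
      rw [← sq_abs]; exact pow_le_one₀ (abs_nonneg _) (hζ1 _)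
    have e : ζ (x + z + z) * v (x + z + z) - 2 * (ζ (x + z) * v (x + z)) + ζ x * v x =
        ζ (x + z + z) * (η (x + z) * (v (x + z + z) - v (x + z)) - η x * (v (x + z) - v x)) +
        2 * (ζ (x + z + z) - ζ (x + z)) * (v (x + z) - v x) +
        ((ζ (x + z + z) - ζ (x + z)) - (ζ (x + z) - ζ x)) * v x := by
      by_cases h0 : ζ (x + z + z) = 0
      · rw [h0]; ring
      · rw [(hηζ x h0).1, (hηζ x h0).2]; ring
    rw [e]
    set a := η (x + z) * (v (x + z + z) - v (x + z)) - η x * (v (x + z) - v x)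
    set b := v (x + z) - v x
    set c := v x
    set d1 := ζ (x + z + z) - ζ (x + z)
    set d2 := ζ (x + z) - ζ x
    set q := ζ (x + z + z)
    have t1 : (q * a + 2 * d1 * b + (d1 - d2) * c) ^ 2 ≤
        3 * (q ^ 2 * a ^ 2) + 12 * (d1 ^ 2 * b ^ 2) + 3 * ((d1 - d2) ^ 2 * c ^ 2) := by
      nlinarith [sq_nonneg (q * a - 2 * d1 * b), sq_nonneg (q * a - (d1 - d2) * c),
        sq_nonneg (2 * d1 * b - (d1 - d2) * c)]
    have t2 : (d1 - d2) ^ 2 ≤ 4 * (L ^ 2 * ‖z‖ ^ 2) := by nlinarith [sq_nonneg (d1 + d2)]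
    have t3 := mul_le_mul_of_nonneg_right l3 (sq_nonneg a)
    have t4 := mul_le_mul_of_nonneg_right l1 (sq_nonneg b)
    have t5 := mul_le_mul_of_nonneg_right t2 (sq_nonneg c)
    have : b ^ 2 = (v (x + z) - v x) ^ 2 := rfl
    nlinarith)
  refine h.trans (le_of_eq ?_)
  simp only [Pi.add_apply]
  rw [integral_add (i3.const_mul 3) i4, integral_const_mul,
    integral_const_mul, integral_add i1 hv]
  rfl

lemma shiftNormSq_le_double {w : V n → ℝ} (hwm : Measurable w)
    (hw : Integrable (fun x => w x ^ 2)) {θ : ℝ} (hθ : 0 < θ) (z : V n) :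
    shiftNormSq w z ≤ (1 + θ) / 4 * shiftNormSq w ((2 : ℝ) • z) +
      (1 + 1 / θ) / 4 * shift2NormSq w z := by
  have i1 := integrable_shift_sq hwm hw ((2 : ℝ) • z)
  have i2 := integrable_diff2_sq hwm hw z
  have h := integral_mono (integrable_shift_sq hwm hw z)
    ((i1.const_mul ((1 + θ) / 4)).add (i2.const_mul ((1 + 1 / θ) / 4))) (fun x => by
    simp only [Pi.add_apply, diff2_eq]
    rw [two_smul, ← add_assoc]
    set a := w (x + z + z) - w x with ha
    set d := w (x + z + z) - 2 * w (x + z) + w x with hd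
    have e : w (x + z) - w x = (a - d) / 2 := by rw [ha, hd]; ring
    rw [e]
    have : (1 + θ) / 4 * a ^ 2 + (1 + 1 / θ) / 4 * d ^ 2 - ((a - d) / 2) ^ 2 =
        (θ * a + d) ^ 2 / (4 * θ) := by field_simp; ring
    have : 0 ≤ (θ * a + d) ^ 2 / (4 * θ) := by positivity
    linarith)
  refine h.trans (le_of_eq ?_)
  simp only [Pi.add_apply]
  rw [integral_add (i1.const_mul _) (i2.const_mul _), integral_const_mul, integral_const_mul]
  rfl

/-- Marchaud-type inequality: below order one, first differences are controlled by second
differences along the dyadic multiples of the increment. -/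
lemma exists_shiftNormSq_le_of_shift2NormSq_le {τ δ : ℝ} (hτ1 : τ < 1)
    (hδ : 0 < δ) :
    ∃ C > 0, ∀ (w : V n → ℝ) (D : ℝ), Measurable w → Integrable (fun x => w x ^ 2) → 0 ≤ D →
      ∀ z : V n, z ≠ 0 →
      (∀ j : ℕ, ‖(2 : ℝ) ^ j • z‖ < δ →
        shift2NormSq w ((2 : ℝ) ^ j • z) ≤ D * ‖(2 : ℝ) ^ j • z‖ ^ (2 * τ)) → 0 ≤ τ →
      shiftNormSq w z ≤ C * (D + ∫ x, w x ^ 2) * ‖z‖ ^ (2 * τ) := by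
  set q : ℝ := 2 ^ (2 * τ) / 4 with hq
  have h4 : (2 : ℝ) ^ (2 : ℝ) = 4 := by norm_num
  have hq1 : q < 1 := by
    rw [hq, div_lt_one (by norm_num), ← h4]
    exact Real.rpow_lt_rpow_of_exponent_lt (by norm_num) (by linarith)
  have hq0 : 0 < q := by positivity
  have h1q : 0 < 1 - q := by linarith
  set θ := (1 - q) / (2 * q) with hθ
  have hθ0 : 0 < θ := by positivity
  set C1 := 2 / (1 - q) * ((1 + 1 / θ) / 4) with hC1
  have hC10 : 0 < C1 := by positivity
  refine ⟨C1 + 4 / δ ^ (2 * τ), by positivity, ?_⟩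
  intro w D hwm hw hD z hz hgood hτ0
  set I := ∫ x, w x ^ 2 with hI
  have hI0 : 0 ≤ I := integral_nonneg fun _ => sq_nonneg _
  set A := (C1 + 4 / δ ^ (2 * τ)) * (D + I) with hA
  have hA0 : 0 ≤ A := by positivity
  have hAD : C1 * D ≤ A := by
    rw [hA]
    have : 0 ≤ 4 / δ ^ (2 * τ) * (D + I) := by positivity
    nlinarith
  have hAI : 4 / δ ^ (2 * τ) * I ≤ A := by
    rw [hA]
    have : 0 ≤ C1 * (D + I) := by positivity
    have : 0 ≤ 4 / δ ^ (2 * τ) * D := by positivity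
    nlinarith
  have large : ∀ y : V n, δ ≤ ‖y‖ → shiftNormSq w y ≤ A * ‖y‖ ^ (2 * τ) := by
    intro y hy
    have p1 : δ ^ (2 * τ) ≤ ‖y‖ ^ (2 * τ) := Real.rpow_le_rpow hδ.le hy (by linarith)
    calc shiftNormSq w y ≤ 4 * I := shiftNormSq_le hwm hw y
      _ = 4 / δ ^ (2 * τ) * I * δ ^ (2 * τ) := by
        have : (0 : ℝ) < δ ^ (2 * τ) := by positivity
        field_simp
      _ ≤ A * ‖y‖ ^ (2 * τ) := by gcongr
  have main : ∀ (m : ℕ) (y : V n), δ ≤ ‖(2 : ℝ) ^ m • y‖ →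
      (∀ j : ℕ, ‖(2 : ℝ) ^ j • y‖ < δ →
        shift2NormSq w ((2 : ℝ) ^ j • y) ≤ D * ‖(2 : ℝ) ^ j • y‖ ^ (2 * τ)) →
      shiftNormSq w y ≤ A * ‖y‖ ^ (2 * τ) := by
    intro m
    induction m with
    | zero => intro y hy _; exact large y (by simpa using hy)
    | succ m ih =>
      intro y hy hg
      by_cases hyδ : δ ≤ ‖y‖
      · exact large y hyδ
      have hs : ∀ j : ℕ, (2 : ℝ) ^ j • (2 : ℝ) • y = (2 : ℝ) ^ (j + 1) • y := fun j => by
        rw [smul_smul, pow_succ]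
      have h2 := ih ((2 : ℝ) • y) (by rw [hs]; exact hy) (fun j hj => by
        rw [hs] at hj ⊢; exact hg _ hj)
      have h3 := hg 0 (by simpa using hyδ)
      rw [pow_zero, one_smul] at h3
      have h5 := shiftNormSq_le_double hwm hw hθ0 y
      have e2 : ‖(2 : ℝ) • y‖ ^ (2 * τ) = 4 * q * ‖y‖ ^ (2 * τ) := by
        rw [norm_smul, Real.norm_of_nonneg (by norm_num),
          Real.mul_rpow (by norm_num) (norm_nonneg _), hq]
        ring
      rw [e2] at h2
      set Y := ‖y‖ ^ (2 * τ) with hY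
      have hY0 : 0 ≤ Y := by positivity
      have h6 : shiftNormSq w y ≤ (1 + θ) / 4 * (A * (4 * q * Y)) + (1 + 1 / θ) / 4 * (D * Y) := by
        have := mul_le_mul_of_nonneg_left h2 (by positivity : 0 ≤ (1 + θ) / 4)
        have := mul_le_mul_of_nonneg_left h3 (by positivity : 0 ≤ (1 + 1 / θ) / 4)
        linarith
      have e3 : (1 + θ) * q = (1 + q) / 2 := by rw [hθ]; field_simp; ring
      have e4 : (1 + 1 / θ) / 4 = C1 * ((1 - q) / 2) := by rw [hC1]; field_simp
      have e5 : (1 + θ) / 4 * (A * (4 * q * Y)) = (1 + q) / 2 * (A * Y) := by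
        rw [← e3]; ring
      rw [e5, e4] at h6
      have := mul_le_mul_of_nonneg_right hAD (by positivity : 0 ≤ (1 - q) / 2 * Y)
      nlinarith
  have hzp : 0 < ‖z‖ := norm_pos_iff.2 hz
  obtain ⟨m, hm⟩ := pow_unbounded_of_one_lt (δ / ‖z‖) (by norm_num : (1 : ℝ) < 2)
  refine main m z ?_ hgood
  rw [norm_smul, Real.norm_of_nonneg (by positivity)]
  rw [div_lt_iff₀ hzp] at hm
  exact hm.le

lemma integrable_rpow_mul_truncWeight (hn : 1 ≤ n) {σ τ R : ℝ} (hστ : σ < τ) (hR : 0 < R) :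
    Integrable (fun h : V n => ‖h‖ ^ (2 * τ) * truncWeight σ R h) := by
  have h := integrableOn_norm_rpow_ball (n := n) hn (a := 2 * τ - 2 * σ) (by linarith) hR
  rw [← integrable_indicator_iff measurableSet_ball] at h
  refine h.congr ?_
  have h0 : ∀ᵐ x : V n, x ≠ 0 := by
    have : Nonempty (Fin n) := ⟨⟨0, hn⟩⟩
    exact Measure.ae_ne volume 0
  filter_upwards [h0] with x hx
  by_cases hxr : ‖x‖ < R
  · rw [indicator_of_mem (by simpa using hxr)]
    simp only [truncWeight, hxr, if_true]
    rw [← Real.rpow_add (norm_pos_iff.2 hx)]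
    congr 1; ring
  · rw [indicator_of_notMem (by simpa using hxr)]
    simp [truncWeight, hxr]

lemma lintegral_gagliardo_le (hn : 1 ≤ n) {σ τ R A : ℝ} (hστ : σ < τ) (hR : 0 < R)
    {w u : V n → ℝ} (hwm : Measurable w) (hw : Integrable (fun x => w x ^ 2))
    (hA : ∀ᵐ z : V n, shiftNormSq w z ≤ A * ‖z‖ ^ (2 * τ))
    {U : Set (V n)} (hU : MeasurableSet U) (hUR : ∀ x ∈ U, ∀ y ∈ U, ‖x - y‖ < R)
    (huw : ∀ x ∈ U, w x = u x) :
    ∫⁻ q in U ×ˢ U, ENNReal.ofReal ((u q.1 - u q.2) ^ 2 / ‖q.1 - q.2‖ ^ ((n : ℝ) + 2 * σ)) ≤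
      ENNReal.ofReal (A * ∫ h : V n, ‖h‖ ^ (2 * τ) * truncWeight σ R h) := by
  have hm := measurable_truncWeight (n := n) σ R
  calc ∫⁻ q in U ×ˢ U, ENNReal.ofReal ((u q.1 - u q.2) ^ 2 / ‖q.1 - q.2‖ ^ ((n : ℝ) + 2 * σ))
      = ∫⁻ q in U ×ˢ U, ENNReal.ofReal ((w q.1 - w q.2) ^ 2 * truncWeight σ R (q.1 - q.2)) := by
        refine setLIntegral_congr_fun (hU.prod hU) fun q hq => ?_
        rw [huw _ hq.1, huw _ hq.2, truncWeight, if_pos (hUR _ hq.1 _ hq.2),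
          Real.rpow_neg (norm_nonneg _), div_eq_mul_inv]
    _ ≤ ∫⁻ q : V n × V n, ENNReal.ofReal ((w q.1 - w q.2) ^ 2 * truncWeight σ R (q.1 - q.2)) :=
        setLIntegral_le_lintegral _ _
    _ = ∫⁻ q : V n × V n, ENNReal.ofReal ((w (q.1 + q.2) - w q.2) ^ 2 * truncWeight σ R q.1) := by
        rw [← measurePreserving_shearEquiv.lintegral_comp_emb (shearEquiv n).measurableEmbedding]
        simp [shearEquiv]
    _ = ∫⁻ h : V n, ∫⁻ x : V n, ENNReal.ofReal ((w (h + x) - w x) ^ 2 * truncWeight σ R h) := by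
        rw [Measure.volume_eq_prod, lintegral_prod _ (by fun_prop)]
    _ = ∫⁻ h : V n, ENNReal.ofReal (shiftNormSq w h * truncWeight σ R h) := by
        refine lintegral_congr fun h => ?_
        rw [shiftNormSq, ← integral_mul_const, ofReal_integral_eq_lintegral_ofReal
          ((integrable_shift_sq hwm hw h).mul_const _)
          (ae_of_all _ fun x => mul_nonneg (sq_nonneg _) (truncWeight_nonneg _ _ _))]
        simp only [add_comm h]
    _ ≤ ∫⁻ h : V n, ENNReal.ofReal (A * (‖h‖ ^ (2 * τ) * truncWeight σ R h)) := by
        refine lintegral_mono_ae ?_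
        filter_upwards [hA] with h hh
        refine ENNReal.ofReal_le_ofReal ?_
        rw [← mul_assoc]
        exact mul_le_mul_of_nonneg_right hh (truncWeight_nonneg _ _ _)
    _ = _ := by
        have hA0 : ∀ᵐ h : V n, 0 ≤ A * (‖h‖ ^ (2 * τ) * truncWeight σ R h) := by
          filter_upwards [hA] with h hh
          rw [← mul_assoc]
          exact mul_nonneg ((shiftNormSq_nonneg w h).trans hh) (truncWeight_nonneg _ _ _)
        rw [← integral_const_mul, ofReal_integral_eq_lintegral_ofReal
          ((integrable_rpow_mul_truncWeight hn hστ hR).const_mul A) hA0]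

/-- The restriction of a kernel to a neighbourhood of the diagonal. -/
def nearKernel (r : ℝ) (K : V n → V n → ℝ) (p : V n × V n) : ℝ :=
  if ‖p.1 - p.2‖ < r then K p.1 p.2 else 0

lemma KBounds.ae_fst_ne_snd {s β lam Lam M : ℝ} {K : V n → V n → ℝ} (hs : 0 < s) (hlam : 0 < lam)
    (hK : KBounds s β lam Lam M K) : ∀ᵐ p : V n × V n, p.1 ≠ p.2 := by
  filter_upwards [hK.1] with p hp h
  have h1 := (hp (by simp [h])).1
  rw [h, sub_self, norm_zero, Real.zero_rpow (by positivity), zero_mul] at h1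
  linarith

lemma isTruncKernel_nearKernel {s r β lam Lam M : ℝ} (hs : 0 < s) (hr1 : r ≤ 1) (hlam : 0 < lam)
    {K : V n → V n → ℝ} (hKm : Measurable (Function.uncurry K)) (hK : KBounds s β lam Lam M K) :
    IsTruncKernel s r lam Lam (nearKernel r K) := by
  have key : ∀ᵐ p : V n × V n, lam * truncWeight s r (p.1 - p.2) ≤ nearKernel r K p ∧
      nearKernel r K p ≤ Lam * truncWeight s r (p.1 - p.2) := by
    filter_upwards [hK.ae_fst_ne_snd hs hlam, hK.1] with p hne hp
    by_cases hpr : ‖p.1 - p.2‖ < r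
    · obtain ⟨h1, h2⟩ := hp (hpr.trans_le hr1)
      have hpos : 0 < ‖p.1 - p.2‖ ^ ((n : ℝ) + 2 * s) :=
        Real.rpow_pos_of_pos (norm_pos_iff.2 (sub_ne_zero.2 hne)) _
      simp only [truncWeight, nearKernel, hpr, if_true, Real.rpow_neg (norm_nonneg _),
        ← div_eq_mul_inv]
      rw [div_le_iff₀ hpos, le_div_iff₀ hpos, mul_comm (K _ _)]
      exact ⟨h1, h2⟩
    · simp [truncWeight, nearKernel, hpr]
  refine ⟨?_, key.mono fun p h => h.1, key.mono fun p h => h.2⟩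
  exact Measurable.ite (measurableSet_lt (by fun_prop) measurable_const) hKm measurable_const

lemma KHolder.ae_nearKernel {s r Gam β lam Lam M : ℝ} (hs : 0 < s) (hr1 : r ≤ 1) (hlam : 0 < lam)
    {K : V n → V n → ℝ} (hK : KBounds s β lam Lam M K) (hH : KHolder s Gam K) :
    ∀ᵐ z : V n, ∀ᵐ p : V n × V n, ‖z‖ < 1 →
      |nearKernel r K (p.1 + z, p.2 + z) - nearKernel r K p| ≤
        Gam * ‖z‖ ^ s * truncWeight s r (p.1 - p.2) := by
  have h := Measure.ae_ae_of_ae_prod (μ := (volume : Measure (V n)))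
    (ν := (volume : Measure (V n × V n))) hH
  filter_upwards [h] with z hz
  filter_upwards [hz, hK.ae_fst_ne_snd hs hlam] with p hp hne hz1
  simp only [nearKernel, truncWeight, add_sub_add_right_eq_sub]
  by_cases hpr : ‖p.1 - p.2‖ < r
  · have hpos : 0 < ‖p.1 - p.2‖ ^ ((n : ℝ) + 2 * s) :=
      Real.rpow_pos_of_pos (norm_pos_iff.2 (sub_ne_zero.2 hne)) _
    simp only [hpr, if_true, Real.rpow_neg (norm_nonneg _), ← div_eq_mul_inv]
    rw [le_div_iff₀ hpos, mul_comm]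
    exact hp (hpr.trans_le hr1) hz1
  · simp [hpr]

lemma ae_forall_two_pow_smul {P : V n → Prop} (h : ∀ᵐ z : V n, P z) :
    ∀ᵐ z : V n, ∀ j : ℕ, P ((2 : ℝ) ^ j • z) := by
  rw [ae_all_iff]
  intro j
  exact (Measure.quasiMeasurePreserving_smul (volume : Measure (V n))
    (pow_ne_zero j two_ne_zero)).ae h

/-- The weight of the norm `wnorm β 0`. -/
def tailWeight (β : ℝ) (y : V n) : ℝ := 1 / (1 + ‖y‖ ^ ((n : ℝ) + β))

lemma tailWeight_nonneg (β : ℝ) (y : V n) : 0 ≤ tailWeight β y := by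
  unfold tailWeight; positivity

lemma measurable_tailWeight (β : ℝ) : Measurable (tailWeight β : V n → ℝ) := by
  unfold tailWeight; fun_prop

lemma integrable_tailWeight {β : ℝ} (hβ : 0 < β) : Integrable (tailWeight β : V n → ℝ) := by
  have h := (integrable_one_add_norm (E := V n) (μ := volume) (r := (n : ℝ) + β)
    (by simpa using hβ)).const_mul (2 ^ ((n : ℝ) + β))
  refine h.mono' (measurable_tailWeight β).aestronglyMeasurable (ae_of_all _ fun y => ?_)
  rw [Real.norm_of_nonneg (tailWeight_nonneg _ _), tailWeight]
  have hp : 0 ≤ (n : ℝ) + β := by positivity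
  have hy := norm_nonneg y
  have h1 : (1 + ‖y‖) ^ ((n : ℝ) + β) ≤ 2 ^ ((n : ℝ) + β) * (1 + ‖y‖ ^ ((n : ℝ) + β)) := by
    rcases le_total ‖y‖ 1 with h1 | h1
    · have := Real.rpow_le_rpow (by positivity) (by linarith : 1 + ‖y‖ ≤ 2) hp
      refine this.trans (le_mul_of_one_le_right (by positivity) ?_)
      have : 0 ≤ ‖y‖ ^ ((n : ℝ) + β) := by positivity
      linarith
    · have := Real.rpow_le_rpow (by positivity) (by linarith : 1 + ‖y‖ ≤ 2 * ‖y‖) hp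
      rw [Real.mul_rpow (by norm_num) hy] at this
      refine this.trans (mul_le_mul_of_nonneg_left (by linarith) (by positivity))
  rw [Real.rpow_neg (by positivity), ← div_eq_mul_inv, div_le_div_iff₀ (by positivity)
    (by positivity), one_mul]
  exact h1

/-- Constant comparing the kernel away from the diagonal with `tailWeight`. -/
def tailConst (n : ℕ) (s β r R Lam M : ℝ) : ℝ :=
  (Lam * r ^ (-((n : ℝ) + 2 * s)) + M) * (1 + (R + 1) ^ ((n : ℝ) + β))

lemma le_tailConst_mul {s β r R Lam M κ : ℝ} (hs : 0 < s) (hβ : 0 < β) (hr : 0 < r) (hR : 0 ≤ R)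
    (hLam : 0 ≤ Lam) (hM : 0 ≤ M) {x y : V n}
    (h1 : ‖x - y‖ < 1 → ‖x - y‖ ^ ((n : ℝ) + 2 * s) * κ ≤ Lam)
    (h2 : 1 ≤ ‖x - y‖ → ‖x - y‖ ^ ((n : ℝ) + β) * κ ≤ M) (hxy : r ≤ ‖x - y‖) (hx : ‖x‖ ≤ R) :
    κ ≤ tailConst n s β r R Lam M * tailWeight β y := by
  have hy : ‖y‖ ≤ R + ‖x - y‖ := by
    have : ‖y‖ ≤ ‖x‖ + ‖x - y‖ := by
      calc ‖y‖ = ‖x - (x - y)‖ := by rw [sub_sub_cancel]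
        _ ≤ _ := norm_sub_le _ _
    linarith
  have hd : 0 < ‖x - y‖ := hr.trans_le hxy
  have hp : 0 ≤ (n : ℝ) + β := by positivity
  rw [tailWeight, mul_one_div, le_div_iff₀ (by positivity), tailConst]
  set d := ‖x - y‖
  have hRp : 0 ≤ (R + 1) ^ ((n : ℝ) + β) := by positivity
  have hyp : 0 ≤ ‖y‖ ^ ((n : ℝ) + β) := by positivity
  have hrp : 0 ≤ r ^ (-((n : ℝ) + 2 * s)) := by positivity
  rcases lt_or_ge d 1 with hd1 | hd1
  · have a1 : κ ≤ Lam * r ^ (-((n : ℝ) + 2 * s)) := by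
      have := h1 hd1
      have hdp : 0 < d ^ ((n : ℝ) + 2 * s) := by positivity
      calc κ ≤ Lam / d ^ ((n : ℝ) + 2 * s) := by rw [le_div_iff₀ hdp, mul_comm]; exact this
        _ = Lam * d ^ (-((n : ℝ) + 2 * s)) := by rw [Real.rpow_neg hd.le, div_eq_mul_inv]
        _ ≤ _ := mul_le_mul_of_nonneg_left (Real.rpow_le_rpow_of_nonpos hr hxy
            (by have : (0:ℝ) ≤ n := n.cast_nonneg
                linarith)) hLam
    have a2 : ‖y‖ ^ ((n : ℝ) + β) ≤ (R + 1) ^ ((n : ℝ) + β) :=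
      Real.rpow_le_rpow (norm_nonneg _) (by linarith) hp
    calc κ * (1 + ‖y‖ ^ ((n : ℝ) + β))
        ≤ (Lam * r ^ (-((n : ℝ) + 2 * s))) * (1 + ‖y‖ ^ ((n : ℝ) + β)) :=
          mul_le_mul_of_nonneg_right a1 (by positivity)
      _ ≤ _ := mul_le_mul (by linarith) (by linarith) (by positivity) (by positivity)
  · have hdp : 1 ≤ d ^ ((n : ℝ) + β) := Real.one_le_rpow hd1 hp
    have a1 : κ ≤ M / d ^ ((n : ℝ) + β) := by
      rw [le_div_iff₀ (by positivity), mul_comm]; exact h2 hd1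
    have a2 : ‖y‖ ^ ((n : ℝ) + β) ≤ (R + 1) ^ ((n : ℝ) + β) * d ^ ((n : ℝ) + β) := by
      rw [← Real.mul_rpow (by positivity) hd.le]
      exact Real.rpow_le_rpow (norm_nonneg _) (by nlinarith) hp
    calc κ * (1 + ‖y‖ ^ ((n : ℝ) + β))
        ≤ (M / d ^ ((n : ℝ) + β)) * (d ^ ((n : ℝ) + β) * (1 + (R + 1) ^ ((n : ℝ) + β))) :=
          mul_le_mul a1 (by nlinarith) (by positivity) (by positivity)
      _ = M * (1 + (R + 1) ^ ((n : ℝ) + β)) := by field_simp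
      _ ≤ _ := mul_le_mul_of_nonneg_right
          (le_add_of_nonneg_left (mul_nonneg hLam hrp)) (by positivity)

lemma tailConst_nonneg {s β r R Lam M : ℝ} (hr : 0 < r) (hR : 0 ≤ R) (hLam : 0 ≤ Lam)
    (hM : 0 ≤ M) : 0 ≤ tailConst n s β r R Lam M := by
  unfold tailConst; positivity

lemma KBounds.ae_le_tail {s β r R lam Lam M : ℝ} (hs : 0 < s) (hβ : 0 < β) (hr : 0 < r)
    (hR : 0 ≤ R) (hLam : 0 ≤ Lam) (hM : 0 ≤ M) {K : V n → V n → ℝ}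
    (hK : KBounds s β lam Lam M K) :
    ∀ᵐ p : V n × V n, r ≤ ‖p.1 - p.2‖ →
      (‖p.1‖ ≤ R → K p.1 p.2 ≤ tailConst n s β r R Lam M * tailWeight β p.2) ∧
      (‖p.2‖ ≤ R → K p.1 p.2 ≤ tailConst n s β r R Lam M * tailWeight β p.1) := by
  filter_upwards [hK.1, hK.2] with p h1 h2 hp
  refine ⟨fun h => le_tailConst_mul hs hβ hr hR hLam hM (fun h' => (h1 h').2)
    (fun h' => (h2 h').2) hp h, fun h => ?_⟩
  rw [norm_sub_rev] at h1 h2 hp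
  exact le_tailConst_mul hs hβ hr hR hLam hM (fun h' => (h1 h').2)
    (fun h' => (h2 h').2) hp h

/-- Domination of a kernel away from the diagonal: `K p ≤ κ` of the other point as soon as one of
the two points lies in `U`. -/
def TailBound (r : ℝ) (U : Set (V n)) (κ : V n → ℝ) (K : V n → V n → ℝ) : Prop :=
  ∀ᵐ p : V n × V n, r ≤ ‖p.1 - p.2‖ →
    (p.1 ∈ U → K p.1 p.2 ≤ κ p.2) ∧ (p.2 ∈ U → K p.1 p.2 ≤ κ p.1)

lemma FiniteEnergy.integrable_sq_mul_kernel {s r lam Lam : ℝ} {U : Set (V n)} {κ : V n → ℝ}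
    {K : V n → V n → ℝ} (hKm : Measurable (Function.uncurry K)) (hK0 : ∀ x y, 0 ≤ K x y)
    (hLam : 0 ≤ Lam) (hk : IsTruncKernel s r lam Lam (nearKernel r K)) (hκ0 : ∀ x, 0 ≤ κ x)
    (hκ : Integrable κ) (hT : TailBound r U κ K)
    {φ : V n → ℝ} (hφ : FiniteEnergy s r φ) (hφU : ∀ x ∉ U, φ x = 0) :
    Integrable (fun p : V n × V n => (φ p.1 - φ p.2) ^ 2 * K p.1 p.2) := by
  have hφm := hφ.meas
  have hKm' : Measurable (fun p : V n × V n => K p.1 p.2) := hKm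
  have i1 : Integrable (fun p : V n × V n => φ p.1 ^ 2 * κ p.2) := hφ.sq.mul_prod hκ
  have i2 : Integrable (fun p : V n × V n => κ p.1 * φ p.2 ^ 2) := hκ.mul_prod hφ.sq
  refine (((hφ.gag.const_mul Lam).add (i1.const_mul 2)).add (i2.const_mul 2)).mono'
    (by fun_prop : Measurable _).aestronglyMeasurable ?_
  filter_upwards [hk.upper, hT] with p h1 h2
  rw [Real.norm_of_nonneg (mul_nonneg (sq_nonneg _) (hK0 _ _))]
  simp only [Pi.add_apply]
  have hρ := truncWeight_nonneg s r (p.1 - p.2)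
  have n0 : 0 ≤ Lam * ((φ p.1 - φ p.2) ^ 2 * truncWeight s r (p.1 - p.2)) := by positivity
  have n1 : 0 ≤ φ p.1 ^ 2 * κ p.2 := mul_nonneg (sq_nonneg _) (hκ0 _)
  have n2 : 0 ≤ κ p.1 * φ p.2 ^ 2 := mul_nonneg (hκ0 _) (sq_nonneg _)
  by_cases hp : ‖p.1 - p.2‖ < r
  · simp only [nearKernel, hp, if_true] at h1
    have := mul_le_mul_of_nonneg_left h1 (sq_nonneg (φ p.1 - φ p.2))
    nlinarith
  · obtain ⟨h3, h4⟩ := h2 (not_lt.1 hp)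
    have a1 : φ p.1 ^ 2 * K p.1 p.2 ≤ φ p.1 ^ 2 * κ p.2 := by
      by_cases hx : p.1 ∈ U
      · exact mul_le_mul_of_nonneg_left (h3 hx) (sq_nonneg _)
      · simp [hφU _ hx]
    have a2 : φ p.2 ^ 2 * K p.1 p.2 ≤ κ p.1 * φ p.2 ^ 2 := by
      by_cases hx : p.2 ∈ U
      · rw [mul_comm (κ _)]; exact mul_le_mul_of_nonneg_left (h4 hx) (sq_nonneg _)
      · simp [hφU _ hx]
    have a3 : (φ p.1 - φ p.2) ^ 2 * K p.1 p.2 ≤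
        2 * (φ p.1 ^ 2 * K p.1 p.2) + 2 * (φ p.2 ^ 2 * K p.1 p.2) := by
      nlinarith [mul_nonneg (sq_nonneg (φ p.1 + φ p.2)) (hK0 p.1 p.2)]
    linarith

lemma integrable_abs_mul_abs {Ω : Set (V n)} (hΩ : MeasurableSet Ω) {g φ : V n → ℝ}
    (hgm : Measurable g) (hg : IntegrableOn (fun x => g x ^ 2) Ω) (hφm : Measurable φ)
    (hφ : Integrable (fun x => φ x ^ 2)) (hφΩ : ∀ x ∉ Ω, φ x = 0) :
    Integrable (fun x => |g x| * |φ x|) := by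
  refine (((integrable_indicator_iff hΩ).2 hg).add hφ).mono'
    (by fun_prop : Measurable _).aestronglyMeasurable (ae_of_all _ fun x => ?_)
  rw [Real.norm_of_nonneg (by positivity)]
  simp only [Pi.add_apply]
  by_cases hx : x ∈ Ω
  · rw [indicator_of_mem hx]
    nlinarith [sq_abs (g x), sq_abs (φ x), sq_nonneg (|g x| - |φ x|), sq_nonneg (|g x| + |φ x|)]
  · rw [indicator_of_notMem hx, hφΩ x hx]; simp

/-- The right-hand side seen by the localized equation. -/
def localRhs (U : Set (V n)) (κ u f : V n → ℝ) : V n → ℝ :=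
  U.indicator fun x => |f x| + 2 * (∫ y, κ y) * |u x| + 2 * ∫ y, |u y| * κ y

lemma kernelForm_nearKernel_le {s r lam Lam : ℝ} {Ω U : Set (V n)} {κ : V n → ℝ}
    {K : V n → V n → ℝ} {u f : V n → ℝ} (hr : 0 < r) (hLam : 0 ≤ Lam) (hΩ : MeasurableSet Ω)
    (hU : MeasurableSet U) (hUv : volume U ≠ ⊤) (hUΩ : ∀ x ∈ U, ∀ y, ‖x - y‖ < r → y ∈ Ω)
    (hKm : Measurable (Function.uncurry K)) (hK0 : ∀ x y, 0 ≤ K x y)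
    (hk : IsTruncKernel s r lam Lam (nearKernel r K)) (hκ0 : ∀ x, 0 ≤ κ x)
    (hκ : Integrable κ) (huκ : Integrable (fun x => |u x| * κ x))
    (hT : TailBound r U κ K) (hu : MemX Ω K u) (hfm : Measurable f)
    (hf : IntegrableOn (fun x => f x ^ 2) Ω) (hsol : IsSolution Ω K u f)
    {φ : V n → ℝ} (hφ : FiniteEnergy s r φ) (hφU : ∀ x ∉ U, φ x = 0) :
    Integrable (fun p : V n × V n => (Ω.indicator u p.1 - Ω.indicator u p.2) *
        (φ p.1 - φ p.2) * nearKernel r K p) ∧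
      kernelForm (nearKernel r K) (Ω.indicator u) φ ≤ ∫ x, localRhs U κ u f x * |φ x| := by
  obtain ⟨hum, hu2, huE⟩ := hu
  have hφm := hφ.meas
  have hKm' : Measurable (fun p : V n × V n => K p.1 p.2) := hKm
  have hUsub : U ⊆ Ω := fun x hx => hUΩ x hx x (by simpa using hr)
  have hφΩ : ∀ x ∉ Ω, φ x = 0 := fun x hx => hφU x fun h => hx (hUsub h)
  have iφ := hφ.integrable_sq_mul_kernel hKm hK0 hLam hk hκ0 hκ hT hφU
  have hcross : MeasurableSet (crossSet Ω) :=
    (hΩ.preimage measurable_fst).union (hΩ.preimage measurable_snd)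
  have iI : Integrable (fun p : V n × V n => (u p.1 - u p.2) * (φ p.1 - φ p.2) * K p.1 p.2) := by
    refine (((integrable_indicator_iff hcross).2 huE).add iφ).mono'
      (by fun_prop : Measurable _).aestronglyMeasurable (ae_of_all _ fun p => ?_)
    rw [Real.norm_eq_abs, abs_mul, abs_of_nonneg (hK0 _ _)]
    simp only [Pi.add_apply]
    by_cases hp : p ∈ crossSet Ω
    · rw [indicator_of_mem hp, ← add_mul]
      refine mul_le_mul_of_nonneg_right ?_ (hK0 _ _)
      rw [abs_le]
      constructor <;> nlinarith [sq_nonneg ((u p.1 - u p.2) + (φ p.1 - φ p.2)),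
        sq_nonneg ((u p.1 - u p.2) - (φ p.1 - φ p.2))]
    · have h1 : p.1 ∉ Ω := fun h => hp (Or.inl h)
      have h2 : p.2 ∉ Ω := fun h => hp (Or.inr h)
      rw [indicator_of_notMem hp, hφΩ _ h1, hφΩ _ h2]; simp
  set I : V n × V n → ℝ := fun p => (u p.1 - u p.2) * (φ p.1 - φ p.2) * K p.1 p.2 with hI
  set S : Set (V n × V n) := {p | ‖p.1 - p.2‖ < r} with hS
  have hSm : MeasurableSet S := measurableSet_lt (by fun_prop) measurable_const
  have eA : (fun p : V n × V n => (Ω.indicator u p.1 - Ω.indicator u p.2) *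
      (φ p.1 - φ p.2) * nearKernel r K p) = S.indicator I := by
    ext p
    by_cases hp : ‖p.1 - p.2‖ < r
    · rw [indicator_of_mem (show p ∈ S from hp)]
      simp only [nearKernel, hp, if_true, hI]
      by_cases h1 : p.1 ∈ U
      · rw [indicator_of_mem (hUsub h1), indicator_of_mem (hUΩ _ h1 _ hp)]
      · by_cases h2 : p.2 ∈ U
        · rw [indicator_of_mem (hUsub h2),
            indicator_of_mem (hUΩ _ h2 p.1 (by rwa [norm_sub_rev]))]
        · rw [hφU _ h1, hφU _ h2]; simp
    · rw [indicator_of_notMem (show p ∉ S from hp)]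
      simp [nearKernel, hp]
  rw [kernelForm, eA]
  refine ⟨iI.indicator hSm, ?_⟩
  have iabsφ : Integrable (fun x => |φ x|) := by
    have i1 : Integrable (U.indicator fun _ => (1 : ℝ)) :=
      (integrable_indicator_iff hU).2 (integrableOn_const hUv)
    refine (i1.add hφ.sq).mono' (by fun_prop : Measurable _).aestronglyMeasurable
      (ae_of_all _ fun x => ?_)
    rw [Real.norm_of_nonneg (abs_nonneg _)]
    simp only [Pi.add_apply]
    by_cases hx : x ∈ U
    · rw [indicator_of_mem hx]
      nlinarith [sq_abs (φ x), sq_nonneg (|φ x| - 1)]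
    · rw [indicator_of_notMem hx, hφU x hx]; simp
  have iu := integrable_abs_mul_abs hΩ hum hu2 hφm hφ.sq hφΩ
  have if' := integrable_abs_mul_abs hΩ hfm hf hφm hφ.sq hφΩ
  have q1 : Integrable (fun p : V n × V n => (|u p.1| * |φ p.1|) * κ p.2) := iu.mul_prod hκ
  have q2 : Integrable (fun p : V n × V n => |φ p.1| * (|u p.2| * κ p.2)) := iabsφ.mul_prod huκ
  have q3 : Integrable (fun p : V n × V n => κ p.1 * (|u p.2| * |φ p.2|)) := hκ.mul_prod iu
  have q4 : Integrable (fun p : V n × V n => (|u p.1| * κ p.1) * |φ p.2|) := huκ.mul_prod iabsφ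
  have hfar : -∫ p in Sᶜ, I p ≤
      2 * (∫ x, κ x) * (∫ x, |u x| * |φ x|) + 2 * (∫ x, |u x| * κ x) * ∫ x, |φ x| := by
    rw [← integral_indicator hSm.compl, ← integral_neg]
    have h := integral_mono_ae (iI.indicator hSm.compl).neg ((q1.add q2).add (q3.add q4)) (by
      filter_upwards [hT] with p hp
      simp only [Pi.add_apply, Pi.neg_apply]
      have n1 : 0 ≤ |u p.1| * |φ p.1| * κ p.2 := mul_nonneg (by positivity) (hκ0 _)
      have n2 : 0 ≤ |φ p.1| * (|u p.2| * κ p.2) :=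
        mul_nonneg (by positivity) (mul_nonneg (by positivity) (hκ0 _))
      have n3 : 0 ≤ κ p.1 * (|u p.2| * |φ p.2|) := mul_nonneg (hκ0 _) (by positivity)
      have n4 : 0 ≤ |u p.1| * κ p.1 * |φ p.2| :=
        mul_nonneg (mul_nonneg (by positivity) (hκ0 _)) (by positivity)
      by_cases hps : p ∈ Sᶜ
      · rw [indicator_of_mem hps]
        obtain ⟨h3, h4⟩ := hp (not_lt.1 hps)
        have a1 : |φ p.1| * K p.1 p.2 ≤ |φ p.1| * κ p.2 := by
          by_cases hx : p.1 ∈ U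
          · exact mul_le_mul_of_nonneg_left (h3 hx) (abs_nonneg _)
          · simp [hφU _ hx]
        have a2 : |φ p.2| * K p.1 p.2 ≤ |φ p.2| * κ p.1 := by
          by_cases hx : p.2 ∈ U
          · exact mul_le_mul_of_nonneg_left (h4 hx) (abs_nonneg _)
          · simp [hφU _ hx]
        have a3 : -I p ≤ (|u p.1| + |u p.2|) * (|φ p.1| * K p.1 p.2 + |φ p.2| * K p.1 p.2) := by
          refine (neg_le_abs _).trans ?_
          simp only [hI]
          rw [abs_mul, abs_mul, abs_of_nonneg (hK0 _ _), ← add_mul, ← mul_assoc]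
          refine mul_le_mul_of_nonneg_right ?_ (hK0 _ _)
          exact mul_le_mul (abs_sub _ _) (abs_sub _ _) (abs_nonneg _) (by positivity)
        have a4 := mul_le_mul_of_nonneg_left (add_le_add a1 a2)
          (by positivity : 0 ≤ |u p.1| + |u p.2|)
        refine (a3.trans a4).trans (le_of_eq (by ring))
      · rw [indicator_of_notMem hps, neg_zero]; linarith)
    refine h.trans (le_of_eq ?_)
    have e1 : ∫ p : V n × V n, (|u p.1| * |φ p.1|) * κ p.2 = _ :=
      integral_prod_mul (fun x => |u x| * |φ x|) κ
    have e2 : ∫ p : V n × V n, |φ p.1| * (|u p.2| * κ p.2) = _ :=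
      integral_prod_mul (fun x => |φ x|) (fun x => |u x| * κ x)
    have e3 : ∫ p : V n × V n, κ p.1 * (|u p.2| * |φ p.2|) = _ :=
      integral_prod_mul κ (fun x => |u x| * |φ x|)
    have e4 : ∫ p : V n × V n, (|u p.1| * κ p.1) * |φ p.2| = _ :=
      integral_prod_mul (fun x => |u x| * κ x) (fun x => |φ x|)
    have e12 := integral_add q1 q2
    have e34 := integral_add q3 q4
    have e := integral_add (q1.add q2) (q3.add q4)
    simp only [Pi.add_apply] at e ⊢
    rw [e, e12, e34, e1, e2, e3, e4]
    ring
  have hX0 : MemX0 Ω K φ := ⟨⟨hφm, hφ.sq.integrableOn, iφ.integrableOn⟩, ae_of_all _ hφΩ⟩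
  have hE := hsol φ hX0
  have hE' : energyForm K u φ = ∫ p, I p := by
    rw [Measure.volume_eq_prod] at iI ⊢
    exact (integral_prod _ iI).symm
  have hsplit := integral_add_compl hSm iI
  have hfφ : ∫ x in Ω, f x * φ x ≤ ∫ x, |f x| * |φ x| := by
    rw [setIntegral_eq_integral_of_forall_compl_eq_zero (fun x hx => by rw [hφΩ x hx, mul_zero])]
    refine (le_abs_self _).trans ((abs_integral_le_integral_abs).trans (le_of_eq ?_))
    simp only [abs_mul]
  have hG : ∫ x, localRhs U κ u f x * |φ x| = (∫ x, |f x| * |φ x|) +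
      2 * (∫ x, κ x) * (∫ x, |u x| * |φ x|) + 2 * (∫ x, |u x| * κ x) * ∫ x, |φ x| := by
    simp only [localRhs]
    generalize 2 * (∫ x, κ x) = c1
    generalize 2 * (∫ x, |u x| * κ x) = c2
    have iu' : Integrable (fun x => c1 * (|u x| * |φ x|)) := iu.const_mul _
    have i3 : Integrable (fun x => |f x| * |φ x| + c1 * (|u x| * |φ x|)) := if'.add iu'
    rw [← integral_const_mul, ← integral_const_mul, ← integral_add if' iu',
      ← integral_add i3 (iabsφ.const_mul _)]
    refine integral_congr_ae (ae_of_all _ fun x => ?_)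
    simp only
    by_cases hx : x ∈ U
    · rw [indicator_of_mem hx]; ring
    · rw [indicator_of_notMem hx, hφU x hx]; simp
  rw [integral_indicator hSm, hG]
  linarith

lemma measurable_localRhs {U : Set (V n)} (hU : MeasurableSet U) {κ u f : V n → ℝ}
    (hum : Measurable u) (hfm : Measurable f) : Measurable (localRhs U κ u f) :=
  Measurable.indicator (by fun_prop) hU

lemma localRhs_sq {Ω U : Set (V n)} (hΩ : MeasurableSet Ω) (hU : MeasurableSet U)
    (hUv : volume U ≠ ⊤) (hUsub : U ⊆ Ω) {κ u f : V n → ℝ} (hum : Measurable u)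
    (hu : IntegrableOn (fun x => u x ^ 2) Ω) (hfm : Measurable f)
    (hf : IntegrableOn (fun x => f x ^ 2) Ω) :
    Integrable (fun x => localRhs U κ u f x ^ 2) ∧
      ∫ x, localRhs U κ u f x ^ 2 ≤ 3 * (∫ x in Ω, f x ^ 2) +
        12 * (∫ y, κ y) ^ 2 * (∫ x in Ω, u x ^ 2) +
        12 * (∫ y, |u y| * κ y) ^ 2 * volume.real U := by
  have i1 := (integrable_indicator_iff hΩ).2 hf
  have i2 := (integrable_indicator_iff hΩ).2 hu
  have i3 : Integrable (U.indicator fun _ => (1 : ℝ)) :=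
    (integrable_indicator_iff hU).2 (integrableOn_const hUv)
  have hm := measurable_localRhs (κ := κ) hU hum hfm
  simp only [localRhs] at hm ⊢
  generalize (∫ y, |u y| * κ y) = b at hm ⊢
  generalize (∫ y, κ y) = a at hm ⊢
  have hI := ((i1.const_mul 3).add (i2.const_mul (12 * a ^ 2))).add (i3.const_mul (12 * b ^ 2))
  have hpt : ∀ x, (U.indicator (fun x => |f x| + 2 * a * |u x| + 2 * b) x) ^ 2 ≤
      3 * Ω.indicator (fun x => f x ^ 2) x + 12 * a ^ 2 * Ω.indicator (fun x => u x ^ 2) x +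
        12 * b ^ 2 * U.indicator (fun _ => (1 : ℝ)) x := by
    intro x
    by_cases hx : x ∈ U
    · rw [indicator_of_mem hx, indicator_of_mem (hUsub hx), indicator_of_mem (hUsub hx),
        indicator_of_mem hx, ← sq_abs (f x), ← sq_abs (u x)]
      nlinarith [sq_nonneg (|f x| - 2 * a * |u x|), sq_nonneg (|f x| - 2 * b),
        sq_nonneg (2 * a * |u x| - 2 * b)]
    · rw [indicator_of_notMem hx, indicator_of_notMem hx]
      have h1 : 0 ≤ Ω.indicator (fun x => f x ^ 2) x := indicator_nonneg (fun _ _ => sq_nonneg _) _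
      have h2 : 0 ≤ Ω.indicator (fun x => u x ^ 2) x := indicator_nonneg (fun _ _ => sq_nonneg _) _
      have : 0 ≤ 12 * a ^ 2 * Ω.indicator (fun x => u x ^ 2) x := by positivity
      linarith
  have hL : Integrable (fun x => (U.indicator (fun x => |f x| + 2 * a * |u x| + 2 * b) x) ^ 2) :=
    hI.mono' (hm.pow_const 2).aestronglyMeasurable
      (ae_of_all _ fun x => by
        rw [Real.norm_of_nonneg (sq_nonneg _)]
        exact hpt x)
  refine ⟨hL, (integral_mono hL hI hpt).trans (le_of_eq ?_)⟩
  have e1 := integral_add (i1.const_mul 3) (i2.const_mul (12 * a ^ 2))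
  have e2 := integral_add ((i1.const_mul 3).add (i2.const_mul (12 * a ^ 2)))
    (i3.const_mul (12 * b ^ 2))
  simp only [Pi.add_apply] at e2 ⊢
  rw [e2, e1, integral_const_mul, integral_const_mul, integral_const_mul, integral_indicator hΩ,
    integral_indicator hΩ, integral_indicator hU]
  simp

/-- Caccioppoli inequality for solutions. -/
lemma caccioppoli (hn : 1 ≤ n) {s r lam Lam L : ℝ} {Ω U : Set (V n)} {K : V n → V n → ℝ}
    {u G η : V n → ℝ} (hs : s < 1) (hr : 0 < r) (hlam : 0 < lam) (hΩ : MeasurableSet Ω)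
    (hUΩ : ∀ x ∈ U, ∀ y, ‖x - y‖ < r → y ∈ Ω)
    (hK0 : ∀ x y, 0 ≤ K x y) (hk : IsTruncKernel s r lam Lam (nearKernel r K))
    (hu : MemX Ω K u) (hGm : Measurable G) (hG : Integrable (fun x => G x ^ 2))
    (hηm : Measurable η) (hη1 : ∀ x, |η x| ≤ 1) (hηL : ∀ x y, |η x - η y| ≤ L * ‖x - y‖)
    (hηU : ∀ x ∉ U, η x = 0)
    (hP : ∀ φ : V n → ℝ, FiniteEnergy s r φ → (∀ x ∉ U, φ x = 0) →
      Integrable (fun p : V n × V n => (Ω.indicator u p.1 - Ω.indicator u p.2) *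
        (φ p.1 - φ p.2) * nearKernel r K p) ∧
      kernelForm (nearKernel r K) (Ω.indicator u) φ ≤ ∫ x, G x * |φ x|) :
    FiniteEnergy s r (fun x => η x * Ω.indicator u x) ∧
      lam * truncEnergy s r (fun x => η x * Ω.indicator u x) ≤
        1 / 2 * (∫ x, G x ^ 2) + (1 / 2 + Lam * L ^ 2 * truncMoment n s r) *
          ∫ x in Ω, u x ^ 2 := by
  obtain ⟨hum, hu2, huE⟩ := hu
  have hUsub : U ⊆ Ω := fun x hx => hUΩ x hx x (by simpa using hr)
  have hcross : MeasurableSet (crossSet Ω) :=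
    (hΩ.preimage measurable_fst).union (hΩ.preimage measurable_snd)
  set w : V n → ℝ := Ω.indicator u with hw
  have hwm : Measurable w := hum.indicator hΩ
  have hw2 : (fun x => w x ^ 2) = Ω.indicator (fun x => u x ^ 2) := by
    ext x
    by_cases hx : x ∈ Ω <;> simp [hw, hx]
  have hwI : Integrable (fun x => w x ^ 2) := by
    rw [hw2]; exact (integrable_indicator_iff hΩ).2 hu2
  have hwe : ∫ x, w x ^ 2 = ∫ x in Ω, u x ^ 2 := by rw [hw2, integral_indicator hΩ]
  have hηw : FiniteEnergy s r (fun x => η x * w x) := by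
    refine (FiniteEnergy.cutoff_of_local hn hs hr hηm hη1 hηL hwm hwI
      (((integrable_indicator_iff hcross).2 huE).const_mul (1 / lam)) ?_).1
    filter_upwards [hk.lower] with p hp
    have hD0 : 0 ≤ (crossSet Ω).indicator
        (fun p : V n × V n => (u p.1 - u p.2) ^ 2 * K p.1 p.2) p :=
      indicator_nonneg (fun p _ => mul_nonneg (sq_nonneg _) (hK0 _ _)) p
    by_cases hpr : ‖p.1 - p.2‖ < r
    · by_cases h1 : p.1 ∈ U
      · have hm : p ∈ crossSet Ω := Or.inl (hUsub h1)
        rw [indicator_of_mem hm, hw, indicator_of_mem (hUsub h1),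
          indicator_of_mem (hUΩ _ h1 _ hpr)]
        simp only [nearKernel, hpr, if_true] at hp
        have hη2 : η p.1 ^ 2 ≤ 1 := by
          rw [← sq_abs]; exact pow_le_one₀ (abs_nonneg _) (hη1 _)
        have hρ : truncWeight s r (p.1 - p.2) ≤ 1 / lam * K p.1 p.2 := by
          rw [one_div, ← div_eq_inv_mul, le_div_iff₀ hlam, mul_comm]; exact hp
        calc (η p.1 * (u p.1 - u p.2)) ^ 2 * truncWeight s r (p.1 - p.2)
            = η p.1 ^ 2 * ((u p.1 - u p.2) ^ 2 * truncWeight s r (p.1 - p.2)) := by ring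
          _ ≤ 1 * ((u p.1 - u p.2) ^ 2 * truncWeight s r (p.1 - p.2)) :=
              mul_le_mul_of_nonneg_right hη2
                (mul_nonneg (sq_nonneg _) (truncWeight_nonneg _ _ _))
          _ ≤ 1 * ((u p.1 - u p.2) ^ 2 * (1 / lam * K p.1 p.2)) := by gcongr
          _ = _ := by ring
      · rw [hηU _ h1]
        simp only [zero_mul, ne_eq, OfNat.ofNat_ne_zero, not_false_eq_true, zero_pow]
        positivity
    · rw [truncWeight, if_neg hpr, mul_zero]; positivity
  have hψ : FiniteEnergy s r (fun x => η x * (η x * w x)) :=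
    (FiniteEnergy.cutoff hn hs hr hηm hη1 hηL hηw).1
  obtain ⟨p1, p2⟩ := hP _ hψ (fun x hx => by simp [hηU x hx])
  refine ⟨hηw, ?_⟩
  have b1 := hk.energy_cutoff_le hn hs hr hlam.le hηL hwI hηw p1
  have b2 := integral_mul_abs_le hGm hG hψ.meas hψ.sq one_pos
  have b3 : ∫ x, (η x * (η x * w x)) ^ 2 ≤ ∫ x, w x ^ 2 := integral_mono hψ.sq hwI fun x => by
    simp only
    have hη2 : η x ^ 2 ≤ 1 := by rw [← sq_abs]; exact pow_le_one₀ (abs_nonneg _) (hη1 _)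
    have h4 : η x ^ 2 * η x ^ 2 ≤ 1 := mul_le_one₀ hη2 (sq_nonneg _) hη2
    calc (η x * (η x * w x)) ^ 2 = (η x ^ 2 * η x ^ 2) * w x ^ 2 := by ring
      _ ≤ 1 * w x ^ 2 := mul_le_mul_of_nonneg_right h4 (sq_nonneg _)
      _ = _ := one_mul _
  rw [hwe] at b1 b3
  linarith

lemma kernelForm_nearKernel_congr {r : ℝ} {K : V n → V n → ℝ} {v w φ : V n → ℝ} (hr : 0 < r)
    (h : ∀ x, φ x ≠ 0 → ∀ y, ‖x - y‖ < r → v y = w y) :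
    kernelForm (nearKernel r K) v φ = kernelForm (nearKernel r K) w φ := by
  unfold kernelForm
  congr 1; ext p
  by_cases hp : ‖p.1 - p.2‖ < r
  · by_cases h1 : φ p.1 = 0
    · by_cases h2 : φ p.2 = 0
      · simp [h1, h2]
      · rw [h _ h2 p.1 (by rwa [norm_sub_rev]), h _ h2 p.2 (by simpa using hr)]
    · rw [h _ h1 p.1 (by simpa using hr), h _ h1 p.2 hp]
  · simp [nearKernel, hp]

/-- A Lipschitz cutoff equal to `1` where the distance to `S` is at most `j * r` and vanishing
where it is at least `(j + 1) * r`. -/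
def distCutoff (S : Set (V n)) (r j : ℝ) (x : V n) : ℝ :=
  max 0 (min 1 (j + 1 - infDist x S / r))

lemma measurable_distCutoff (S : Set (V n)) (r j : ℝ) : Measurable (distCutoff S r j) := by
  unfold distCutoff
  have : Measurable (fun x : V n => infDist x S) := (continuous_infDist_pt S).measurable
  fun_prop

lemma abs_distCutoff_le_one (S : Set (V n)) (r j : ℝ) (x : V n) : |distCutoff S r j x| ≤ 1 := by
  unfold distCutoff
  rw [abs_of_nonneg (le_max_left _ _)]
  exact max_le zero_le_one (min_le_left _ _)

lemma distCutoff_eq_one {S : Set (V n)} {r j : ℝ} (hr : 0 < r) {x : V n}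
    (hx : infDist x S ≤ j * r) : distCutoff S r j x = 1 := by
  have : infDist x S / r ≤ j := by rwa [div_le_iff₀ hr]
  rw [distCutoff, min_eq_left (by linarith), max_eq_right zero_le_one]

lemma infDist_lt_of_distCutoff_ne_zero {S : Set (V n)} {r j : ℝ} (hr : 0 < r) {x : V n}
    (hx : distCutoff S r j x ≠ 0) : infDist x S < (j + 1) * r := by
  by_contra! h
  refine hx ?_
  have : j + 1 ≤ infDist x S / r := by rwa [le_div_iff₀ hr]
  rw [distCutoff]
  exact max_eq_left ((min_le_right _ _).trans (by linarith))

lemma abs_distCutoff_sub_le (S : Set (V n)) {r : ℝ} (hr : 0 < r) (j : ℝ) (x y : V n) :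
    |distCutoff S r j x - distCutoff S r j y| ≤ 1 / r * ‖x - y‖ := by
  unfold distCutoff
  refine (abs_max_sub_max_le_max _ _ _ _).trans ?_
  rw [sub_self, abs_zero, max_eq_right (abs_nonneg _)]
  refine (abs_min_sub_min_le_max _ _ _ _).trans ?_
  rw [sub_self, abs_zero, max_eq_right (abs_nonneg _), sub_sub_sub_cancel_left, ← sub_div, abs_div,
    abs_of_pos hr, one_div, ← div_eq_inv_mul]
  refine div_le_div_of_nonneg_right ?_ hr.le
  rw [abs_sub_le_iff]
  have h1 := infDist_le_infDist_add_dist (s := S) (x := x) (y := y)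
  have h2 := infDist_le_infDist_add_dist (s := S) (x := y) (y := x)
  rw [dist_comm y x, dist_eq_norm] at h2
  rw [dist_eq_norm] at h1
  constructor <;> linarith

lemma infDist_add_lt {S : Set (V n)} {x z : V n} {a b : ℝ} (hx : infDist (x + z) S < a)
    (hz : ‖z‖ < b) : infDist x S < a + b := by
  have h := infDist_le_infDist_add_dist (s := S) (x := x) (y := x + z)
  rw [dist_eq_norm, sub_add_cancel_left, norm_neg] at h
  linarith

/-- Bound for second differences of a localized solution. -/
lemma exists_shift2NormSq_le (hn : 1 ≤ n) {s r τ lam Lam Gam : ℝ} (S : Set (V n)) (hs0 : 0 < s)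
    (hs : s < 1) (hr : 0 < r) (hr1 : r ≤ 1) (hτ1 : τ ≤ 1) (hτs : τ ≤ 2 * s) (hlam : 0 < lam)
    (hLam : 0 ≤ Lam) :
    ∃ C > 0, ∀ (k : V n × V n → ℝ) (v G : V n → ℝ) (z : V n),
      IsTruncKernel s r lam Lam k → FiniteEnergy s r v → Measurable G →
      Integrable (fun x => G x ^ 2) → z ≠ 0 → ‖z‖ < r →
      (∀ᵐ p : V n × V n,
        |k (p.1 + z, p.2 + z) - k p| ≤ Gam * ‖z‖ ^ s * truncWeight s r (p.1 - p.2)) →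
      (∀ φ : V n → ℝ, FiniteEnergy s r φ → (∀ x, φ x ≠ 0 → infDist x S < 5 * r) →
        kernelForm k v φ ≤ ∫ x, G x * |φ x|) →
      shift2NormSq (fun x => distCutoff S r 0 x * v x) z ≤
        C * ((∫ x, G x ^ 2) + truncEnergy s r v + ∫ x, v x ^ 2) * ‖z‖ ^ (2 * τ) := by
  obtain ⟨C1, hC1, h1⟩ := exists_energy_diff_le (n := n) (s := s) (r := r) (lam := lam)
    (Lam := Lam) (Gam := Gam) (L := 1 / r) hn hs0 hs hr hlam hLam
  set N := nikolskiiConst n with hN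
  have hNp : 0 < N := nikolskiiConst_pos n
  refine ⟨3 * N * C1 + 60 * (1 / r) ^ 2, by positivity, ?_⟩
  intro k v G z hk hv hGm hG hz hzr hH hP
  set η := distCutoff S r 3 with hη
  have hηm : Measurable η := measurable_distCutoff S r 3
  have hη1 : ∀ x, |η x| ≤ 1 := abs_distCutoff_le_one S r 3
  have hηL := abs_distCutoff_sub_le S hr 3
  have a1 := h1 k v G η z hk hv hGm hG hηm hη1 hηL hz hzr hH (fun φ hφ hφ0 => by
    refine hP φ hφ fun x hx => ?_
    by_cases hx0 : η x = 0
    · have hxz : η (x + -z) ≠ 0 := fun h => hx (hφ0 x h hx0)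
      have := infDist_add_lt (infDist_lt_of_distCutoff_ne_zero hr hxz)
        (show ‖-z‖ < r by rwa [norm_neg])
      linarith
    · have := infDist_lt_of_distCutoff_ne_zero hr hx0
      linarith)
  have hΔ : FiniteEnergy s r (fun x => η x * (v (x + z) - v x)) :=
    (FiniteEnergy.cutoff hn hs hr hηm hη1 hηL ((hv.translate z).sub hv)).1
  have a2 := hΔ.shiftNormSq_le hs0 hzr
  have a3 := shift2NormSq_cutoff_le (measurable_distCutoff S r 0) (abs_distCutoff_le_one S r 0)
    (abs_distCutoff_sub_le S hr 0) hηm hη1 (z := z) (fun x hx => by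
      have b1 := infDist_lt_of_distCutoff_ne_zero hr hx
      have b2 := infDist_add_lt b1 hzr
      have b3 := infDist_add_lt b2 hzr
      exact ⟨distCutoff_eq_one hr (by linarith), distCutoff_eq_one hr (by linarith)⟩)
    hv.meas hv.sq
  have a4 := shiftNormSq_le hv.meas hv.sq z
  set g := ∫ x, G x ^ 2
  set E := truncEnergy s r v
  set I := ∫ x, v x ^ 2
  have hg0 : 0 ≤ g := integral_nonneg fun _ => sq_nonneg _
  have hE0 : 0 ≤ E := truncEnergy_nonneg _ _ _
  have hI0 : 0 ≤ I := integral_nonneg fun _ => sq_nonneg _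
  have hzp : 0 < ‖z‖ := norm_pos_iff.2 hz
  have hz1 : ‖z‖ ≤ 1 := (hzr.trans_le hr1).le
  have p1 : ‖z‖ ^ (2 * s) * ‖z‖ ^ (2 * s) ≤ ‖z‖ ^ (2 * τ) := by
    rw [← Real.rpow_add hzp]
    exact Real.rpow_le_rpow_of_exponent_ge hzp hz1 (by linarith)
  have p2 : ‖z‖ ^ 2 ≤ ‖z‖ ^ (2 * τ) := by
    rw [← Real.rpow_natCast]
    exact Real.rpow_le_rpow_of_exponent_ge hzp hz1 (by push_cast; linarith)
  set T := ‖z‖ ^ (2 * τ)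
  have hT0 : 0 ≤ T := by positivity
  have q1 : shiftNormSq (fun x => η x * (v (x + z) - v x)) z ≤ N * C1 * (g + E) * T := by
    calc _ ≤ N * ‖z‖ ^ (2 * s) * (C1 * ‖z‖ ^ (2 * s) * (g + E)) :=
          a2.trans (mul_le_mul_of_nonneg_left a1 (by positivity))
      _ = N * C1 * (g + E) * (‖z‖ ^ (2 * s) * ‖z‖ ^ (2 * s)) := by ring
      _ ≤ _ := mul_le_mul_of_nonneg_left p1 (by positivity)
  have q2 : 12 * (1 / r) ^ 2 * ‖z‖ ^ 2 * (shiftNormSq v z + I) ≤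
      60 * (1 / r) ^ 2 * I * T := by
    calc _ ≤ 12 * (1 / r) ^ 2 * ‖z‖ ^ 2 * (4 * I + I) := by gcongr
      _ = 60 * (1 / r) ^ 2 * I * ‖z‖ ^ 2 := by ring
      _ ≤ _ := mul_le_mul_of_nonneg_left p2 (by positivity)
  have q3 : 0 ≤ 3 * N * C1 * I * T := by positivity
  have q4 : 0 ≤ 60 * (1 / r) ^ 2 * (g + E) * T := by positivity
  calc _ ≤ _ := a3
    _ ≤ 3 * (N * C1 * (g + E) * T) + 60 * (1 / r) ^ 2 * I * T := by linarith
    _ ≤ _ := by linarith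

set_option maxHeartbeats 1600000 in
/-- The interior estimate in squared form. -/
lemma exists_lintegral_le (hn : 1 ≤ n) {s β lam Lam M Gam σ : ℝ} (hs : s ∈ Ioo (0 : ℝ) 1)
    (hβ : 0 < β) (hlam : 0 < lam) (hlL : lam ≤ Lam) (hM : 0 < M)
    {Ω : Set (V n)} (hΩ : IsOpen Ω) (hσ0 : 0 < σ) (hσs : σ < 2 * s) (hσ1 : σ < 1)
    {Ω' : Set (V n)} (hΩ' : IsOpen Ω') (hne : Ω'.Nonempty) (hΩ'c : IsCompact (closure Ω'))
    (hΩ'Ω : closure Ω' ⊆ Ω) :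
    ∃ C > 0, ∀ (K : V n → V n → ℝ) (u f : V n → ℝ),
      Measurable (Function.uncurry K) → (∀ x y, 0 ≤ K x y) →
      KBounds s β lam Lam M K → KHolder s Gam K →
      MemX Ω K u → HasFiniteWnorm β 0 u →
      Measurable f → IntegrableOn (fun x => f x ^ 2) Ω → IsSolution Ω K u f →
      ∫⁻ q in Ω' ×ˢ Ω', ENNReal.ofReal
            ((u q.1 - u q.2) ^ 2 / ‖q.1 - q.2‖ ^ ((n : ℝ) + 2 * σ)) ≤
        ENNReal.ofReal (C * ((∫ x in Ω, u x ^ 2) + wnorm β 0 u ^ 2 + ∫ x in Ω, f x ^ 2)) := by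
  obtain ⟨hs0, hs1⟩ := hs
  have hLam : 0 < Lam := hlam.trans_le hlL
  set S := closure Ω' with hS
  have hSne : S.Nonempty := hne.closure
  obtain ⟨d, hd, hdΩ⟩ := hΩ'c.exists_cthickening_subset_open hΩ hΩ'Ω
  obtain ⟨R0, hR0⟩ := hΩ'c.isBounded.subset_closedBall (0 : V n)
  set r := min d 1 / 8 with hr_def
  have hr : 0 < r := by positivity
  have hrd : 8 * r ≤ d := by rw [hr_def]; linarith [min_le_left d 1]
  have hr1 : r ≤ 1 := by rw [hr_def]; linarith [min_le_right d 1]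
  obtain ⟨τ, hτσ, hτ⟩ := exists_between (lt_min hσ1 hσs)
  have hτ1 : τ < 1 := hτ.trans_le (min_le_left _ _)
  have hτs : τ < 2 * s := hτ.trans_le (min_le_right _ _)
  set U : Set (V n) := {x | infDist x S < 7 * r} with hU_def
  have hUo : IsOpen U := isOpen_lt (continuous_infDist_pt S) continuous_const
  have hU := hUo.measurableSet
  set R := max R0 0 + 7 * r with hR_def
  have hR : 0 ≤ R := by positivity
  have hUR : ∀ x ∈ U, ‖x‖ ≤ R := fun x hx => by
    obtain ⟨y, hyS, hy⟩ := (infDist_lt_iff hSne).1 hx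
    have h1 : ‖y‖ ≤ R0 := by simpa using hR0 hyS
    rw [dist_eq_norm] at hy
    have h2 : ‖x‖ ≤ ‖x - y‖ + ‖y‖ := by simpa using norm_add_le (x - y) y
    rw [hR_def]; linarith [le_max_left R0 0]
  have hUv : volume U ≠ ⊤ := ne_top_of_le_ne_top measure_closedBall_lt_top.ne
    (measure_mono fun x hx => mem_closedBall_zero_iff.2 (hUR x hx) :
      volume U ≤ volume (closedBall (0 : V n) R))
  have hUΩ : ∀ x ∈ U, ∀ y, ‖x - y‖ < r → y ∈ Ω := fun x hx y hxy => by
    obtain ⟨w, hwS, hw⟩ := (infDist_lt_iff hSne).1 hx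
    refine hdΩ (mem_cthickening_of_dist_le y w d S hwS ?_)
    have h1 := dist_triangle y x w
    rw [dist_comm y x, dist_eq_norm x y] at h1
    linarith
  have hUsub : U ⊆ Ω := fun x hx => hUΩ x hx x (by simpa using hr)
  set c := tailConst n s β r R Lam M with hc
  have hc0 : 0 ≤ c := tailConst_nonneg hr hR hLam.le hM.le
  set κ : V n → ℝ := fun y => c * tailWeight β y with hκ_def
  have hκ0 : ∀ y, 0 ≤ κ y := fun y => mul_nonneg hc0 (tailWeight_nonneg _ _)
  have hκ : Integrable κ := (integrable_tailWeight hβ).const_mul c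
  obtain ⟨C1, hC1, h1⟩ := exists_shift2NormSq_le (n := n) (Gam := Gam) hn S hs0 hs1 hr hr1
    hτ1.le hτs.le hlam hLam.le
  obtain ⟨C2, hC2, h2⟩ := exists_shiftNormSq_le_of_shift2NormSq_le (n := n) hτ1 hr
  set a := ∫ y, κ y with ha
  set cG := 3 + 12 * a ^ 2 + 12 * c ^ 2 * volume.real U with hcG
  have hcG0 : 0 ≤ cG := by positivity
  set m := truncMoment n s r with hm
  have hm0 : 0 ≤ m := truncMoment_nonneg n s r
  set cE := 1 / lam * (1 / 2 * cG + (1 / 2 + Lam * (1 / r) ^ 2 * m)) with hcE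
  have hcE0 : 0 ≤ cE := by positivity
  set J := ∫ h : V n, ‖h‖ ^ (2 * τ) * truncWeight σ (2 * max R0 0 + 1) h with hJ
  have hJ0 : 0 ≤ J := integral_nonneg fun h =>
    mul_nonneg (by positivity) (truncWeight_nonneg _ _ _)
  refine ⟨C2 * (C1 * (cG + cE + 1) + 1) * J + 1, by positivity, ?_⟩
  intro K u f hKm hK0 hKB hKH hu huW hfm hf hsol
  have hk := isTruncKernel_nearKernel hs0 hr1 hlam hKm hKB
  have hwn : wnorm β 0 u = ∫ x, |u x| * tailWeight β x := by
    simp [wnorm, tailWeight, div_eq_mul_inv]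
  have huκ : Integrable (fun x => |u x| * κ x) := by
    refine (huW.const_mul c).congr (ae_of_all _ fun x => ?_)
    simp only [hκ_def, tailWeight, sub_zero]; ring
  have huκe : ∫ x, |u x| * κ x = c * wnorm β 0 u := by
    rw [hwn, ← integral_const_mul]
    congr 1; ext x; simp only [hκ_def]; ring
  have hT : TailBound r U κ K := by
    filter_upwards [hKB.ae_le_tail hs0 hβ hr hR hLam.le hM.le] with p hp hpr
    exact ⟨fun h => (hp hpr).1 (hUR _ h), fun h => (hp hpr).2 (hUR _ h)⟩
  set G := localRhs U κ u f with hG_def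
  have hGm : Measurable G := measurable_localRhs hU hu.1 hfm
  obtain ⟨hG, hGle⟩ := localRhs_sq (κ := κ) hΩ.measurableSet hU hUv hUsub hu.1 hu.2.1 hfm hf
  have hP : ∀ φ : V n → ℝ, FiniteEnergy s r φ → (∀ x ∉ U, φ x = 0) → _ := fun φ hφ hφU =>
    kernelForm_nearKernel_le hr hLam.le hΩ.measurableSet hU hUv hUΩ hKm hK0 hk hκ0 hκ huκ hT hu
      hfm hf hsol hφ hφU
  set η := distCutoff S r 6 with hη
  have hηU : ∀ x ∉ U, η x = 0 := fun x hx => by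
    by_contra h
    refine hx ?_
    have := infDist_lt_of_distCutoff_ne_zero hr h
    simp only [hU_def, mem_ofPred_eq]; linarith
  obtain ⟨hv, hvE⟩ := caccioppoli (L := 1 / r) hn hs1 hr hlam hΩ.measurableSet hUΩ hK0 hk hu hGm hG
    (measurable_distCutoff S r 6) (abs_distCutoff_le_one S r 6) (abs_distCutoff_sub_le S hr 6)
    hηU hP
  set v : V n → ℝ := fun x => η x * Ω.indicator u x with hv_def
  set X := (∫ x in Ω, u x ^ 2) + wnorm β 0 u ^ 2 + ∫ x in Ω, f x ^ 2 with hX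
  have hu0 : 0 ≤ ∫ x in Ω, u x ^ 2 := integral_nonneg fun _ => sq_nonneg _
  have hf0 : 0 ≤ ∫ x in Ω, f x ^ 2 := integral_nonneg fun _ => sq_nonneg _
  have hX0 : 0 ≤ X := by positivity
  have huX : ∫ x in Ω, u x ^ 2 ≤ X := by rw [hX]; nlinarith [sq_nonneg (wnorm β 0 u)]
  have hfX : ∫ x in Ω, f x ^ 2 ≤ X := by rw [hX]; nlinarith [sq_nonneg (wnorm β 0 u)]
  have hwX : wnorm β 0 u ^ 2 ≤ X := by rw [hX]; linarith
  have hGX : ∫ x, G x ^ 2 ≤ cG * X := by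
    refine hGle.trans ?_
    rw [huκe, ← ha, mul_pow, hcG]
    have t1 := mul_le_mul_of_nonneg_left huX (by positivity : 0 ≤ 12 * a ^ 2)
    have t2 := mul_le_mul_of_nonneg_left hwX (by positivity : 0 ≤ 12 * c ^ 2 * volume.real U)
    linarith
  have hEX : truncEnergy s r v ≤ cE * X := by
    rw [hcE, mul_assoc, one_div, ← div_eq_inv_mul, le_div_iff₀ hlam, mul_comm]
    refine hvE.trans ?_
    have t1 := mul_le_mul_of_nonneg_left huX
      (by positivity : 0 ≤ 1 / 2 + Lam * (1 / r) ^ 2 * m)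
    linarith
  have hcut : ∀ χ w : V n → ℝ, (∀ x, |χ x| ≤ 1) → ∀ x, (χ x * w x) ^ 2 ≤ w x ^ 2 := by
    intro χ w hχ x
    rw [mul_pow]
    refine mul_le_of_le_one_left (sq_nonneg _) ?_
    rw [← sq_abs]; exact pow_le_one₀ (abs_nonneg _) (hχ x)
  have hvX : ∫ x, v x ^ 2 ≤ X := by
    refine le_trans ?_ huX
    rw [← integral_indicator hΩ.measurableSet]
    refine integral_mono hv.sq ((integrable_indicator_iff hΩ.measurableSet).2 hu.2.1) fun x => ?_
    refine (hcut η (Ω.indicator u) (abs_distCutoff_le_one S r 6) x).trans (le_of_eq ?_)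
    by_cases hx : x ∈ Ω <;> simp [hx]
  set ζ := distCutoff S r 0 with hζ
  have hζm : Measurable (fun x => ζ x * v x) := (measurable_distCutoff S r 0).mul hv.meas
  have hζI : Integrable (fun x => (ζ x * v x) ^ 2) := by
    refine hv.sq.mono' (hζm.pow_const 2).aestronglyMeasurable (ae_of_all _ fun x => ?_)
    rw [Real.norm_of_nonneg (sq_nonneg _)]
    exact hcut ζ v (abs_distCutoff_le_one S r 0) x
  have hζX : ∫ x, (ζ x * v x) ^ 2 ≤ X :=
    (integral_mono hζI hv.sq (hcut ζ v (abs_distCutoff_le_one S r 0))).trans hvX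
  have hPv : ∀ φ : V n → ℝ, FiniteEnergy s r φ → (∀ x, φ x ≠ 0 → infDist x S < 5 * r) →
      kernelForm (nearKernel r K) v φ ≤ ∫ x, G x * |φ x| := fun φ hφ hφS => by
    rw [kernelForm_nearKernel_congr (w := Ω.indicator u) hr]
    · refine (hP φ hφ fun x hx => ?_).2
      by_contra h
      have := hφS x h
      exact hx (by simp only [hU_def, mem_ofPred_eq]; linarith)
    · intro x hx y hxy
      have t1 := infDist_le_infDist_add_dist (s := S) (x := y) (y := x)
      rw [dist_comm, dist_eq_norm] at t1
      have t2 := hφS x hx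
      have : η y = 1 := distCutoff_eq_one hr (by linarith)
      simp [hv_def, this]
  have hshift : ∀ᵐ z : V n, shiftNormSq (fun x => ζ x * v x) z ≤
      C2 * (C1 * (cG + cE + 1) + 1) * X * ‖z‖ ^ (2 * τ) := by
    have hz0 : ∀ᵐ z : V n, z ≠ 0 := by
      have : Nonempty (Fin n) := ⟨⟨0, hn⟩⟩
      exact Measure.ae_ne volume 0
    filter_upwards [ae_forall_two_pow_smul (hKH.ae_nearKernel (r := r) hs0 hr1 hlam hKB), hz0]
      with z hz hz0
    have t := h2 (fun x => ζ x * v x) (C1 * (cG + cE + 1) * X) hζm hζI (by positivity) z hz0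
      (fun j hj => by
        have hzj := h1 (nearKernel r K) v G ((2 : ℝ) ^ j • z) hk hv hGm hG
          (smul_ne_zero (by positivity) hz0) hj
          ((hz j).mono fun p hp => hp (hj.trans_le hr1)) hPv
        refine hzj.trans (mul_le_mul_of_nonneg_right ?_ (by positivity))
        rw [mul_assoc]
        refine mul_le_mul_of_nonneg_left ?_ hC1.le
        linarith) (by linarith)
    refine t.trans (mul_le_mul_of_nonneg_right ?_ (by positivity))
    refine (mul_le_mul_of_nonneg_left (add_le_add_right hζX _) hC2.le).trans (le_of_eq ?_)
    ring
  have hfin := lintegral_gagliardo_le (u := u) hn hτσ (R := 2 * max R0 0 + 1) (by positivity)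
    hζm hζI hshift hΩ'.measurableSet (fun x hx y hy => by
      have t1 : ‖x‖ ≤ R0 := by simpa using hR0 (subset_closure hx)
      have t2 : ‖y‖ ≤ R0 := by simpa using hR0 (subset_closure hy)
      have := norm_sub_le x y
      linarith [le_max_left R0 0]) (fun x hx => by
      have hxS : x ∈ S := subset_closure hx
      have t0 : infDist x S = 0 := infDist_zero_of_mem hxS
      have t1 : ζ x = 1 := distCutoff_eq_one hr (by rw [t0]; linarith)
      have t2 : η x = 1 := distCutoff_eq_one hr (by rw [t0]; positivity)
      simp [hv_def, t1, t2, indicator_of_mem (hΩ'Ω hxS)])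
  refine hfin.trans (ENNReal.ofReal_le_ofReal ?_)
  rw [← hJ]
  linarith

lemma L2norm_sq (A : Set (V n)) (u : V n → ℝ) : L2norm A u ^ 2 = ∫ x in A, u x ^ 2 := by
  have h : 0 ≤ ∫ x in A, u x ^ 2 := integral_nonneg fun _ => sq_nonneg _
  rw [L2norm, ← Real.sqrt_eq_rpow, Real.sq_sqrt h]

/-- **Theorem (Gagliardo seminorm estimate of order `2s-ε`).** -/
theorem gagliardo_interior_estimate {n : ℕ} (hn : 1 ≤ n)
    (s β lam Lam M Gam : ℝ) (hs : s ∈ Ioo (0 : ℝ) 1) (hβ : 0 < β)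
    (hlam : 0 < lam) (hlL : lam ≤ Lam) (hM : 0 < M) (hGam : 0 < Gam)
    (Ω : Set (V n)) (hΩ : IsOpen Ω)
    (ε : ℝ) (hε : 0 < ε) (hε1 : 0 < 2 * s - ε) (hε2 : 2 * s - ε < 1)
    (Ω' : Set (V n)) (hΩ' : IsOpen Ω') (hΩ'c : IsCompact (closure Ω'))
    (hΩ'Ω : closure Ω' ⊆ Ω) :
    ∃ C > 0, ∀ (K : V n → V n → ℝ) (u f : V n → ℝ),
      Measurable (Function.uncurry K) → (∀ x y, 0 ≤ K x y) →
      KSym K → KBounds s β lam Lam M K → KHolder s Gam K →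
      MemX Ω K u → HasFiniteWnorm β 0 u →
      Measurable f → IntegrableOn (fun x => f x ^ 2) Ω →
      IsSolution Ω K u f →
      (∫⁻ q in Ω' ×ˢ Ω', ENNReal.ofReal
            ((u q.1 - u q.2) ^ 2 / ‖q.1 - q.2‖ ^ ((n : ℝ) + 2 * (2 * s - ε)))) ^ ((1 : ℝ) / 2) ≤
        ENNReal.ofReal (C * (L2norm Ω u + wnorm β 0 u + L2norm Ω f)) := by
  rcases Ω'.eq_empty_or_nonempty with rfl | hne
  · exact ⟨1, one_pos, fun K u f _ _ _ _ _ _ _ _ _ _ => by simp⟩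
  obtain ⟨C, hC, h⟩ := exists_lintegral_le (Gam := Gam) hn hs hβ hlam hlL hM hΩ hε1
    (by linarith) hε2 hΩ' hne hΩ'c hΩ'Ω
  refine ⟨√C, Real.sqrt_pos.2 hC, ?_⟩
  intro K u f hKm hK0 _ hKB hKH hu huW hfm hf hsol
  have hmain := h K u f hKm hK0 hKB hKH hu huW hfm hf hsol
  rw [← L2norm_sq, ← L2norm_sq] at hmain
  have n1 : 0 ≤ L2norm Ω u := Real.rpow_nonneg (integral_nonneg fun _ => sq_nonneg _) _
  have n2 : 0 ≤ L2norm Ω f := Real.rpow_nonneg (integral_nonneg fun _ => sq_nonneg _) _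
  have n3 : 0 ≤ wnorm β 0 u := integral_nonneg fun _ => by positivity
  set a := L2norm Ω u
  set b := wnorm β 0 u
  set c := L2norm Ω f
  have hle : C * (a ^ 2 + b ^ 2 + c ^ 2) ≤ (√C * (a + b + c)) ^ 2 := by
    rw [mul_pow, Real.sq_sqrt hC.le]
    refine mul_le_mul_of_nonneg_left ?_ hC.le
    nlinarith [mul_nonneg n1 n2, mul_nonneg n1 n3, mul_nonneg n2 n3]
  have h0 : 0 ≤ √C * (a + b + c) := by positivity
  calc _ ≤ ENNReal.ofReal ((√C * (a + b + c)) ^ 2) ^ ((1 : ℝ) / 2) :=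
        ENNReal.rpow_le_rpow (hmain.trans (ENNReal.ofReal_le_ofReal hle)) (by norm_num)
    _ = _ := by
        rw [ENNReal.ofReal_rpow_of_nonneg (sq_nonneg _) (by norm_num), ← Real.sqrt_eq_rpow,
          Real.sqrt_sq h0]
end
end

section
/- (Discrete integration by parts.) Let n ≥ 1, s ∈ (0,1), and let K be measurable, symmetric, and satisfy the growth conditions (i) and (ii). Let B_R = B_R(x₀) be a ball of radius R > 0 in ℝⁿ, and let u, v : ℝⁿ → ℝ be measurable with u, v ∈ L²(B_{8R}) and with finite Gagliardo seminorms [u]_{H^s(B_{8R})}, [v]_{H^s(B_{8R})} < ∞, and assume v = 0 a.e. outside B_{2R}. Then for every z ∈ ℝⁿ with |z| < R the following identity holds (all integrals converging absolutely): ∫_{B_{8R}}∫_{B_{8R}} (u(x)−u(y)) (Δ_{−z}² v(x) − Δ_{−z}² v(y)) K(x,y) dx dy = ∫_{B_{6R}}∫_{B_{6R}} (Δ_z² u(x) − Δ_z² u(y)) (v(x) − v(y)) K(x,y) dx dy + Σ_{i=1}^{2} (−1)^i binom(2,i) ∫_{B_{6R}}∫_{B_{6R}} (u(x+iz) − u(y+iz))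 (v(x) − v(y)) (K(x+iz, y+iz) − K(x,y)) dx dy − 2 Σ_{i=0}^{2} (−1)^i binom(2,i) ∫_{B_{8R}}∫_{B_{8R}} (u(x)−u(y)) χ_{ℝⁿ\B_{6R}}(x − iz) v(y − iz) K(x,y) dx dy. -/
open MeasureTheory Set Metric

noncomputable section

variable {n : ℕ}

/-- The Gagliardo difference quotient of exponent `N`. -/
def gagliardo (N : ℝ) (f : V n → ℝ) (q : V n × V n) : ℝ :=
  (f q.1 - f q.2) ^ 2 / ‖q.1 - q.2‖ ^ N

theorem measurePreserving_diag_add (h : V n) :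
    MeasurePreserving (fun q : V n × V n => (q.1 + h, q.2 + h)) volume volume :=
  (measurePreserving_add_right volume h).prod (measurePreserving_add_right volume h)

theorem measurableEmbedding_diag_add (h : V n) :
    MeasurableEmbedding (fun q : V n × V n => (q.1 + h, q.2 + h)) :=
  ((MeasurableEquiv.addRight h).prodCongr (MeasurableEquiv.addRight h)).measurableEmbedding

theorem KBounds.ae_rpow_mul_le {s β lam Lam M : ℝ} {K : V n → V n → ℝ}
    (hs : 0 < s) (hβ : 0 < β) (hLam : 0 < Lam) (hM : 0 < M) (hKpos : ∀ x y, 0 ≤ K x y)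
    (hKb : KBounds s β lam Lam M K) {ρ : ℝ} (hρ : 0 < ρ) :
    ∃ C, 0 ≤ C ∧ ∀ᵐ q ∂(volume : Measure (V n × V n)), ‖q.1 - q.2‖ ≤ ρ →
      ‖q.1 - q.2‖ ^ ((n : ℝ) + 2 * s) * K q.1 q.2 ≤ C := by
  refine ⟨Lam + ρ ^ ((n : ℝ) + 2 * s) * M, by positivity, ?_⟩
  filter_upwards [hKb.1, hKb.2] with q h1 h2 hq
  have hpos : 0 ≤ ρ ^ ((n : ℝ) + 2 * s) * M := by positivity
  rcases lt_or_ge ‖q.1 - q.2‖ 1 with h | h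
  · linarith [(h1 h).2]
  · have hK : K q.1 q.2 ≤ M := by
      refine le_trans ?_ (h2 h).2
      exact le_mul_of_one_le_left (hKpos _ _) (Real.one_le_rpow h (by positivity))
    have : ‖q.1 - q.2‖ ^ ((n : ℝ) + 2 * s) * K q.1 q.2 ≤ ρ ^ ((n : ℝ) + 2 * s) * M :=
      mul_le_mul (Real.rpow_le_rpow (norm_nonneg _) hq (by positivity)) hK (hKpos _ _)
        (by positivity)
    linarith

theorem sq_mul_le_gagliardo {N C : ℝ} {f : V n → ℝ} {q : V n × V n} {k : ℝ}
    (hk : ‖q.1 - q.2‖ ^ N * k ≤ C) : (f q.1 - f q.2) ^ 2 * k ≤ C * gagliardo N f q := by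
  unfold gagliardo
  by_cases h : q.1 = q.2
  · simp [h]
  · have hW : 0 < ‖q.1 - q.2‖ ^ N := Real.rpow_pos_of_pos (norm_pos_iff.2 (sub_ne_zero.2 h)) _
    rw [mul_div_assoc', le_div_iff₀ hW]
    nlinarith [mul_le_mul_of_nonneg_left hk (sq_nonneg (f q.1 - f q.2))]

theorem integrableOn_mul_kernel {N C : ℝ} {S : Set (V n × V n)}
    (hS : MeasurableSet S) {f g : V n → ℝ} (hf : Measurable f) (hg : Measurable g)
    {k : V n × V n → ℝ} (hk : Measurable k) (hk0 : ∀ q, 0 ≤ k q)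
    (hkC : ∀ᵐ q ∂(volume : Measure (V n × V n)), q ∈ S → ‖q.1 - q.2‖ ^ N * k q ≤ C)
    (hfG : IntegrableOn (gagliardo N f) S) (hgG : IntegrableOn (gagliardo N g) S) :
    IntegrableOn (fun q => (f q.1 - f q.2) * (g q.1 - g q.2) * k q) S := by
  refine Integrable.mono' ((hfG.const_mul C).add (hgG.const_mul C))
    (by fun_prop) ?_
  filter_upwards [(ae_restrict_iff' hS).2 hkC] with q hq
  have h1 := sq_mul_le_gagliardo (f := f) hq
  have h2 := sq_mul_le_gagliardo (f := g) hq
  simp only [Pi.add_apply, Real.norm_eq_abs]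
  rw [abs_mul, abs_of_nonneg (hk0 q), abs_mul]
  refine le_trans ?_ (add_le_add h1 h2)
  rw [← add_mul]
  refine mul_le_mul_of_nonneg_right ?_ (hk0 q)
  rw [← sq_abs (f q.1 - f q.2), ← sq_abs (g q.1 - g q.2)]
  nlinarith [sq_nonneg (|f q.1 - f q.2| - |g q.1 - g q.2|), sq_nonneg |f q.1 - f q.2|,
    sq_nonneg |g q.1 - g q.2|]

theorem integrableOn_gagliardo_translate {N : ℝ} {f : V n → ℝ} {A B : Set (V n)} {h : V n}
    (hAB : ∀ x ∈ A, x + h ∈ B) (hf : IntegrableOn (gagliardo N f) (B ×ˢ B)) :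
    IntegrableOn (gagliardo N fun x => f (x + h)) (A ×ˢ A) := by
  have := ((measurePreserving_diag_add h).integrableOn_comp_preimage
    (measurableEmbedding_diag_add h)).2 hf
  refine IntegrableOn.mono_set (this.congr_fun_ae (.of_forall fun q => ?_)) fun q hq => ?_
  · simp [gagliardo]
  · exact ⟨hAB _ hq.1, hAB _ hq.2⟩

theorem norm_sub_le_of_mem_ball_prod {x₀ : V n} {r : ℝ} {q : V n × V n}
    (hq : q ∈ ball x₀ r ×ˢ ball x₀ r) : ‖q.1 - q.2‖ ≤ 2 * r := by
  rw [← dist_eq_norm]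
  have h1 := mem_ball.1 hq.1
  have h2 := mem_ball.1 hq.2
  linarith [dist_triangle_right q.1 q.2 x₀]

/-- The far-field interaction between the exterior of `B_{6R}` and the support of `v`, both
translated by `h`. -/
def crossTerm (K : V n → V n → ℝ) (x₀ : V n) (R : ℝ) (u v : V n → ℝ) (h : V n)
    (q : V n × V n) : ℝ :=
  (u q.1 - u q.2) * Set.indicator ((ball x₀ (6 * R))ᶜ) 1 (q.1 - h) * v (q.2 - h) * K q.1 q.2

theorem integrableOn_crossTerm {N C : ℝ} (hN : 0 < N) (hC : 0 ≤ C)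
    {K : V n → V n → ℝ} (hKmeas : Measurable (Function.uncurry K)) (hKpos : ∀ x y, 0 ≤ K x y)
    {x₀ : V n} {R : ℝ} (hR : 0 < R)
    (hKC : ∀ᵐ q ∂(volume : Measure (V n × V n)), ‖q.1 - q.2‖ ≤ 2 * (8 * R) →
      ‖q.1 - q.2‖ ^ N * K q.1 q.2 ≤ C)
    {u v : V n → ℝ} (hu : Measurable u) (hv : Measurable v)
    (hv2 : IntegrableOn (fun x => v x ^ 2) (ball x₀ (8 * R)))
    (huG : IntegrableOn (gagliardo N u) (ball x₀ (8 * R) ×ˢ ball x₀ (8 * R)))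
    (hvsupp : ∀ᵐ x ∂(volume : Measure (V n)), x ∉ ball x₀ (2 * R) → v x = 0) (h : V n) :
    IntegrableOn (crossTerm K x₀ R u v h) (ball x₀ (8 * R) ×ˢ ball x₀ (8 * R)) := by
  have hvI : Integrable fun x => v x ^ 2 := by
    refine hv2.integrable_of_ae_notMem_eq_zero ?_
    filter_upwards [hvsupp] with x hx hx8
    simp [hx fun h2 => hx8 (ball_subset_ball (by linarith) h2)]
  have hvI2 : IntegrableOn (fun q : V n × V n => v (q.2 - h) ^ 2)
      (ball x₀ (8 * R) ×ˢ ball x₀ (8 * R)) := by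
    rw [IntegrableOn, Measure.volume_eq_prod, ← Measure.prod_restrict]
    have : IsFiniteMeasure (volume.restrict (ball x₀ (8 * R))) :=
      ⟨by simpa using measure_ball_lt_top⟩
    exact ((hvI.comp_sub_right h).restrict (s := ball x₀ (8 * R))).comp_snd _
  have hsupp : ∀ᵐ q ∂(volume : Measure (V n × V n)),
      q.2 - h ∉ ball x₀ (2 * R) → v (q.2 - h) = 0 :=
    Measure.quasiMeasurePreserving_snd.ae
      ((measurePreserving_sub_right volume h).quasiMeasurePreserving.ae hvsupp)
  have hχ : Measurable (Set.indicator ((ball x₀ (6 * R))ᶜ) (1 : V n → ℝ)) :=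
    measurable_one.indicator measurableSet_ball.compl
  have hK' : Measurable fun q : V n × V n => K q.1 q.2 := hKmeas
  refine Integrable.mono' ((huG.const_mul C).add (hvI2.const_mul (C / (4 * R) ^ N)))
    (by unfold crossTerm; fun_prop) ?_
  filter_upwards [ae_restrict_of_ae hsupp, ae_restrict_of_ae hKC,
    ae_restrict_mem (measurableSet_ball.prod measurableSet_ball)] with q hq1 hq2 hq
  have hW := hq2 (norm_sub_le_of_mem_ball_prod hq)
  have hGu : 0 ≤ gagliardo N u q := by unfold gagliardo; positivity
  simp only [Pi.add_apply, crossTerm]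
  by_cases hx : q.1 - h ∈ ball x₀ (6 * R)
  · rw [indicator_of_notMem (by simpa using hx)]
    simp only [mul_zero, zero_mul, norm_zero]
    positivity
  by_cases hy : q.2 - h ∈ ball x₀ (2 * R)
  swap
  · rw [hq1 hy]
    simp only [mul_zero, zero_mul, norm_zero]
    positivity
  rw [indicator_of_mem (by simpa using hx), Pi.one_apply, mul_one]
  have hd : 4 * R ≤ ‖q.1 - q.2‖ := by
    have h1 := dist_triangle (q.1 - h) (q.2 - h) x₀
    rw [dist_sub_right, dist_eq_norm q.1] at h1
    rw [mem_ball] at hx hy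
    linarith
  have hKle : K q.1 q.2 ≤ C / (4 * R) ^ N := by
    rw [le_div_iff₀ (by positivity), mul_comm]
    exact le_trans (mul_le_mul_of_nonneg_right
      (Real.rpow_le_rpow (by positivity) hd hN.le) (hKpos _ _)) hW
  have h1 := sq_mul_le_gagliardo (f := u) hW
  have h2 := mul_le_mul_of_nonneg_left hKle (sq_nonneg (v (q.2 - h)))
  rw [Real.norm_eq_abs, abs_mul, abs_of_nonneg (hKpos _ _), abs_mul]
  rw [mul_comm (v _ ^ 2) (C / _)] at h2
  refine le_trans ?_ (add_le_add h1 h2)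
  rw [← add_mul]
  refine mul_le_mul_of_nonneg_right ?_ (hKpos _ _)
  rw [← sq_abs (u q.1 - u q.2), ← sq_abs (v (q.2 - h))]
  nlinarith [sq_nonneg (|u q.1 - u q.2| - |v (q.2 - h)|), sq_nonneg |u q.1 - u q.2|,
    sq_nonneg |v (q.2 - h)|]

theorem ae_eq_indicator_sub_crossTerm {K : V n → V n → ℝ} (hKsym : KSym K) {x₀ : V n} {R : ℝ}
    (hR : 0 < R) {u v : V n → ℝ}
    (hvsupp : ∀ᵐ x ∂(volume : Measure (V n)), x ∉ ball x₀ (2 * R) → v x = 0) (h : V n) :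
    ∀ᵐ q ∂(volume : Measure (V n × V n)),
      (u q.1 - u q.2) * (v (q.1 - h) - v (q.2 - h)) * K q.1 q.2 =
        ((ball (x₀ + h) (6 * R) ×ˢ ball (x₀ + h) (6 * R)).indicator
          (fun q => (u q.1 - u q.2) * (v (q.1 - h) - v (q.2 - h)) * K q.1 q.2) q
          - crossTerm K x₀ R u v h q) - crossTerm K x₀ R u v h q.swap := by
  have hsupp := (measurePreserving_sub_right volume h).quasiMeasurePreserving.ae hvsupp
  have h1 : ∀ᵐ q ∂(volume : Measure (V n × V n)),
      q.1 - h ∉ ball x₀ (2 * R) → v (q.1 - h) = 0 :=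
    Measure.quasiMeasurePreserving_fst.ae hsupp
  have h2 : ∀ᵐ q ∂(volume : Measure (V n × V n)),
      q.2 - h ∉ ball x₀ (2 * R) → v (q.2 - h) = 0 :=
    Measure.quasiMeasurePreserving_snd.ae hsupp
  have hmem : ∀ x, x ∈ ball (x₀ + h) (6 * R) ↔ x - h ∈ ball x₀ (6 * R) := fun x => by
    rw [mem_ball, mem_ball, dist_eq_norm, dist_eq_norm]
    congr! 2
    abel
  have hsub : ball x₀ (2 * R) ⊆ ball x₀ (6 * R) := ball_subset_ball (by linarith)
  classical
  filter_upwards [h1, h2, hKsym] with q h1 h2 hK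
  simp only [crossTerm, Prod.fst_swap, Prod.snd_swap, indicator_apply, mem_prod, hmem,
    mem_compl_iff, Pi.one_apply]
  rw [← hK]
  by_cases hx : q.1 - h ∈ ball x₀ (6 * R) <;> by_cases hy : q.2 - h ∈ ball x₀ (6 * R)
  · simp [hx, hy]
  · simp only [hx, hy, h2 fun h => hy (hsub h)]
    simp
    ring
  · simp only [hx, hy, h1 fun h => hx (hsub h)]
    simp
  · simp [hx, hy, h1 fun h => hx (hsub h), h2 fun h => hy (hsub h)]

/-- Translating the second argument of the bilinear form on `B_{8R}` by `h`: the near field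
moves onto the first argument and the kernel, the far field is a cross term. -/
theorem setIntegral_translate {N C : ℝ} (hN : 0 < N) (hC : 0 ≤ C)
    {K : V n → V n → ℝ} (hKmeas : Measurable (Function.uncurry K)) (hKpos : ∀ x y, 0 ≤ K x y)
    (hKsym : KSym K) {x₀ : V n} {R : ℝ} (hR : 0 < R)
    (hKC : ∀ᵐ q ∂(volume : Measure (V n × V n)), ‖q.1 - q.2‖ ≤ 2 * (8 * R) →
      ‖q.1 - q.2‖ ^ N * K q.1 q.2 ≤ C)
    {u v : V n → ℝ} (hu : Measurable u) (hv : Measurable v)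
    (hv2 : IntegrableOn (fun x => v x ^ 2) (ball x₀ (8 * R)))
    (huG : IntegrableOn (gagliardo N u) (ball x₀ (8 * R) ×ˢ ball x₀ (8 * R)))
    (hvsupp : ∀ᵐ x ∂(volume : Measure (V n)), x ∉ ball x₀ (2 * R) → v x = 0) {h : V n}
    (hh : ‖h‖ < 2 * R)
    (hnear : IntegrableOn (fun q : V n × V n => (u (q.1 + h) - u (q.2 + h)) * (v q.1 - v q.2) *
      K (q.1 + h) (q.2 + h)) (ball x₀ (6 * R) ×ˢ ball x₀ (6 * R))) :
    IntegrableOn (fun q : V n × V n => (u q.1 - u q.2) * (v (q.1 - h) - v (q.2 - h)) * K q.1 q.2)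
      (ball x₀ (8 * R) ×ˢ ball x₀ (8 * R)) ∧
    ∫ q in ball x₀ (8 * R) ×ˢ ball x₀ (8 * R),
        (u q.1 - u q.2) * (v (q.1 - h) - v (q.2 - h)) * K q.1 q.2 =
      (∫ q in ball x₀ (6 * R) ×ˢ ball x₀ (6 * R),
        (u (q.1 + h) - u (q.2 + h)) * (v q.1 - v q.2) * K (q.1 + h) (q.2 + h)) -
      2 * ∫ q in ball x₀ (8 * R) ×ˢ ball x₀ (8 * R), crossTerm K x₀ R u v h q := by
  set F : V n × V n → ℝ :=
    fun q => (u q.1 - u q.2) * (v (q.1 - h) - v (q.2 - h)) * K q.1 q.2 with hF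
  set S8 : Set (V n × V n) := ball x₀ (8 * R) ×ˢ ball x₀ (8 * R)
  set A : Set (V n × V n) := ball (x₀ + h) (6 * R) ×ˢ ball (x₀ + h) (6 * R) with hA
  have hAm : MeasurableSet A := measurableSet_ball.prod measurableSet_ball
  have hpre : (fun q : V n × V n => (q.1 + h, q.2 + h)) ⁻¹' A =
      ball x₀ (6 * R) ×ˢ ball x₀ (6 * R) := by
    ext q
    simp [hA]
  have hAS : A ⊆ S8 := by
    have : ball (x₀ + h) (6 * R) ⊆ ball x₀ (8 * R) :=
      ball_subset_ball' (by rw [dist_eq_norm]; simp; linarith)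
    exact prod_mono this this
  have hFA : IntegrableOn F A := by
    rw [← (measurePreserving_diag_add h).integrableOn_comp_preimage
      (measurableEmbedding_diag_add h), hpre]
    simpa [hF, Function.comp_def] using hnear
  have hint : ∫ q in A, F q = ∫ q in ball x₀ (6 * R) ×ˢ ball x₀ (6 * R),
      (u (q.1 + h) - u (q.2 + h)) * (v q.1 - v q.2) * K (q.1 + h) (q.2 + h) := by
    rw [← (measurePreserving_diag_add h).setIntegral_preimage_emb
      (measurableEmbedding_diag_add h), hpre]
    simp [hF]
  have hT := integrableOn_crossTerm hN hC hKmeas hKpos hR hKC hu hv hv2 huG hvsupp h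
  have hswap : MeasurePreserving (Prod.swap : V n × V n → V n × V n) volume volume :=
    Measure.measurePreserving_swap
  have hswape : MeasurableEmbedding (Prod.swap : V n × V n → V n × V n) :=
    MeasurableEquiv.prodComm.measurableEmbedding
  have hSswap : (Prod.swap : V n × V n → V n × V n) ⁻¹' S8 = S8 := preimage_swap_prod _ _
  have hTs : IntegrableOn (fun q => crossTerm K x₀ R u v h q.swap) S8 := by
    have := (hswap.integrableOn_comp_preimage hswape).2 hT
    rwa [hSswap] at this
  have hTsi : ∫ q in S8, crossTerm K x₀ R u v h q.swap = ∫ q in S8, crossTerm K x₀ R u v h q := by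
    have := hswap.setIntegral_preimage_emb hswape (crossTerm K x₀ R u v h) S8
    rwa [hSswap] at this
  have hI : IntegrableOn (A.indicator F) S8 :=
    ((integrable_indicator_iff hAm).2 hFA).integrableOn
  have hae : ∀ᵐ q ∂(volume.restrict S8), F q =
      (A.indicator F q - crossTerm K x₀ R u v h q) - crossTerm K x₀ R u v h q.swap :=
    ae_restrict_of_ae (ae_eq_indicator_sub_crossTerm (u := u) hKsym hR hvsupp h)
  refine ⟨((hI.sub hT).sub hTs).congr (hae.mono fun q hq => hq.symm), ?_⟩
  rw [integral_congr_ae hae, integral_sub (f := fun q => A.indicator F q - crossTerm K x₀ R u v h q)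
      (hI.sub hT) hTs, integral_sub hI hT, hTsi,
    setIntegral_indicator hAm, inter_eq_self_of_subset_right hAS, hint]
  ring

/-- **Lemma (discrete integration by parts).** -/
theorem discrete_integration_by_parts {n : ℕ} (hn : 1 ≤ n)
    (s β lam Lam M : ℝ) (hs : s ∈ Ioo (0 : ℝ) 1) (hβ : 0 < β)
    (hlam : 0 < lam) (hlL : lam ≤ Lam) (hM : 0 < M)
    (K : V n → V n → ℝ) (hKmeas : Measurable (Function.uncurry K))
    (hKpos : ∀ x y, 0 ≤ K x y) (hKsym : KSym K) (hKb : KBounds s β lam Lam M K)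
    (x₀ : V n) (R : ℝ) (hR : 0 < R) (u v : V n → ℝ)
    (hu : Measurable u) (hv : Measurable v)
    (hu2 : IntegrableOn (fun x => u x ^ 2) (ball x₀ (8 * R)))
    (hv2 : IntegrableOn (fun x => v x ^ 2) (ball x₀ (8 * R)))
    (huG : IntegrableOn (fun q : V n × V n =>
        (u q.1 - u q.2) ^ 2 / ‖q.1 - q.2‖ ^ ((n : ℝ) + 2 * s))
        (ball x₀ (8 * R) ×ˢ ball x₀ (8 * R)))
    (hvG : IntegrableOn (fun q : V n × V n =>
        (v q.1 - v q.2) ^ 2 / ‖q.1 - q.2‖ ^ ((n : ℝ) + 2 * s))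
        (ball x₀ (8 * R) ×ˢ ball x₀ (8 * R)))
    (hvsupp : ∀ᵐ x ∂(volume : Measure (V n)), x ∉ ball x₀ (2 * R) → v x = 0)
    (z : V n) (hz : ‖z‖ < R) :
    IntegrableOn (fun q : V n × V n =>
        (u q.1 - u q.2) * (diff2 (-z) v q.1 - diff2 (-z) v q.2) * K q.1 q.2)
      (ball x₀ (8 * R) ×ˢ ball x₀ (8 * R)) ∧
    IntegrableOn (fun q : V n × V n =>
        (diff2 z u q.1 - diff2 z u q.2) * (v q.1 - v q.2) * K q.1 q.2)
      (ball x₀ (6 * R) ×ˢ ball x₀ (6 * R)) ∧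
    (∀ i ∈ Finset.Icc 1 2, IntegrableOn (fun q : V n × V n =>
        (u (q.1 + i • z) - u (q.2 + i • z)) * (v q.1 - v q.2) *
          (K (q.1 + i • z) (q.2 + i • z) - K q.1 q.2))
      (ball x₀ (6 * R) ×ˢ ball x₀ (6 * R))) ∧
    (∀ i ∈ Finset.range 3, IntegrableOn (fun q : V n × V n =>
        (u q.1 - u q.2) * Set.indicator ((ball x₀ (6 * R))ᶜ) 1 (q.1 - i • z) *
          v (q.2 - i • z) * K q.1 q.2)
      (ball x₀ (8 * R) ×ˢ ball x₀ (8 * R))) ∧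
    ∫ x in ball x₀ (8 * R), ∫ y in ball x₀ (8 * R),
        (u x - u y) * (diff2 (-z) v x - diff2 (-z) v y) * K x y
      = (∫ x in ball x₀ (6 * R), ∫ y in ball x₀ (6 * R),
          (diff2 z u x - diff2 z u y) * (v x - v y) * K x y)
        + (∑ i ∈ Finset.Icc 1 2, (-1 : ℝ) ^ i * (Nat.choose 2 i) *
            ∫ x in ball x₀ (6 * R), ∫ y in ball x₀ (6 * R),
              (u (x + i • z) - u (y + i • z)) * (v x - v y) *
                (K (x + i • z) (y + i • z) - K x y))
        - 2 * ∑ i ∈ Finset.range 3, (-1 : ℝ) ^ i * (Nat.choose 2 i) *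
            ∫ x in ball x₀ (8 * R), ∫ y in ball x₀ (8 * R),
              (u x - u y) * Set.indicator ((ball x₀ (6 * R))ᶜ) 1 (x - i • z) *
                v (y - i • z) * K x y := by
  set N : ℝ := (n : ℝ) + 2 * s
  have hN : 0 < N := by have := hs.1; positivity
  obtain ⟨C, hC, hKC⟩ := hKb.ae_rpow_mul_le hs.1 hβ (hlam.trans_le hlL) hM hKpos
    (show 0 < 2 * (8 * R) by positivity)
  have hK' : Measurable fun q : V n × V n => K q.1 q.2 := hKmeas
  have hS6 : MeasurableSet (ball x₀ (6 * R) ×ˢ ball x₀ (6 * R)) :=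
    measurableSet_ball.prod measurableSet_ball
  have hvG6 : IntegrableOn (gagliardo N v) (ball x₀ (6 * R) ×ˢ ball x₀ (6 * R)) :=
    IntegrableOn.mono_set hvG (prod_mono (ball_subset_ball (by linarith))
      (ball_subset_ball (by linarith)))
  have hiz : ∀ i ≤ 2, ‖i • z‖ < 2 * R := fun i hi => by
    have : (i : ℝ) ≤ 2 := by exact_mod_cast hi
    calc ‖i • z‖ ≤ i * ‖z‖ := norm_nsmul_le
      _ ≤ 2 * ‖z‖ := by gcongr
      _ < 2 * R := by linarith
  have huG6 : ∀ i ≤ 2, IntegrableOn (gagliardo N fun x => u (x + i • z))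
      (ball x₀ (6 * R) ×ˢ ball x₀ (6 * R)) := fun i hi =>
    integrableOn_gagliardo_translate (B := ball x₀ (8 * R)) (fun x hx => by
      have h1 := norm_add_le (x - x₀) (i • z)
      have h2 := hiz i hi
      rw [mem_ball, dist_eq_norm] at hx ⊢
      rw [add_sub_right_comm]
      linarith) huG
  set J : ℕ → V n × V n → ℝ := fun i q =>
    (u (q.1 + i • z) - u (q.2 + i • z)) * (v q.1 - v q.2) * K q.1 q.2 with hJdef
  set I : ℕ → V n × V n → ℝ := fun i q =>
    (u (q.1 + i • z) - u (q.2 + i • z)) * (v q.1 - v q.2) *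
      K (q.1 + i • z) (q.2 + i • z) with hIdef
  set F : ℕ → V n × V n → ℝ := fun i q =>
    (u q.1 - u q.2) * (v (q.1 - i • z) - v (q.2 - i • z)) * K q.1 q.2 with hFdef
  have hJ : ∀ i ≤ 2, IntegrableOn (J i) (ball x₀ (6 * R) ×ˢ ball x₀ (6 * R)) := fun i hi => by
    refine integrableOn_mul_kernel (f := fun x => u (x + i • z)) hS6 (by fun_prop) hv hK'
      (fun q => hKpos _ _) (C := C) ?_ (huG6 i hi) hvG6
    filter_upwards [hKC] with q h hq
    exact h ((norm_sub_le_of_mem_ball_prod hq).trans (by linarith))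
  have hI : ∀ i ≤ 2, IntegrableOn (I i) (ball x₀ (6 * R) ×ˢ ball x₀ (6 * R)) := fun i hi => by
    refine integrableOn_mul_kernel (f := fun x => u (x + i • z))
      (k := fun q => K (q.1 + i • z) (q.2 + i • z)) hS6 (by fun_prop) hv
      (hK'.comp (measurePreserving_diag_add (i • z)).measurable)
      (fun q => hKpos _ _) (C := C) ?_ (huG6 i hi) hvG6
    filter_upwards [(measurePreserving_diag_add (i • z)).quasiMeasurePreserving.ae hKC] with q h hq
    simp only [add_sub_add_right_eq_sub] at h
    exact h ((norm_sub_le_of_mem_ball_prod hq).trans (by linarith))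
  have hT : ∀ i : ℕ, IntegrableOn (crossTerm K x₀ R u v (i • z))
      (ball x₀ (8 * R) ×ˢ ball x₀ (8 * R)) := fun i =>
    integrableOn_crossTerm hN hC hKmeas hKpos hR hKC hu hv hv2 huG hvsupp _
  have hF : ∀ i ≤ 2, IntegrableOn (F i) (ball x₀ (8 * R) ×ˢ ball x₀ (8 * R)) ∧
      ∫ q in ball x₀ (8 * R) ×ˢ ball x₀ (8 * R), F i q =
        (∫ q in ball x₀ (6 * R) ×ˢ ball x₀ (6 * R), I i q) -
        2 * ∫ q in ball x₀ (8 * R) ×ˢ ball x₀ (8 * R), crossTerm K x₀ R u v (i • z) q :=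
    fun i hi => setIntegral_translate hN hC hKmeas hKpos hKsym hR hKC hu hv hv2 huG hvsupp
      (hiz i hi) (hI i hi)
  have hLfun : (fun q : V n × V n =>
      (u q.1 - u q.2) * (diff2 (-z) v q.1 - diff2 (-z) v q.2) * K q.1 q.2) =
      fun q => F 2 q - 2 * F 1 q + F 0 q := by
    funext q
    simp only [hFdef, diff2, smul_neg, one_smul, zero_smul, sub_zero, ← sub_eq_add_neg]
    ring
  have hRfun : (fun q : V n × V n =>
      (diff2 z u q.1 - diff2 z u q.2) * (v q.1 - v q.2) * K q.1 q.2) =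
      fun q => J 2 q - 2 * J 1 q + J 0 q := by
    funext q
    simp only [hJdef, diff2, one_smul, zero_smul, add_zero]
    ring
  have hDfun : ∀ i : ℕ, (fun q : V n × V n =>
      (u (q.1 + i • z) - u (q.2 + i • z)) * (v q.1 - v q.2) *
        (K (q.1 + i • z) (q.2 + i • z) - K q.1 q.2)) = fun q => I i q - J i q := fun i => by
    funext q
    simp only [hIdef, hJdef]
    ring
  have hLint := ((hF 2 le_rfl).1.sub ((hF 1 one_le_two).1.const_mul 2)).add (hF 0 zero_le_two).1
  have hRint := ((hJ 2 le_rfl).sub ((hJ 1 one_le_two).const_mul 2)).add (hJ 0 zero_le_two)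
  have hD : ∀ i ≤ 2, IntegrableOn (fun q : V n × V n =>
      (u (q.1 + i • z) - u (q.2 + i • z)) * (v q.1 - v q.2) *
        (K (q.1 + i • z) (q.2 + i • z) - K q.1 q.2))
      (ball x₀ (6 * R) ×ˢ ball x₀ (6 * R)) := fun i hi => by
    rw [hDfun]
    exact (hI i hi).sub (hJ i hi)
  have hL : IntegrableOn (fun q : V n × V n =>
      (u q.1 - u q.2) * (diff2 (-z) v q.1 - diff2 (-z) v q.2) * K q.1 q.2)
      (ball x₀ (8 * R) ×ˢ ball x₀ (8 * R)) := hLfun ▸ hLint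
  have hRt : IntegrableOn (fun q : V n × V n =>
      (diff2 z u q.1 - diff2 z u q.2) * (v q.1 - v q.2) * K q.1 q.2)
      (ball x₀ (6 * R) ×ˢ ball x₀ (6 * R)) := hRfun ▸ hRint
  refine ⟨hL, hRt, fun i hi => hD i (Finset.mem_Icc.1 hi).2, fun i _ => hT i, ?_⟩
  have hIJ : I 0 = J 0 := by simp [hIdef, hJdef]
  have hLval : ∫ x in ball x₀ (8 * R), ∫ y in ball x₀ (8 * R),
      (u x - u y) * (diff2 (-z) v x - diff2 (-z) v y) * K x y =
      (∫ q in ball x₀ (8 * R) ×ˢ ball x₀ (8 * R), F 2 q) -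
        2 * (∫ q in ball x₀ (8 * R) ×ˢ ball x₀ (8 * R), F 1 q) +
        ∫ q in ball x₀ (8 * R) ×ˢ ball x₀ (8 * R), F 0 q := by
    refine (setIntegral_prod _ hL).symm.trans ?_
    rw [hLfun, ← Measure.volume_eq_prod, integral_add (f := fun q => F 2 q - 2 * F 1 q)
      ((hF 2 le_rfl).1.sub ((hF 1 one_le_two).1.const_mul 2)) (hF 0 zero_le_two).1,
      integral_sub (hF 2 le_rfl).1 ((hF 1 one_le_two).1.const_mul 2), integral_const_mul]
  have hRval : ∫ x in ball x₀ (6 * R), ∫ y in ball x₀ (6 * R),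
      (diff2 z u x - diff2 z u y) * (v x - v y) * K x y =
      (∫ q in ball x₀ (6 * R) ×ˢ ball x₀ (6 * R), J 2 q) -
        2 * (∫ q in ball x₀ (6 * R) ×ˢ ball x₀ (6 * R), J 1 q) +
        ∫ q in ball x₀ (6 * R) ×ˢ ball x₀ (6 * R), J 0 q := by
    refine (setIntegral_prod _ hRt).symm.trans ?_
    rw [hRfun, ← Measure.volume_eq_prod, integral_add (f := fun q => J 2 q - 2 * J 1 q)
      ((hJ 2 le_rfl).sub ((hJ 1 one_le_two).const_mul 2)) (hJ 0 zero_le_two),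
      integral_sub (hJ 2 le_rfl) ((hJ 1 one_le_two).const_mul 2), integral_const_mul]
  have hDval : ∀ i ≤ 2, ∫ x in ball x₀ (6 * R), ∫ y in ball x₀ (6 * R),
      (u (x + i • z) - u (y + i • z)) * (v x - v y) * (K (x + i • z) (y + i • z) - K x y) =
      (∫ q in ball x₀ (6 * R) ×ˢ ball x₀ (6 * R), I i q) -
        ∫ q in ball x₀ (6 * R) ×ˢ ball x₀ (6 * R), J i q := fun i hi => by
    refine (setIntegral_prod _ (hD i hi)).symm.trans ?_
    rw [hDfun, ← Measure.volume_eq_prod, integral_sub (hI i hi) (hJ i hi)]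
  have hTval : ∀ i : ℕ, ∫ x in ball x₀ (8 * R), ∫ y in ball x₀ (8 * R),
      (u x - u y) * Set.indicator ((ball x₀ (6 * R))ᶜ) 1 (x - i • z) * v (y - i • z) * K x y =
      ∫ q in ball x₀ (8 * R) ×ˢ ball x₀ (8 * R), crossTerm K x₀ R u v (i • z) q := fun i =>
    (setIntegral_prod _ (hT i)).symm
  have hIcc : Finset.Icc 1 2 = ({1, 2} : Finset ℕ) := rfl
  rw [hLval, hRval, hIcc, Finset.sum_pair (by norm_num), hDval 1 one_le_two, hDval 2 le_rfl]
  simp only [Finset.sum_range_succ, Finset.sum_range_zero, hTval]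
  rw [(hF 2 le_rfl).2, (hF 1 one_le_two).2, (hF 0 zero_le_two).2, hIJ]
  norm_num
  ring
end
end

section
/- Let n ≥ 2 and s ∈ (1/2, 1). Let Q = B₁′ × (0,1) ⊂ ℝⁿ, where B₁′ is the open unit ball in ℝ^{n−1}, and let u_s(x) = (x_n)_+^s, whose gradient on Q is ∇u_s(x) = (0,…,0, s x_n^{s−1}). Then ∫_Q ∫_Q |∇u_s(x) − ∇u_s(y)|² / |x−y|^{n + 2(2s−1)} dx dy = ∫_Q ∫_Q s² |x_n^{s−1} − y_n^{s−1}|² / |x−y|^{n + 2(2s−1)} dx dy = +∞. In particular u_s ∉ H^{2s}(Q), so the s-harmonic function u_s does not belong to H^{2s}_loc of the closed half-space. -/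
open MeasureTheory Set
open scoped ENNReal

noncomputable section

/-- The cylinder `Q = B₁′ × (0,1)` in `ℝⁿ` with `n = m + 2`. -/
def cyl (m : ℕ) : Set (EuclideanSpace ℝ (Fin (m + 2))) :=
  {x | (∑ i : Fin (m + 1), x i.castSucc ^ 2) < 1 ∧ x (Fin.last (m + 1)) ∈ Ioo (0 : ℝ) 1}

/-- The volume of a coordinate box in `ℝ^(m+2)`, the last coordinate being singled out. -/
lemma volume_box_snoc {m : ℕ} (a b : Fin (m + 1) → ℝ) (c d : ℝ) :
    volume {x : EuclideanSpace ℝ (Fin (m + 2)) |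
        (∀ i : Fin (m + 1), x i.castSucc ∈ Ioo (a i) (b i)) ∧ x (Fin.last (m + 1)) ∈ Ioo c d} =
      (∏ i, ENNReal.ofReal (b i - a i)) * ENNReal.ofReal (d - c) := by
  have h := (EuclideanSpace.volume_preserving_symm_measurableEquiv_toLp
    (Fin (m + 2))).measure_preimage_equiv
    (Set.pi univ fun i ↦ Ioo ((Fin.snoc a c : Fin (m + 2) → ℝ) i)
      ((Fin.snoc b d : Fin (m + 2) → ℝ) i))
  rw [Real.volume_pi_Ioo, Fin.prod_univ_castSucc] at h
  simp only [Fin.snoc_castSucc, Fin.snoc_last] at h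
  rw [← h]
  congr 1
  ext x
  simp only [mem_ofPred_eq, mem_preimage, Set.mem_pi, mem_univ, forall_true_left]
  rw [Fin.forall_fin_succ' (n := m + 1)]
  simp only [Fin.snoc_castSucc, Fin.snoc_last]
  rfl

/-- Pairs of points of the cylinder at height and mutual distance comparable to `ε`. -/
def boundaryPairs (m : ℕ) (ε : ℝ) :
    Set (EuclideanSpace ℝ (Fin (m + 2)) × EuclideanSpace ℝ (Fin (m + 2))) :=
  {q | ((∀ i : Fin (m + 1), q.1 i.castSucc ∈ Ioo (-(1 / (2 * ((m : ℝ) + 2))))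
          (1 / (2 * ((m : ℝ) + 2)))) ∧ q.1 (Fin.last (m + 1)) ∈ Ioo ε (2 * ε)) ∧
    ((∀ i : Fin (m + 1), q.2 i.castSucc ∈ Ioo (q.1 i.castSucc - ε) (q.1 i.castSucc + ε)) ∧
      q.2 (Fin.last (m + 1)) ∈ Ioo (3 * ε) (4 * ε))}

lemma measurableSet_boundaryPairs (m : ℕ) (ε : ℝ) : MeasurableSet (boundaryPairs m ε) := by
  apply IsOpen.measurableSet
  simp only [boundaryPairs, mem_Ioo, ofPred_and, ofPred_forall]
  refine IsOpen.inter (IsOpen.inter (isOpen_iInter_of_finite fun i ↦ IsOpen.inter ?_ ?_)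
      (IsOpen.inter ?_ ?_))
    (IsOpen.inter (isOpen_iInter_of_finite fun i ↦ IsOpen.inter ?_ ?_) (IsOpen.inter ?_ ?_)) <;>
  exact isOpen_lt (by fun_prop) (by fun_prop)

lemma volume_boundaryPairs_ge (m : ℕ) {ε : ℝ} (hε : 0 < ε) :
    ENNReal.ofReal ((1 / ((m : ℝ) + 2)) ^ (m + 1) * ε * ((2 * ε) ^ (m + 1) * ε)) ≤
      volume (boundaryPairs m ε) := by
  rw [Measure.volume_eq_prod, Measure.prod_apply (measurableSet_boundaryPairs m ε)]
  set X : Set (EuclideanSpace ℝ (Fin (m + 2))) :=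
    {x | (∀ i : Fin (m + 1), x i.castSucc ∈ Ioo (-(1 / (2 * ((m : ℝ) + 2))))
      (1 / (2 * ((m : ℝ) + 2)))) ∧ x (Fin.last (m + 1)) ∈ Ioo ε (2 * ε)} with hX
  have hvX : volume X = ENNReal.ofReal ((1 / ((m : ℝ) + 2)) ^ (m + 1) * ε) := by
    rw [hX, volume_box_snoc (fun _ ↦ -(1 / (2 * ((m : ℝ) + 2)))) (fun _ ↦ 1 / (2 * ((m : ℝ) + 2))),
      Finset.prod_const, Finset.card_univ, Fintype.card_fin,
      ENNReal.ofReal_mul (by positivity), ENNReal.ofReal_pow (by positivity)]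
    congr 3
    · field_simp; ring
    · ring
  have hXm : MeasurableSet X := by
    apply IsOpen.measurableSet
    simp only [hX, mem_Ioo, ofPred_and, ofPred_forall]
    refine IsOpen.inter (isOpen_iInter_of_finite fun i ↦ IsOpen.inter ?_ ?_)
      (IsOpen.inter ?_ ?_) <;>
    exact isOpen_lt (by fun_prop) (by fun_prop)
  calc ENNReal.ofReal ((1 / ((m : ℝ) + 2)) ^ (m + 1) * ε * ((2 * ε) ^ (m + 1) * ε))
      = ∫⁻ _ in X, ENNReal.ofReal ((2 * ε) ^ (m + 1) * ε) := by
        rw [setLIntegral_const, hvX, mul_comm, ENNReal.ofReal_mul (by positivity)]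
    _ ≤ ∫⁻ x in X, volume (Prod.mk x ⁻¹' boundaryPairs m ε) := by
        refine setLIntegral_mono' hXm fun x hx ↦ ?_
        have : Prod.mk x ⁻¹' boundaryPairs m ε =
            {y | (∀ i : Fin (m + 1), y i.castSucc ∈
              Ioo (x i.castSucc - ε) (x i.castSucc + ε)) ∧
              y (Fin.last (m + 1)) ∈ Ioo (3 * ε) (4 * ε)} := by
          ext y
          exact ⟨fun h ↦ h.2, fun h ↦ ⟨hx, h⟩⟩
        rw [this, volume_box_snoc (fun i ↦ x i.castSucc - ε) (fun i ↦ x i.castSucc + ε)]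
        simp only [show ∀ t : ℝ, t + ε - (t - ε) = 2 * ε from fun t ↦ by ring,
          show 4 * ε - 3 * ε = ε by ring, Finset.prod_const, Finset.card_univ, Fintype.card_fin]
        rw [ENNReal.ofReal_mul (by positivity), ENNReal.ofReal_pow (by positivity)]
    _ ≤ ∫⁻ x, volume (Prod.mk x ⁻¹' boundaryPairs m ε) := setLIntegral_le_lintegral _ _

lemma sum_sq_lt_one {m : ℕ} {f : Fin (m + 1) → ℝ} (hf : ∀ i, |f i| ≤ 1 / ((m : ℝ) + 2)) :
    ∑ i, f i ^ 2 < 1 := by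
  calc ∑ i, f i ^ 2 ≤ ∑ _i : Fin (m + 1), (1 / ((m : ℝ) + 2)) ^ 2 :=
        Finset.sum_le_sum fun i _ ↦ sq_le_sq.2 ((hf i).trans (le_abs_self _))
    _ < 1 := by
        simp only [Finset.sum_const, Finset.card_univ, Fintype.card_fin, nsmul_eq_mul]
        push_cast
        rw [div_pow, one_pow, mul_one_div, div_lt_one (by positivity)]
        have : (0 : ℝ) ≤ m := m.cast_nonneg
        nlinarith

lemma boundaryPairs_subset {m : ℕ} {ε : ℝ}
    (hε : ε < 1 / (2 * ((m : ℝ) + 2))) :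
    boundaryPairs m ε ⊆ cyl m ×ˢ cyl m := by
  have hm : (0 : ℝ) ≤ m := m.cast_nonneg
  have h4 : 1 / (2 * ((m : ℝ) + 2)) ≤ 1 / 4 := by
    apply one_div_le_one_div_of_le <;> linarith
  have h2 : 1 / ((m : ℝ) + 2) = 1 / (2 * ((m : ℝ) + 2)) + 1 / (2 * ((m : ℝ) + 2)) := by
    field_simp; norm_num
  rintro ⟨x, y⟩ ⟨⟨hx, hxn⟩, hy, hyn⟩
  simp only [mem_Ioo] at hx hxn hy hyn
  refine ⟨⟨sum_sq_lt_one fun i ↦ abs_le.2 ?_, ?_⟩, sum_sq_lt_one fun i ↦ abs_le.2 ?_, ?_⟩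
  · have := hx i
    constructor <;> linarith
  · constructor <;> linarith
  · have := hx i
    have := hy i
    constructor <;> linarith
  · constructor <;> linarith

lemma norm_sub_le_of_mem_boundaryPairs {m : ℕ} {ε : ℝ} (hε : 0 < ε)
    {q : EuclideanSpace ℝ (Fin (m + 2)) × EuclideanSpace ℝ (Fin (m + 2))}
    (hq : q ∈ boundaryPairs m ε) : ‖q.1 - q.2‖ ≤ 3 * ((m : ℝ) + 2) * ε := by
  obtain ⟨⟨hx, hxn⟩, hy, hyn⟩ := hq
  simp only [mem_Ioo] at hx hxn hy hyn
  have hi : ∀ i, (q.1 - q.2) i ^ 2 ≤ (3 * ε) ^ 2 := by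
    rw [Fin.forall_fin_succ']
    refine ⟨fun i ↦ ?_, ?_⟩
    · have := hy i
      rw [PiLp.sub_apply]
      apply sq_le_sq' <;> linarith
    · rw [PiLp.sub_apply]
      apply sq_le_sq' <;> linarith
  refine (sq_le_sq₀ (norm_nonneg _) (by positivity)).1 ?_
  rw [EuclideanSpace.real_norm_sq_eq]
  refine (Finset.sum_le_sum fun i _ ↦ hi i).trans ?_
  simp only [Finset.sum_const, Finset.card_univ, Fintype.card_fin, nsmul_eq_mul]
  push_cast
  have : (0 : ℝ) ≤ m := m.cast_nonneg
  nlinarith [sq_nonneg ε, mul_nonneg this (sq_nonneg ε),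
    mul_nonneg (mul_nonneg this this) (sq_nonneg ε)]

lemma integrand_ge_of_mem_boundaryPairs {m : ℕ} {s : ℝ} (hs : s ∈ Ioo (1 / 2 : ℝ) 1) {ε : ℝ}
    (hε : 0 < ε) {q : EuclideanSpace ℝ (Fin (m + 2)) × EuclideanSpace ℝ (Fin (m + 2))}
    (hq : q ∈ boundaryPairs m ε) :
    s ^ 2 * ((2 * ε) ^ (s - 1) - (3 * ε) ^ (s - 1)) ^ 2 /
        (3 * ((m : ℝ) + 2) * ε) ^ (((m : ℝ) + 2) + 2 * (2 * s - 1)) ≤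
      s ^ 2 * (q.1 (Fin.last (m + 1)) ^ (s - 1) - q.2 (Fin.last (m + 1)) ^ (s - 1)) ^ 2 /
        ‖q.1 - q.2‖ ^ (((m : ℝ) + 2) + 2 * (2 * s - 1)) := by
  have hn := norm_sub_le_of_mem_boundaryPairs hε hq
  obtain ⟨⟨hx, hxn⟩, hy, hyn⟩ := hq
  have hs1 := hs.1
  have hs2 := hs.2
  have hne : 0 < ‖q.1 - q.2‖ := by
    rw [norm_pos_iff, sub_ne_zero]
    intro h
    rw [h] at hxn
    linarith [hxn.2, hyn.1]
  have hp : 0 ≤ ((m : ℝ) + 2) + 2 * (2 * s - 1) := by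
    have : (0 : ℝ) ≤ m := m.cast_nonneg
    linarith
  have h1 : (2 * ε) ^ (s - 1) ≤ q.1 (Fin.last (m + 1)) ^ (s - 1) :=
    Real.rpow_le_rpow_of_nonpos (hε.trans hxn.1) hxn.2.le (by linarith)
  have h2 : q.2 (Fin.last (m + 1)) ^ (s - 1) ≤ (3 * ε) ^ (s - 1) :=
    Real.rpow_le_rpow_of_nonpos (by linarith) hyn.1.le (by linarith)
  have h3 : (3 * ε) ^ (s - 1) ≤ (2 * ε) ^ (s - 1) :=
    Real.rpow_le_rpow_of_nonpos (by linarith) (by linarith) (by linarith)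
  gcongr

/-- **Proposition (optimality, `s ≥ 1/2`).** For `s ∈ (1/2,1)` the Gagliardo double integral of
order `2s−1` of the gradient of `u_s(x) = (x_n)_+^s` on the cylinder `Q`, which equals
`∫_Q∫_Q s²|x_n^{s−1} − y_n^{s−1}|²/|x−y|^{n+2(2s−1)}`, diverges; hence `u_s ∉ H^{2s}(Q)`. -/
theorem us_not_in_H2s {m : ℕ} (s : ℝ) (hs : s ∈ Ioo (1 / 2 : ℝ) 1) :
    ∫⁻ q in cyl m ×ˢ cyl m,
        ENNReal.ofReal (s ^ 2 *
            (q.1 (Fin.last (m + 1)) ^ (s - 1) - q.2 (Fin.last (m + 1)) ^ (s - 1)) ^ 2 /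
          ‖q.1 - q.2‖ ^ (((m : ℝ) + 2) + 2 * (2 * s - 1))) = ⊤ := by
  have hs1 := hs.1
  have hs2 := hs.2
  set K : ℝ := s ^ 2 * ((2 : ℝ) ^ (s - 1) - 3 ^ (s - 1)) ^ 2 /
    (3 * ((m : ℝ) + 2)) ^ (((m : ℝ) + 2) + 2 * (2 * s - 1)) *
    ((1 / ((m : ℝ) + 2)) ^ (m + 1) * 2 ^ (m + 1)) with hK
  have hKpos : 0 < K := by
    have : (3 : ℝ) ^ (s - 1) < 2 ^ (s - 1) :=
      Real.rpow_lt_rpow_of_neg (by norm_num) (by norm_num) (by linarith)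
    have := sub_pos.2 this
    positivity
  have key : ∀ ε : ℝ, 0 < ε →
      s ^ 2 * ((2 * ε) ^ (s - 1) - (3 * ε) ^ (s - 1)) ^ 2 /
        (3 * ((m : ℝ) + 2) * ε) ^ (((m : ℝ) + 2) + 2 * (2 * s - 1)) *
      ((1 / ((m : ℝ) + 2)) ^ (m + 1) * ε * ((2 * ε) ^ (m + 1) * ε)) = K * ε ^ (1 - 2 * s) := by
    intro ε hε
    have e : ε ^ (1 - 2 * s) = (ε ^ (s - 1)) ^ 2 * ε ^ (m + 3) /
        ε ^ (((m : ℝ) + 2) + 2 * (2 * s - 1)) := by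
      rw [← Real.rpow_natCast (ε ^ (s - 1)), ← Real.rpow_mul hε.le, ← Real.rpow_natCast ε,
        ← Real.rpow_add hε, ← Real.rpow_sub hε]
      congr 1
      push_cast
      ring
    rw [e, hK, Real.mul_rpow (by norm_num) hε.le, Real.mul_rpow (by norm_num) hε.le,
      Real.mul_rpow (by positivity) hε.le, mul_pow]
    have := (Real.rpow_pos_of_pos hε (((m : ℝ) + 2) + 2 * (2 * s - 1))).ne'
    have := (Real.rpow_pos_of_pos (show 0 < 3 * ((m : ℝ) + 2) by positivity)
      (((m : ℝ) + 2) + 2 * (2 * s - 1))).ne'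
    generalize (3 * ((m : ℝ) + 2)) ^ (((m : ℝ) + 2) + 2 * (2 * s - 1)) = A at *
    generalize ε ^ (((m : ℝ) + 2) + 2 * (2 * s - 1)) = B at *
    field_simp
    ring
  have lower : ∀ ε ∈ Ioo (0 : ℝ) (1 / (2 * ((m : ℝ) + 2))),
      ENNReal.ofReal (K * ε ^ (1 - 2 * s)) ≤ ∫⁻ q in cyl m ×ˢ cyl m,
        ENNReal.ofReal (s ^ 2 *
            (q.1 (Fin.last (m + 1)) ^ (s - 1) - q.2 (Fin.last (m + 1)) ^ (s - 1)) ^ 2 /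
          ‖q.1 - q.2‖ ^ (((m : ℝ) + 2) + 2 * (2 * s - 1))) := by
    rintro ε ⟨hε, hε'⟩
    refine le_trans ?_ (lintegral_mono_set (boundaryPairs_subset hε'))
    refine le_trans ?_ (setLIntegral_mono' (measurableSet_boundaryPairs m ε) fun q hq ↦
      ENNReal.ofReal_le_ofReal (integrand_ge_of_mem_boundaryPairs hs hε hq))
    rw [setLIntegral_const, ← key ε hε, ENNReal.ofReal_mul (by positivity)]
    gcongr
    exact volume_boundaryPairs_ge m hε
  have lim : Filter.Tendsto (fun ε : ℝ ↦ ENNReal.ofReal (K * ε ^ (1 - 2 * s)))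
      (nhdsWithin 0 (Ioi 0)) (nhds ⊤) :=
    ENNReal.tendsto_ofReal_atTop.comp
      ((tendsto_rpow_neg_nhdsGT_zero (by linarith)).const_mul_atTop hKpos)
  refine top_le_iff.1 (le_of_tendsto lim ?_)
  filter_upwards [Ioo_mem_nhdsGT (show (0 : ℝ) < 1 / (2 * ((m : ℝ) + 2)) by positivity)]
    with ε hε using lower ε hε
end
end

section
/- Let s ∈ (1/2, 1) and let μ_s′(t) = s t^{s−1} for t > 0. Then the double integral E = ∫_0^1 ∫_0^1 |μ_s′(t) − μ_s′(r)|² / |t−r|^{1 + 2(2s−1)} dt dr = ∫_0^1 ∫_0^1 s² |t^{s−1} − r^{s−1}|² / |t−r|^{4s−1} dt dr diverges, i.e. E = +∞. -/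
open MeasureTheory Set
open scoped ENNReal

noncomputable section

/-- A real power that is not integrable near `0` has infinite integral over `(0,1)`. -/
theorem lintegral_Ioo_rpow_eq_top {a : ℝ} (ha : a ≤ -1) :
    ∫⁻ t in Ioo (0 : ℝ) 1, ENNReal.ofReal (t ^ a) = ⊤ := by
  by_contra h
  have hint : IntegrableOn (fun t : ℝ => t ^ a) (Ioo 0 1) := by
    refine (lintegral_ofReal_ne_top_iff_integrable
      (measurable_id.pow_const a).aestronglyMeasurable ?_).1 h
    filter_upwards [ae_restrict_mem measurableSet_Ioo] with t ht
    exact Real.rpow_nonneg ht.1.le a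
  have := (intervalIntegral.integrableOn_Ioo_rpow_iff one_pos).1 hint
  linarith

/-- Lower bound for the difference quotient away from the diagonal. -/
theorem rpow_le_sq_sub_div_rpow {s t r : ℝ} (hs : s ∈ Ioo (1 / 2 : ℝ) 1) (hr : 0 < r)
    (hrt : r < t / 2) :
    s ^ 2 * ((1 / 2 : ℝ) ^ (s - 1) - 1) ^ 2 * t ^ (-2 * s - 1) ≤
      s ^ 2 * (t ^ (s - 1) - r ^ (s - 1)) ^ 2 / |t - r| ^ (4 * s - 1) := by
  obtain ⟨hs1, hs2⟩ := hs
  have ht : 0 < t := by linarith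
  have hc : 1 ≤ (1 / 2 : ℝ) ^ (s - 1) :=
    Real.one_le_rpow_of_pos_of_le_one_of_nonpos (by norm_num) (by norm_num) (by linarith)
  have hpow : (1 / 2 : ℝ) ^ (s - 1) * t ^ (s - 1) ≤ r ^ (s - 1) := by
    rw [← Real.mul_rpow (by norm_num) ht.le]
    exact Real.rpow_le_rpow_of_nonpos hr (by linarith) (by linarith)
  have htp : 0 < t ^ (s - 1) := Real.rpow_pos_of_pos ht _
  have hsq : (((1 / 2 : ℝ) ^ (s - 1) - 1) * t ^ (s - 1)) ^ 2 ≤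
      (t ^ (s - 1) - r ^ (s - 1)) ^ 2 := by
    rw [← neg_sub (r ^ (s - 1)), neg_sq]
    exact pow_le_pow_left₀ (mul_nonneg (by linarith) htp.le) (by linarith) 2
  have habs : |t - r| = t - r := abs_of_pos (by linarith)
  have hden : |t - r| ^ (4 * s - 1) ≤ t ^ (4 * s - 1) := by
    rw [habs]
    exact Real.rpow_le_rpow (by linarith) (by linarith) (by linarith)
  have hden0 : 0 < |t - r| ^ (4 * s - 1) := by
    rw [habs]
    exact Real.rpow_pos_of_pos (by linarith) _
  have hexp : t ^ (-2 * s - 1) * t ^ (4 * s - 1) = (t ^ (s - 1)) ^ 2 := by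
    rw [← Real.rpow_add ht, ← Real.rpow_mul_natCast ht.le]
    congr 1
    push_cast
    ring
  rw [le_div_iff₀ hden0]
  calc s ^ 2 * ((1 / 2 : ℝ) ^ (s - 1) - 1) ^ 2 * t ^ (-2 * s - 1) * |t - r| ^ (4 * s - 1)
      ≤ s ^ 2 * ((1 / 2 : ℝ) ^ (s - 1) - 1) ^ 2 * t ^ (-2 * s - 1) * t ^ (4 * s - 1) := by
        gcongr
    _ = s ^ 2 * (((1 / 2 : ℝ) ^ (s - 1) - 1) * t ^ (s - 1)) ^ 2 := by
        rw [mul_assoc, hexp]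
        ring
    _ ≤ s ^ 2 * (t ^ (s - 1) - r ^ (s - 1)) ^ 2 := by gcongr

/-- **Claim (divergence of the one-dimensional integral).** For `s ∈ (1/2,1)`,
`E = ∫₀¹∫₀¹ s²|t^{s−1} − r^{s−1}|²/|t−r|^{4s−1} dt dr = +∞`. -/
theorem one_dim_integral_diverges (s : ℝ) (hs : s ∈ Ioo (1 / 2 : ℝ) 1) :
    ∫⁻ t in Ioo (0 : ℝ) 1, ∫⁻ r in Ioo (0 : ℝ) 1,
        ENNReal.ofReal (s ^ 2 * (t ^ (s - 1) - r ^ (s - 1)) ^ 2 / |t - r| ^ (4 * s - 1)) = ⊤ := by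
  set K : ℝ := s ^ 2 * ((1 / 2 : ℝ) ^ (s - 1) - 1) ^ 2 with hK
  have hK0 : 0 < K := by
    have hc : 1 < (1 / 2 : ℝ) ^ (s - 1) :=
      Real.one_lt_rpow_of_pos_of_lt_one_of_neg (by norm_num) (by norm_num) (by linarith [hs.2])
    have hs0 : 0 < s := by linarith [hs.1]
    have := sub_pos.2 hc
    positivity
  rw [eq_top_iff]
  calc ⊤ = ENNReal.ofReal (K / 2) * ∫⁻ t in Ioo (0 : ℝ) 1, ENNReal.ofReal (t ^ (-2 * s)) := by
        rw [lintegral_Ioo_rpow_eq_top (by linarith [hs.1]), ENNReal.mul_top]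
        simpa using hK0
    _ = ∫⁻ t in Ioo (0 : ℝ) 1, ENNReal.ofReal (K / 2) * ENNReal.ofReal (t ^ (-2 * s)) :=
        (lintegral_const_mul' _ _ ENNReal.ofReal_ne_top).symm
    _ ≤ _ := by
        refine setLIntegral_mono' measurableSet_Ioo fun t ht => ?_
        calc ENNReal.ofReal (K / 2) * ENNReal.ofReal (t ^ (-2 * s))
            = ∫⁻ _ in Ioo (0 : ℝ) (t / 2), ENNReal.ofReal (K * t ^ (-2 * s - 1)) := by
              rw [setLIntegral_const, Real.volume_Ioo, ← ENNReal.ofReal_mul (by positivity),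
                ← ENNReal.ofReal_mul (mul_nonneg hK0.le (Real.rpow_nonneg ht.1.le _)),
                Real.rpow_sub_one ht.1.ne']
              congr 1
              have := ht.1.ne'
              field_simp
              ring
          _ ≤ ∫⁻ r in Ioo (0 : ℝ) (t / 2), ENNReal.ofReal
                (s ^ 2 * (t ^ (s - 1) - r ^ (s - 1)) ^ 2 / |t - r| ^ (4 * s - 1)) :=
              setLIntegral_mono' measurableSet_Ioo fun r hr =>
                ENNReal.ofReal_le_ofReal (rpow_le_sq_sub_div_rpow hs hr.1 hr.2)
          _ ≤ _ := lintegral_mono_set (Ioo_subset_Ioo_right (by linarith [ht.1, ht.2]))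
end
end

section
/- Let n ≥ 2 and s ∈ (0, 1/2). Let Q = B₁′ × (0,1) ⊂ ℝⁿ, where B₁′ is the open unit ball in ℝ^{n−1}, and let u_s(x) = (x_n)_+^s. Then ∫_Q ∫_Q |u_s(x) − u_s(y)|² / |x−y|^{n + 2(s + 1/2)} dx dy = +∞. In particular u_s ∉ H^{s+1/2}(Q), so u_s does not belong to H^{s+1/2}_loc of the closed half-space. -/
open MeasureTheory Set
open scoped ENNReal

noncomputable section

/-- The function `u_s(x) = (x_n)_+^s`. -/
def uFun (m : ℕ) (s : ℝ) (x : EuclideanSpace ℝ (Fin (m + 2))) : ℝ :=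
  max (x (Fin.last (m + 1))) 0 ^ s

lemma lintegral_inv_Ioo_zero_eq_top {a : ℝ} (ha : 0 < a) :
    ∫⁻ t in Ioo (0 : ℝ) a, ENNReal.ofReal t⁻¹ = ⊤ := by
  by_contra h
  have hint : IntegrableOn (fun t : ℝ => t⁻¹) (Ioo 0 a) := by
    refine ⟨measurable_inv.aestronglyMeasurable, ?_⟩
    rw [hasFiniteIntegral_iff_ofReal]
    · exact lt_top_iff_ne_top.2 h
    · filter_upwards [ae_restrict_mem measurableSet_Ioo] with t ht
      exact inv_nonneg.2 ht.1.le
  rw [← integrableOn_Ioc_iff_integrableOn_Ioo,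
    ← intervalIntegrable_iff_integrableOn_Ioc_of_le ha.le, intervalIntegrable_inv_iff] at hint
  rcases hint with h0 | h0
  · exact ha.ne h0
  · exact h0 left_mem_uIcc

/-- The integral of `1 / x_i` over a box whose `i`-th side is `(0, a)` diverges. -/
lemma setLIntegral_inv_apply_pi_eq_top {ι : Type*} [Fintype ι] (i : ι) (I : ι → Set ℝ)
    (hI : ∀ j, volume (I j) ≠ 0) (hfin : ∀ j, volume (I j) ≠ ⊤) {a : ℝ} (ha : 0 < a)
    (hi : I i = Ioo 0 a) :
    ∫⁻ x in {x : EuclideanSpace ℝ ι | ∀ j, x j ∈ I j}, ENNReal.ofReal (x i)⁻¹ = ⊤ := by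
  classical
  have hset : {x : EuclideanSpace ℝ ι | ∀ j, x j ∈ I j} =
      (MeasurableEquiv.toLp 2 (ι → ℝ)).symm ⁻¹' (univ.pi I) := by
    ext x
    simp
  have hmp := EuclideanSpace.volume_preserving_symm_measurableEquiv_toLp ι
  have h1 := hmp.setLIntegral_comp_preimage_emb (MeasurableEquiv.measurableEmbedding _)
    (fun y : ι → ℝ => ENNReal.ofReal (y i)⁻¹) (univ.pi I)
  have h2 : ∫⁻ y in univ.pi I, ENNReal.ofReal (y i)⁻¹ = ⊤ := by
    have : ∀ j, IsFiniteMeasure ((volume : Measure ℝ).restrict (I j)) := fun j =>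
      ⟨by simpa using (hfin j).lt_top⟩
    rw [volume_pi, Measure.restrict_pi_pi]
    have hm : Measurable fun t : ℝ => ENNReal.ofReal t⁻¹ := by fun_prop
    have h3 := lintegral_map (μ := Measure.pi fun j => (volume : Measure ℝ).restrict (I j)) hm
      (measurable_pi_apply i)
    rw [Measure.pi_map_eval, lintegral_smul_measure, hi, lintegral_inv_Ioo_zero_eq_top ha] at h3
    rw [← h3, smul_eq_mul]
    refine ENNReal.mul_top (Finset.prod_ne_zero_iff.2 fun j _ => ?_)
    simpa using hI j
  rw [← h2, ← h1, hset]
  rfl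

lemma euclidean_sum_sq_castSucc_le {n : ℕ} (z : EuclideanSpace ℝ (Fin (n + 1))) :
    ∑ i : Fin n, z i.castSucc ^ 2 ≤ ‖z‖ ^ 2 := by
  rw [EuclideanSpace.real_norm_sq_eq, Fin.sum_univ_castSucc]
  exact le_add_of_nonneg_right (sq_nonneg _)

/-- The upward shift of `x` by its own height. -/
def raise {m : ℕ} (x : EuclideanSpace ℝ (Fin (m + 2))) : EuclideanSpace ℝ (Fin (m + 2)) :=
  x + EuclideanSpace.single (Fin.last (m + 1)) (x (Fin.last (m + 1)))

section ball

variable {m : ℕ} {x y : EuclideanSpace ℝ (Fin (m + 2))}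

lemma abs_sub_two_mul_last_lt
    (hy : y ∈ Metric.ball (raise x) (x (Fin.last (m + 1)) / 4)) :
    |y (Fin.last (m + 1)) - 2 * x (Fin.last (m + 1))| < x (Fin.last (m + 1)) / 4 := by
  have h := PiLp.norm_apply_le (y - raise x) (Fin.last (m + 1))
  have e : (y - raise x) (Fin.last (m + 1)) =
      y (Fin.last (m + 1)) - 2 * x (Fin.last (m + 1)) := by
    simp [raise]; ring
  rw [e, Real.norm_eq_abs] at h
  exact h.trans_lt (by simpa [dist_eq_norm] using hy)

lemma norm_sub_le_of_mem_ball_raise (h0 : 0 < x (Fin.last (m + 1)))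
    (hy : y ∈ Metric.ball (raise x) (x (Fin.last (m + 1)) / 4)) :
    ‖x - y‖ ≤ 5 / 4 * x (Fin.last (m + 1)) := by
  have h1 : ‖x - raise x‖ = x (Fin.last (m + 1)) := by
    simp [raise, abs_of_pos h0]
  have h2 : ‖y - raise x‖ < x (Fin.last (m + 1)) / 4 := by simpa [dist_eq_norm] using hy
  have h3 := norm_sub_le (x - raise x) (y - raise x)
  rw [sub_sub_sub_cancel_right] at h3
  linarith

lemma ball_raise_subset_cyl (hx : ∑ i : Fin (m + 1), x i.castSucc ^ 2 ≤ 1 / 4)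
    (h0 : x (Fin.last (m + 1)) ∈ Ioo (0 : ℝ) (1 / 4)) :
    Metric.ball (raise x) (x (Fin.last (m + 1)) / 4) ⊆ cyl m := by
  intro y hy
  have h := abs_lt.1 (abs_sub_two_mul_last_lt hy)
  obtain ⟨h0, h1⟩ := h0
  refine ⟨?_, by linarith, by linarith⟩
  have hz := euclidean_sum_sq_castSucc_le (y - raise x)
  have hn : ‖y - raise x‖ < x (Fin.last (m + 1)) / 4 := by simpa [dist_eq_norm] using hy
  have hsum : ∑ i : Fin (m + 1), y i.castSucc ^ 2 ≤
      2 * ∑ i : Fin (m + 1), x i.castSucc ^ 2 +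
        2 * ∑ i : Fin (m + 1), (y - raise x) i.castSucc ^ 2 := by
    rw [Finset.mul_sum, Finset.mul_sum, ← Finset.sum_add_distrib]
    refine Finset.sum_le_sum fun i _ => ?_
    have e : (y - raise x) i.castSucc = y i.castSucc - x i.castSucc := by
      simp [raise, Fin.castSucc_ne_last]
    rw [e]
    nlinarith [sq_nonneg (y i.castSucc - 2 * x i.castSucc)]
  nlinarith [norm_nonneg (y - raise x)]

lemma le_gagliardo_of_mem_ball_raise {s p : ℝ} (hs : 0 < s) (hp : 0 ≤ p)
    (h0 : 0 < x (Fin.last (m + 1)))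
    (hy : y ∈ Metric.ball (raise x) (x (Fin.last (m + 1)) / 4)) :
    (((7 / 4 : ℝ) ^ s - 1) * x (Fin.last (m + 1)) ^ s) ^ 2 / (5 / 4 * x (Fin.last (m + 1))) ^ p ≤
      (uFun m s x - uFun m s y) ^ 2 / ‖x - y‖ ^ p := by
  set t := x (Fin.last (m + 1)) with ht
  have h := abs_lt.1 (abs_sub_two_mul_last_lt hy)
  rw [← ht] at h
  have hyt : 7 / 4 * t ≤ y (Fin.last (m + 1)) := by linarith
  have hne : 0 < ‖x - y‖ := by
    rw [norm_pos_iff, sub_ne_zero]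
    rintro rfl
    linarith
  have h1 : (1 : ℝ) ≤ (7 / 4 : ℝ) ^ s := Real.one_le_rpow (by norm_num) hs.le
  have h2 : (7 / 4 : ℝ) ^ s * t ^ s ≤ y (Fin.last (m + 1)) ^ s := by
    rw [← Real.mul_rpow (by norm_num) h0.le]
    exact Real.rpow_le_rpow (by positivity) hyt hs.le
  have h3 : uFun m s x = t ^ s := by rw [uFun, max_eq_left h0.le]
  have h4 : uFun m s y = y (Fin.last (m + 1)) ^ s := by
    rw [uFun, max_eq_left (by linarith)]
  have h5 : 0 ≤ ((7 / 4 : ℝ) ^ s - 1) * t ^ s :=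
    mul_nonneg (by linarith) (Real.rpow_nonneg h0.le _)
  rw [h3, h4, sub_sq_comm]
  refine div_le_div₀ (sq_nonneg _) (pow_le_pow_left₀ h5 (by linarith) 2)
    (Real.rpow_pos_of_pos hne _) ?_
  exact Real.rpow_le_rpow hne.le (norm_sub_le_of_mem_ball_raise h0 hy) hp

end ball

lemma scaling_identity {m : ℕ} {s t : ℝ} (A : ℝ) (ht : 0 < t) :
    (A * t ^ s) ^ 2 / (5 / 4 * t) ^ (((m : ℝ) + 2) + 2 * (s + 1 / 2)) * (t / 4) ^ (m + 2) =
      A ^ 2 / (5 / 4 : ℝ) ^ (((m : ℝ) + 2) + 2 * (s + 1 / 2)) / 4 ^ (m + 2) * t⁻¹ := by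
  have e : t ^ (((m : ℝ) + 2) + 2 * (s + 1 / 2)) = t ^ (m + 2) * (t ^ s) ^ 2 * t := by
    rw [show ((m : ℝ) + 2) + 2 * (s + 1 / 2) = ((m + 2 : ℕ) : ℝ) + (s + s) + 1 by
      push_cast; ring, Real.rpow_add ht, Real.rpow_add ht, Real.rpow_natCast, Real.rpow_one,
      Real.rpow_add ht, sq]
  have h1 : 0 < t ^ s := Real.rpow_pos_of_pos ht s
  have h2 : 0 < (5 / 4 : ℝ) ^ (((m : ℝ) + 2) + 2 * (s + 1 / 2)) := by positivity
  rw [Real.mul_rpow (by norm_num) ht.le, e, div_pow]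
  field_simp

/-- The inner Gagliardo integral at height `t` is bounded below by a multiple of `1 / t`. -/
lemma const_mul_inv_le_setLIntegral_cyl {m : ℕ} {s : ℝ} (hs : 0 < s)
    {x : EuclideanSpace ℝ (Fin (m + 2))} (hx : ∑ i : Fin (m + 1), x i.castSucc ^ 2 ≤ 1 / 4)
    (h0 : x (Fin.last (m + 1)) ∈ Ioo (0 : ℝ) (1 / 4)) :
    ENNReal.ofReal (((7 / 4 : ℝ) ^ s - 1) ^ 2 /
        (5 / 4 : ℝ) ^ (((m : ℝ) + 2) + 2 * (s + 1 / 2)) / 4 ^ (m + 2)) *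
      volume (Metric.ball (0 : EuclideanSpace ℝ (Fin (m + 2))) 1) *
        ENNReal.ofReal (x (Fin.last (m + 1)))⁻¹ ≤
      ∫⁻ y in cyl m, ENNReal.ofReal ((uFun m s x - uFun m s y) ^ 2 /
        ‖x - y‖ ^ (((m : ℝ) + 2) + 2 * (s + 1 / 2))) := by
  refine le_trans ?_ (lintegral_mono_set (ball_raise_subset_cyl hx h0))
  refine le_trans ?_ (setLIntegral_mono' measurableSet_ball fun y hy =>
    ENNReal.ofReal_le_ofReal (le_gagliardo_of_mem_ball_raise hs (by positivity) h0.1 hy))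
  have ht := h0.1
  rw [setLIntegral_const, Measure.addHaar_ball _ (raise x) (by positivity),
    finrank_euclideanSpace_fin,
    ← mul_assoc, ← ENNReal.ofReal_mul (by positivity), scaling_identity _ ht,
    ENNReal.ofReal_mul (by positivity)]
  exact le_of_eq (by ring)

@[fun_prop]
lemma measurable_uFun (m : ℕ) (s : ℝ) : Measurable (uFun m s) := by
  unfold uFun
  fun_prop

/-- **Proposition (optimality, `s < 1/2`).** For `s ∈ (0,1/2)` the Gagliardo double integral
of order `s + 1/2` of `u_s(x) = (x_n)_+^s` on the cylinder `Q` diverges; hence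
`u_s ∉ H^{s+1/2}(Q)`. -/
theorem us_not_in_Hs_half {m : ℕ} (s : ℝ) (hs : s ∈ Ioo (0 : ℝ) (1 / 2)) :
    ∫⁻ q in cyl m ×ˢ cyl m,
        ENNReal.ofReal ((uFun m s q.1 - uFun m s q.2) ^ 2 /
          ‖q.1 - q.2‖ ^ (((m : ℝ) + 2) + 2 * (s + 1 / 2))) = ⊤ := by
  have hmeas : Measurable fun q : EuclideanSpace ℝ (Fin (m + 2)) × EuclideanSpace ℝ (Fin (m + 2)) =>
      ENNReal.ofReal ((uFun m s q.1 - uFun m s q.2) ^ 2 /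
        ‖q.1 - q.2‖ ^ (((m : ℝ) + 2) + 2 * (s + 1 / 2))) := by
    fun_prop
  rw [Measure.volume_eq_prod, setLIntegral_prod _ hmeas.aemeasurable]
  set δ : ℝ := 1 / (2 * ((m : ℝ) + 1)) with hδ
  have hδ0 : 0 < δ := by positivity
  let I : Fin (m + 2) → Set ℝ := fun j =>
    if j = Fin.last (m + 1) then Ioo 0 (1 / 4) else Ioo (-δ) δ
  have hIlast : I (Fin.last (m + 1)) = Ioo 0 (1 / 4) := if_pos rfl
  have hIcast (i : Fin (m + 1)) : I i.castSucc = Ioo (-δ) δ := if_neg i.castSucc_ne_last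
  set box := {x : EuclideanSpace ℝ (Fin (m + 2)) | ∀ j, x j ∈ I j} with hbox
  have hsum {x} (hx : x ∈ box) : ∑ i : Fin (m + 1), x i.castSucc ^ 2 ≤ 1 / 4 := by
    calc ∑ i : Fin (m + 1), x i.castSucc ^ 2 ≤ ∑ _i : Fin (m + 1), δ ^ 2 := by
          refine Finset.sum_le_sum fun i _ => ?_
          have := hx i.castSucc
          rw [hIcast] at this
          exact sq_le_sq' this.1.le this.2.le
      _ = 1 / (4 * ((m : ℝ) + 1)) := by
          simp only [Finset.sum_const, Finset.card_univ, Fintype.card_fin, nsmul_eq_mul, hδ]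
          push_cast
          field_simp
          norm_num
      _ ≤ 1 / 4 := one_div_le_one_div_of_le (by norm_num) (by linarith [m.cast_nonneg (α := ℝ)])
  have hlast {x} (hx : x ∈ box) : x (Fin.last (m + 1)) ∈ Ioo (0 : ℝ) (1 / 4) := by
    simpa only [hIlast] using hx (Fin.last (m + 1))
  have hboxmeas : MeasurableSet box := by
    have : box = ⋂ j, (fun x : EuclideanSpace ℝ (Fin (m + 2)) => x j) ⁻¹' I j := by
      ext x; simp [hbox]
    rw [this]
    refine MeasurableSet.iInter fun j => ?_
    have hj : MeasurableSet (I j) := by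
      simp only [I]; split_ifs <;> exact measurableSet_Ioo
    exact (by fun_prop : Measurable fun x : EuclideanSpace ℝ (Fin (m + 2)) => x j) hj
  have hsub : box ⊆ cyl m := fun x hx =>
    ⟨(hsum hx).trans_lt (by norm_num), (hlast hx).1, (hlast hx).2.trans (by norm_num)⟩
  have htop := setLIntegral_inv_apply_pi_eq_top (Fin.last (m + 1)) I
    (fun j => by simp only [I]; split_ifs <;> simp [hδ0])
    (fun j => by simp only [I]; split_ifs <;> simp) (by norm_num) hIlast
  refine top_le_iff.1 (le_trans ?_ ((setLIntegral_mono' hboxmeas fun x hx =>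
    const_mul_inv_le_setLIntegral_cyl hs.1 (hsum hx) (hlast hx)).trans (lintegral_mono_set hsub)))
  have h1 : (1 : ℝ) < (7 / 4 : ℝ) ^ s := Real.one_lt_rpow (by norm_num) hs.1
  have h2 : 0 < (7 / 4 : ℝ) ^ s - 1 := by linarith
  rw [lintegral_const_mul _ (by fun_prop), htop, ENNReal.mul_top]
  refine mul_ne_zero (ENNReal.ofReal_pos.2 (by positivity)).ne' ?_
  exact (Metric.measure_ball_pos _ _ one_pos).ne'
end
end
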